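/- For every real ε with 0 < ε < 1/4 there exists a constant C > 0 such that for all sufficiently large n, the number of integers m in the interval [n^(1/2−2ε), 4·n^(1/2−2ε)] satisfying max over reals y ≤ n/2 of max over residues a with gcd(a, m) = 1 of |ψ(y; m, a) − y/φ(m)| ≥ n/(10m) is at most C · n^(1/2−2ε) / (log n)³. -/

import Mathlib

/-- `ψ(y; m, a) = Σ_{n ≤ y, n ≡ a (mod m)} Λ(n)`, where `Λ` is the von Mangoldt function. -/
noncomputable def psi (y : ℝ) (m a : ℕ) : ℝ :=
  ∑ n ∈ Finset.Icc 1 ⌊y⌋₊,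
    if n % m = a % m then ArithmeticFunction.vonMangoldt n else 0

section

open Finset

open Finset in
/-- `addExp t = exp (2 * π * i * t)`. -/
noncomputable def addExp (t : ℝ) : ℂ := Complex.exp (2 * Real.pi * Complex.I * t)

namespace addExp

lemma add (s t : ℝ) : addExp (s + t) = addExp s * addExp t := by
  unfold addExp; rw [← Complex.exp_add]; push_cast; ring_nf

lemma natCast_mul (n : ℕ) (t : ℝ) : addExp (n * t) = addExp t ^ n := by
  unfold addExp; rw [← Complex.exp_nat_mul]; push_cast; ring_nf

lemma intCast (k : ℤ) : addExp k = 1 := by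
  unfold addExp
  rw [show (2 * Real.pi * Complex.I * ((k : ℝ) : ℂ)) = k * (2 * Real.pi * Complex.I) by push_cast; ring]
  exact Complex.exp_int_mul_two_pi_mul_I k

lemma norm_eq_one (t : ℝ) : ‖addExp t‖ = 1 := by
  unfold addExp
  rw [show (2 * Real.pi * Complex.I * (t : ℂ)) = ((2 * Real.pi * t : ℝ) : ℂ) * Complex.I by push_cast; ring]
  exact Complex.norm_exp_ofReal_mul_I _

lemma conj (t : ℝ) : (starRingEnd ℂ) (addExp t) = addExp (-t) := by
  unfold addExp
  rw [← Complex.exp_conj]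
  congr 1
  simp [Complex.conj_ofReal, Complex.conj_ofNat]

lemma norm_sub_one (t : ℝ) : ‖addExp t - 1‖ = 2 * |Real.sin (Real.pi * t)| := by
  have h : addExp t = Complex.exp (Complex.I * ((2 * Real.pi * t : ℝ) : ℂ)) := by
    unfold addExp; congr 1; push_cast; ring
  rw [h, Complex.norm_exp_I_mul_ofReal_sub_one]
  rw [Real.norm_eq_abs, abs_mul, abs_two]
  congr 3; ring

lemma four_mul_abs_le (t : ℝ) (ht : |t| ≤ 1 / 2) : 4 * |t| ≤ ‖addExp t - 1‖ := by
  rw [norm_sub_one]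
  have h1 : |Real.sin (Real.pi * t)| = Real.sin (Real.pi * |t|) := by
    rcases le_total 0 t with h | h
    · rw [abs_of_nonneg h] at ht ⊢
      apply abs_of_nonneg
      apply Real.sin_nonneg_of_nonneg_of_le_pi
      · positivity
      · nlinarith [Real.pi_pos]
    · rw [abs_of_nonpos h] at ht ⊢
      rw [mul_neg, Real.sin_neg]
      apply abs_of_nonpos
      apply Real.sin_nonpos_of_nonpos_of_neg_pi_le
      · nlinarith [Real.pi_pos]
      · nlinarith [Real.pi_pos]
  rw [h1]
  have h2 := Real.mul_le_sin (x := Real.pi * |t|) (by positivity) (by nlinarith [Real.pi_pos])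
  have h3 : 2 / Real.pi * (Real.pi * |t|) = 2 * |t| := by field_simp
  linarith

end addExp

lemma norm_sum_addExp_le_card (N : ℕ) (t : ℝ) : ‖∑ n ∈ range N, addExp (n * t)‖ ≤ N := by
  refine (norm_sum_le _ _).trans ?_
  simp [addExp.norm_eq_one]

lemma norm_sum_addExp_le (N : ℕ) (t : ℝ) (h0 : t ≠ 0) (ht : |t| ≤ 1 / 2) :
    ‖∑ n ∈ range N, addExp (n * t)‖ ≤ 1 / (2 * |t|) := by
  have h4 := addExp.four_mul_abs_le t ht
  have hpos : 0 < |t| := abs_pos.mpr h0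
  have hne : addExp t ≠ 1 := by
    intro h; rw [h] at h4; simp only [sub_self, norm_zero] at h4; linarith
  simp_rw [addExp.natCast_mul]
  rw [geom_sum_eq hne, norm_div, div_le_div_iff₀ (by linarith) (by positivity)]
  have : ‖addExp t ^ N - 1‖ ≤ 2 := by
    refine (norm_sub_le _ _).trans ?_
    rw [norm_pow, addExp.norm_eq_one]; norm_num
  nlinarith [norm_nonneg (addExp t ^ N - 1)]

lemma norm_sum_addExp_sub_int (N : ℕ) (t : ℝ) (k : ℤ) :
    ∑ n ∈ range N, addExp (n * (t - k)) = ∑ n ∈ range N, addExp (n * t) := by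
  apply sum_congr rfl
  intro n _
  have : (n * t : ℝ) = n * (t - k) + ((n * k : ℤ) : ℝ) := by push_cast; ring
  rw [this, addExp.add, addExp.intCast, mul_one]

/-- The dual (Schur test) form of the large sieve. -/
lemma large_sieve_of_row_bound {ι : Type*} (s : Finset ι) (α : ι → ℝ) (N : ℕ) (B : ℝ)
    (hB0 : 0 ≤ B) (hB : ∀ r ∈ s, ∑ t ∈ s, ‖∑ n ∈ range N, addExp (n * (α r - α t))‖ ≤ B) (a : ℕ → ℂ) :
    ∑ r ∈ s, ‖∑ n ∈ range N, a n * addExp (n * α r)‖ ^ 2 ≤ B * ∑ n ∈ range N, ‖a n‖ ^ 2 := by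
  set S : ι → ℂ := fun r => ∑ n ∈ range N, a n * addExp (n * α r) with hS
  set X : ℝ := ∑ r ∈ s, ‖S r‖ ^ 2 with hX
  set T : ℕ → ℂ := fun n => ∑ r ∈ s, (starRingEnd ℂ) (S r) * addExp (n * α r) with hT
  have hX0 : 0 ≤ X := sum_nonneg fun _ _ => by positivity
  have hA0 : 0 ≤ ∑ n ∈ range N, ‖a n‖ ^ 2 := sum_nonneg fun _ _ => by positivity
  have e1 : (X : ℂ) = ∑ n ∈ range N, a n * T n := by
    simp only [hX, hT, mul_sum]
    push_cast
    rw [sum_comm]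
    apply sum_congr rfl
    intro r _
    rw [← Complex.conj_mul', hS]
    simp only [mul_sum]
    apply sum_congr rfl
    intro n _
    ring
  have e2 : X ≤ ∑ n ∈ range N, ‖a n‖ * ‖T n‖ := by
    have : ‖(X : ℂ)‖ = X := by rw [Complex.norm_real, Real.norm_of_nonneg hX0]
    rw [← this, e1]
    refine (norm_sum_le _ _).trans ?_
    simp
  have e3 : X ^ 2 ≤ (∑ n ∈ range N, ‖a n‖ ^ 2) * ∑ n ∈ range N, ‖T n‖ ^ 2 :=
    (pow_le_pow_left₀ hX0 e2 2).trans (sum_mul_sq_le_sq_mul_sq _ _ _)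
  have e4 : ((∑ n ∈ range N, ‖T n‖ ^ 2 : ℝ) : ℂ) =
      ∑ r ∈ s, ∑ t ∈ s, (starRingEnd ℂ) (S r) * S t * ∑ n ∈ range N, addExp (n * (α r - α t)) := by
    push_cast
    simp_rw [mul_sum]
    rw [sum_congr rfl (fun r _ => sum_comm), sum_comm]
    apply sum_congr rfl
    intro n _
    rw [← Complex.mul_conj', hT]
    simp only [map_sum, sum_mul_sum, map_mul, Complex.conj_conj]
    apply sum_congr rfl; intro r _
    apply sum_congr rfl; intro t _
    rw [addExp.conj, mul_sub, sub_eq_add_neg, addExp.add]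
    ring
  have e5 : ∑ n ∈ range N, ‖T n‖ ^ 2 ≤ B * X := by
    have h0 : 0 ≤ ∑ n ∈ range N, ‖T n‖ ^ 2 := sum_nonneg fun _ _ => by positivity
    have h1 : ‖((∑ n ∈ range N, ‖T n‖ ^ 2 : ℝ) : ℂ)‖ = ∑ n ∈ range N, ‖T n‖ ^ 2 := by
      rw [Complex.norm_real, Real.norm_of_nonneg h0]
    set K : ι → ι → ℝ := fun r t => ‖∑ n ∈ range N, addExp (n * (α r - α t))‖ with hK
    have hsymm : ∀ r t, K r t = K t r := by
      intro r t
      simp only [hK]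
      rw [← Complex.norm_conj, map_sum]
      congr 1; apply sum_congr rfl; intro n _
      rw [addExp.conj]; congr 1; ring
    rw [← h1, e4]
    calc _ ≤ ∑ r ∈ s, ∑ t ∈ s, (‖S r‖ ^ 2 * K r t / 2 + ‖S t‖ ^ 2 * K t r / 2) := by
            refine (norm_sum_le _ _).trans (sum_le_sum fun r _ => (norm_sum_le _ _).trans
              (sum_le_sum fun t _ => ?_))
            rw [norm_mul, norm_mul, Complex.norm_conj, ← hsymm r t]
            have := norm_nonneg (∑ n ∈ range N, addExp (n * (α r - α t)))
            nlinarith [mul_nonneg (sq_nonneg (‖S r‖ - ‖S t‖)) this]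
      _ = ∑ r ∈ s, ‖S r‖ ^ 2 * ∑ t ∈ s, K r t := by
            simp_rw [sum_add_distrib]
            rw [sum_comm (f := fun r t => ‖S t‖ ^ 2 * K t r / 2), ← sum_add_distrib]
            apply sum_congr rfl; intro r _
            rw [← sum_add_distrib, mul_sum]
            apply sum_congr rfl; intro t _; ring
      _ ≤ ∑ r ∈ s, ‖S r‖ ^ 2 * B := sum_le_sum fun r hr => by
            gcongr; exact hB r hr
      _ = B * X := by rw [← sum_mul, mul_comm]
  have e6 : X ^ 2 ≤ (∑ n ∈ range N, ‖a n‖ ^ 2) * (B * X) := e3.trans (by gcongr)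
  rcases hX0.eq_or_lt with h | h
  · rw [← h]; positivity
  · have : X * X ≤ (B * ∑ n ∈ range N, ‖a n‖ ^ 2) * X := by nlinarith
    exact le_of_mul_le_mul_right this h

lemma sum_inv_le_one_add_log (n : ℕ) : ∑ i ∈ range n, (1 : ℝ) / (i + 1) ≤ 1 + Real.log n := by
  have := harmonic_le_one_add_log n
  unfold harmonic at this
  push_cast at this
  simpa [one_div] using this

lemma sum_Icc_neg_natAbs_le (Q : ℕ) (g : ℕ → ℝ) (hg : ∀ n, 0 ≤ g n) :
    ∑ k ∈ Icc (-(Q : ℤ)) Q, g k.natAbs ≤ 2 * ∑ j ∈ range (Q + 1), g j := by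
  have hsub : Icc (-(Q : ℤ)) Q ⊆ (range (Q + 1)).image (fun j : ℕ => (j : ℤ)) ∪
      (range (Q + 1)).image (fun j : ℕ => -(j : ℤ)) := by
    intro k hk
    rw [mem_Icc] at hk
    rw [mem_union, mem_image, mem_image]
    rcases le_total 0 k with h | h
    · left; exact ⟨k.natAbs, by rw [mem_range]; omega, by omega⟩
    · right; exact ⟨k.natAbs, by rw [mem_range]; omega, by omega⟩
  refine (sum_le_sum_of_subset_of_nonneg hsub fun _ _ _ => hg _).trans ?_
  have h1 := sum_union_inter (s₁ := (range (Q + 1)).image (fun j : ℕ => (j : ℤ)))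
    (s₂ := (range (Q + 1)).image (fun j : ℕ => -(j : ℤ))) (f := fun k => g k.natAbs)
  have h2 : 0 ≤ ∑ k ∈ (range (Q + 1)).image (fun j : ℕ => (j : ℤ)) ∩
      (range (Q + 1)).image (fun j : ℕ => -(j : ℤ)), g k.natAbs := sum_nonneg fun _ _ => hg _
  rw [sum_image (by intro a _ b _ h; simpa using h), sum_image (by intro a _ b _ h; simpa using h)] at h1
  simp only [Int.natAbs_natCast, Int.natAbs_neg] at h1
  linarith

lemma row_bound_of_separated {ι : Type*} [DecidableEq ι] (s : Finset ι) (α : ι → ℝ) (N Q : ℕ) (hQ : 1 ≤ Q)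
    (hsep : ∀ r ∈ s, ∀ t ∈ s, r ≠ t → ∀ k : ℤ, 1 / (Q : ℝ) ≤ |α r - α t - k|) (r : ι) (hr : r ∈ s) :
    ∑ t ∈ s, ‖∑ n ∈ range N, addExp (n * (α r - α t))‖ ≤ N + 3 * Q * (1 + Real.log (Q + 1)) := by
  have hQ0 : (0 : ℝ) < Q := by exact_mod_cast hQ
  rw [← add_sum_erase s _ hr]
  refine add_le_add (norm_sum_addExp_le_card _ _) ?_
  set τ : ι → ℝ := fun t => (α r - α t) - round (α r - α t) with hτ
  set f : ι → ℤ := fun t => ⌊τ t * Q⌋ with hf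
  have hτ2 : ∀ t, |τ t| ≤ 1 / 2 := fun t => abs_sub_round _
  have hτ1 : ∀ t ∈ s.erase r, 1 / (Q : ℝ) ≤ |τ t| := by
    intro t ht
    rw [mem_erase] at ht
    exact hsep r hr t ht.2 (Ne.symm ht.1) _
  have hinj : Set.InjOn f (s.erase r) := by
    intro t ht u hu h
    simp only [coe_erase, Set.mem_sdiff, mem_coe, Set.mem_singleton_iff] at ht hu
    by_contra hne
    have h1 := Int.abs_sub_lt_one_of_floor_eq_floor h
    have h2 := hsep u hu.1 t ht.1 (Ne.symm hne) (round (α r - α t) - round (α r - α u))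
    rw [← sub_mul, abs_mul, abs_of_pos hQ0] at h1
    have h3 : τ t - τ u = α u - α t - ((round (α r - α t) - round (α r - α u) : ℤ) : ℝ) := by
      simp only [hτ]; push_cast; ring
    rw [h3] at h1
    rw [div_le_iff₀ hQ0] at h2
    linarith
  have hmem : ∀ t ∈ s.erase r, f t ∈ Icc (-(Q : ℤ)) Q := by
    intro t _
    have := abs_le.mp (hτ2 t)
    rw [mem_Icc]
    constructor
    · apply Int.le_floor.mpr; push_cast; nlinarith
    · have : τ t * Q ≤ (Q : ℤ) := by push_cast; nlinarith
      exact_mod_cast (Int.floor_le _).trans this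
  have hbd : ∀ t ∈ s.erase r, ‖∑ n ∈ range N, addExp (n * (α r - α t))‖ ≤
      3 * Q / 2 * (1 / (((f t).natAbs : ℝ) + 1)) := by
    intro t ht
    have h1 := hτ1 t ht
    have h0 : 0 < |τ t| := lt_of_lt_of_le (by positivity) h1
    rw [← norm_sum_addExp_sub_int N _ (round (α r - α t))]
    refine (norm_sum_addExp_le N _ (abs_pos.mp h0) (hτ2 t)).trans ?_
    rw [div_mul_div_comm, div_le_div_iff₀ (by positivity) (by positivity)]
    have hfl := Int.floor_le (τ t * Q)
    have hfl2 := Int.lt_floor_add_one (τ t * Q)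
    have hnat : ((f t).natAbs : ℝ) = |((f t : ℤ) : ℝ)| := by
      rw [Nat.cast_natAbs]; push_cast; rfl
    rw [hnat]
    rw [div_le_iff₀ hQ0] at h1
    have key : |((f t : ℤ) : ℝ)| ≤ |τ t| * Q + 1 := by
      have : |((f t : ℤ) : ℝ) - τ t * Q| ≤ 1 := by
        rw [abs_le]; constructor <;> simp only [hf] <;> linarith
      have h5 := abs_sub_abs_le_abs_sub ((f t : ℤ) : ℝ) (τ t * Q)
      rw [abs_mul, abs_of_pos hQ0] at h5
      linarith
    change 1 * (2 * (|((f t : ℤ) : ℝ)| + 1)) ≤ 3 * ↑Q * 1 * (2 * |τ t|)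
    nlinarith
  calc _ ≤ ∑ t ∈ s.erase r, 3 * Q / 2 * (1 / (((f t).natAbs : ℝ) + 1)) := sum_le_sum hbd
    _ = ∑ k ∈ (s.erase r).image f, 3 * (Q : ℝ) / 2 * (1 / ((k.natAbs : ℝ) + 1)) := by
        rw [sum_image hinj]
    _ ≤ ∑ k ∈ Icc (-(Q : ℤ)) Q, 3 * (Q : ℝ) / 2 * (1 / ((k.natAbs : ℝ) + 1)) := by
        apply sum_le_sum_of_subset_of_nonneg
        · intro k hk
          rw [mem_image] at hk
          obtain ⟨t, ht, rfl⟩ := hk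
          exact hmem t ht
        · intros; positivity
    _ ≤ 2 * ∑ j ∈ range (Q + 1), 3 * (Q : ℝ) / 2 * (1 / ((j : ℝ) + 1)) :=
        sum_Icc_neg_natAbs_le Q (fun j => 3 * (Q : ℝ) / 2 * (1 / ((j : ℝ) + 1))) (by intros; positivity)
    _ = 3 * Q * ∑ j ∈ range (Q + 1), 1 / ((j : ℝ) + 1) := by rw [← mul_sum]; ring
    _ ≤ 3 * Q * (1 + Real.log (Q + 1)) := by
        have := sum_inv_le_one_add_log (Q + 1)
        push_cast at this
        gcongr

/-- The additive large sieve inequality for well separated points. -/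
lemma large_sieve_of_separated {ι : Type*} [DecidableEq ι] (s : Finset ι) (α : ι → ℝ) (N Q : ℕ) (hQ : 1 ≤ Q)
    (hsep : ∀ r ∈ s, ∀ t ∈ s, r ≠ t → ∀ k : ℤ, 1 / (Q : ℝ) ≤ |α r - α t - k|) (a : ℕ → ℂ) :
    ∑ r ∈ s, ‖∑ n ∈ range N, a n * addExp (n * α r)‖ ^ 2 ≤
      (N + 3 * Q * (1 + Real.log (Q + 1))) * ∑ n ∈ range N, ‖a n‖ ^ 2 := by
  have : 0 ≤ Real.log ((Q : ℝ) + 1) := Real.log_nonneg (by linarith [Nat.cast_nonneg (α := ℝ) Q])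
  exact large_sieve_of_row_bound s α N _ (by positivity)
    (fun r hr => row_bound_of_separated s α N Q hQ hsep r hr) a

/-- The finite set of primitive Dirichlet characters modulo `q`. -/
noncomputable def primChars (q : ℕ) : Finset (DirichletCharacter ℂ q) :=
  (Set.toFinite {χ : DirichletCharacter ℂ q | χ.IsPrimitive}).toFinset

lemma mem_primChars {q : ℕ} {χ : DirichletCharacter ℂ q} : χ ∈ primChars q ↔ χ.IsPrimitive := by
  simp [primChars]

section gauss

lemma char_inv_apply_eq_conj {q : ℕ} (χ : DirichletCharacter ℂ q) (a : ZMod q) :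
    χ⁻¹ a = (starRingEnd ℂ) (χ a) := by
  rw [← MulChar.star_eq_inv, MulChar.star_apply]; rfl

variable {q : ℕ} [NeZero q]

lemma norm_char_inv_apply (χ : DirichletCharacter ℂ q) (a : ZMod q) : ‖χ⁻¹ a‖ = ‖χ a‖ := by
  by_cases h : IsUnit a
  · obtain ⟨u, rfl⟩ := h
    rw [DirichletCharacter.unit_norm_eq_one, DirichletCharacter.unit_norm_eq_one]
  · rw [MulChar.map_nonunit _ h, MulChar.map_nonunit _ h]

lemma conj_stdAddChar (a : ZMod q) :
    (starRingEnd ℂ) (ZMod.stdAddChar a) = ZMod.stdAddChar (-a) := by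
  rw [AddChar.map_neg_eq_conj]

lemma norm_gaussSum_sq {χ : DirichletCharacter ℂ q} (hχ : χ.IsPrimitive) :
    ‖gaussSum χ ZMod.stdAddChar‖ ^ 2 = q := by
  set G := gaussSum χ (ZMod.stdAddChar (N := q)) with hG
  have h1 : ∀ a : ZMod q, ∑ b, χ b * ZMod.stdAddChar (a * b) = χ⁻¹ a * G := fun a =>
    gaussSum_mulShift_of_isPrimitive (ZMod.stdAddChar (N := q)) hχ a
  set P : ℝ := ∑ a : ZMod q, ‖χ a‖ ^ 2 with hP
  have hP0 : 0 < P := by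
    apply sum_pos' (fun _ _ => by positivity) ⟨1, mem_univ _, by simp⟩
  have h2 : ((P * ‖G‖ ^ 2 : ℝ) : ℂ) = ((q * P : ℝ) : ℂ) := by
    calc ((P * ‖G‖ ^ 2 : ℝ) : ℂ) = ((∑ a : ZMod q, ‖χ⁻¹ a * G‖ ^ 2 : ℝ) : ℂ) := by
          congr 1
          rw [hP, sum_mul]
          apply sum_congr rfl; intro a _
          rw [norm_mul, norm_char_inv_apply, mul_pow]
      _ = ∑ a : ZMod q, ∑ b, ∑ c, χ b * (starRingEnd ℂ) (χ c) * ZMod.stdAddChar (a * (b - c)) := by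
          push_cast
          apply sum_congr rfl; intro a _
          rw [← h1, ← Complex.mul_conj']
          simp only [map_sum, sum_mul_sum, map_mul]
          apply sum_congr rfl; intro b _
          apply sum_congr rfl; intro c _
          rw [conj_stdAddChar, mul_sub, sub_eq_add_neg, AddChar.map_add_eq_mul]
          ring
      _ = ∑ b : ZMod q, ∑ c, χ b * (starRingEnd ℂ) (χ c) * ∑ a, ZMod.stdAddChar (a * (b - c)) := by
          simp_rw [mul_sum]
          rw [sum_comm]
          apply sum_congr rfl; intro b _
          rw [sum_comm]
      _ = ∑ b : ZMod q, χ b * (starRingEnd ℂ) (χ b) * q := by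
          apply sum_congr rfl; intro b _
          simp_rw [AddChar.sum_mulShift _ (ZMod.isPrimitive_stdAddChar q), sub_eq_zero]
          simp [ZMod.card]
      _ = ((q * P : ℝ) : ℂ) := by
          rw [hP]; push_cast; rw [mul_sum]
          apply sum_congr rfl; intro b _
          rw [Complex.mul_conj', mul_comm]
  have h3 : P * ‖G‖ ^ 2 = q * P := by exact_mod_cast h2
  have : P * (‖G‖ ^ 2) = P * q := by linarith
  exact mul_left_cancel₀ hP0.ne' this

lemma sum_all_chars_norm_sq (S : ZMod q → ℂ) :
    ∑ χ : DirichletCharacter ℂ q, ‖∑ b, χ⁻¹ b * S b‖ ^ 2 =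
      q.totient * ∑ b ∈ (univ : Finset (ZMod q)).filter IsUnit, ‖S b‖ ^ 2 := by
  have : ((∑ χ : DirichletCharacter ℂ q, ‖∑ b, χ⁻¹ b * S b‖ ^ 2 : ℝ) : ℂ) =
      ((q.totient * ∑ b ∈ (univ : Finset (ZMod q)).filter IsUnit, ‖S b‖ ^ 2 : ℝ) : ℂ) := by
    push_cast
    calc _ = ∑ χ : DirichletCharacter ℂ q, ∑ b, ∑ c, (χ⁻¹ b * χ c) * (S b * (starRingEnd ℂ) (S c)) := by
          apply sum_congr rfl; intro χ _
          rw [← Complex.mul_conj']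
          simp only [map_sum, sum_mul_sum, map_mul]
          apply sum_congr rfl; intro b _
          apply sum_congr rfl; intro c _
          rw [char_inv_apply_eq_conj, char_inv_apply_eq_conj, Complex.conj_conj]
          ring
      _ = ∑ b, ∑ c, (∑ χ : DirichletCharacter ℂ q, χ⁻¹ b * χ c) * (S b * (starRingEnd ℂ) (S c)) := by
          rw [sum_comm]
          apply sum_congr rfl; intro b _
          rw [sum_comm]
          simp_rw [sum_mul]
      _ = ∑ b, if IsUnit b then (q.totient : ℂ) * (‖S b‖ : ℂ) ^ 2 else 0 := by
          apply sum_congr rfl; intro b _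
          split_ifs with hb
          · have : ∀ c, ∑ χ : DirichletCharacter ℂ q, χ⁻¹ b * χ c = if b = c then (q.totient : ℂ) else 0 := by
              intro c
              rw [← DirichletCharacter.sum_char_inv_mul_char_eq ℂ hb c]
              apply sum_congr rfl; intro χ _
              rw [MulChar.inv_apply_eq_inv']
              rw [← eq_inv_of_mul_eq_one_right (a := χ b)]
              rw [← map_mul, ZMod.mul_inv_of_unit _ hb, map_one]
            simp_rw [this]
            simp [Complex.mul_conj']
          · apply sum_eq_zero; intro c _
            rw [sum_eq_zero, zero_mul]
            intro χ _
            rw [MulChar.map_nonunit _ hb, zero_mul]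
      _ = _ := by rw [mul_sum, sum_filter]
  exact_mod_cast this

lemma sum_primChars_le (N : ℕ) (a : ℕ → ℂ) :
    ∑ χ ∈ primChars q, ‖∑ n ∈ range N, a n * χ n‖ ^ 2 ≤
      ∑ b ∈ (range q).filter (fun b => b.Coprime q), ‖∑ n ∈ range N, a n * addExp (n * (b / q : ℝ))‖ ^ 2 := by
  set S : ZMod q → ℂ := fun b => ∑ n ∈ range N, a n * ZMod.stdAddChar ((n : ZMod q) * b) with hS
  have hq0 : (0 : ℝ) < q := by exact_mod_cast NeZero.pos q
  have h1 : ∀ χ ∈ primChars q, q * ‖∑ n ∈ range N, a n * χ n‖ ^ 2 = ‖∑ b, χ⁻¹ b * S b‖ ^ 2 := by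
    intro χ hχ
    rw [mem_primChars] at hχ
    have hχ' : χ⁻¹.IsPrimitive := by
      rw [DirichletCharacter.isPrimitive_def, DirichletCharacter.conductor_inv]; exact hχ
    rw [← norm_gaussSum_sq hχ', ← mul_pow, ← norm_mul]
    congr 2
    simp only [hS, mul_sum]
    rw [sum_comm]
    apply sum_congr rfl; intro n _
    have h2 : ∑ b, χ⁻¹ b * ZMod.stdAddChar ((n : ZMod q) * b) = χ⁻¹⁻¹ n * gaussSum χ⁻¹ ZMod.stdAddChar :=
      gaussSum_mulShift_of_isPrimitive (ZMod.stdAddChar (N := q)) hχ' n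
    rw [inv_inv] at h2
    calc _ = a n * (χ n * gaussSum χ⁻¹ ZMod.stdAddChar) := by ring
      _ = _ := by
        rw [← h2, mul_sum]; apply sum_congr rfl; intro b _; ring
  have h2 : q * ∑ χ ∈ primChars q, ‖∑ n ∈ range N, a n * χ n‖ ^ 2 ≤
      q * ∑ b ∈ (univ : Finset (ZMod q)).filter IsUnit, ‖S b‖ ^ 2 := by
    rw [mul_sum, sum_congr rfl h1]
    calc _ ≤ ∑ χ : DirichletCharacter ℂ q, ‖∑ b, χ⁻¹ b * S b‖ ^ 2 :=
          sum_le_sum_of_subset_of_nonneg (subset_univ _) (fun _ _ _ => by positivity)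
      _ = q.totient * ∑ b ∈ (univ : Finset (ZMod q)).filter IsUnit, ‖S b‖ ^ 2 := sum_all_chars_norm_sq S
      _ ≤ _ := by
        have : (q.totient : ℝ) ≤ q := by exact_mod_cast Nat.totient_le q
        gcongr
  refine (le_of_mul_le_mul_left h2 hq0).trans (le_of_eq ?_)
  symm
  apply sum_bij (fun (b : ℕ) _ => (b : ZMod q))
  · intro b hb
    rw [mem_filter] at hb ⊢
    exact ⟨mem_univ _, (ZMod.isUnit_iff_coprime b q).mpr hb.2⟩
  · intro b hb c hc h
    rw [mem_filter, mem_range] at hb hc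
    have := congrArg ZMod.val h
    rwa [ZMod.val_natCast_of_lt hb.1, ZMod.val_natCast_of_lt hc.1] at this
  · intro b hb
    rw [mem_filter] at hb
    refine ⟨b.val, ?_, by simp⟩
    rw [mem_filter, mem_range]
    refine ⟨ZMod.val_lt b, (ZMod.isUnit_iff_coprime _ _).mp ?_⟩
    simpa using hb.2
  · intro b _
    simp only [hS]
    congr 2
    apply sum_congr rfl; intro n _
    congr 1
    have := ZMod.stdAddChar_coe (N := q) ((n * b : ℕ) : ℤ)
    push_cast at this
    rw [this]
    unfold addExp
    congr 1; push_cast; ring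

end gauss

/-- The multiplicative large sieve inequality. -/
theorem large_sieve_primChars (R N : ℕ) (a : ℕ → ℂ) :
    ∑ q ∈ Icc 1 R, ∑ χ ∈ primChars q, ‖∑ n ∈ range N, a n * χ n‖ ^ 2 ≤
      (N + 3 * R ^ 2 * (1 + Real.log (R ^ 2 + 1))) * ∑ n ∈ range N, ‖a n‖ ^ 2 := by
  rcases Nat.eq_zero_or_pos R with rfl | hR
  · simp; positivity
  set s : Finset (Σ _ : ℕ, ℕ) := (Icc 1 R).sigma (fun q => (range q).filter (fun b => b.Coprime q)) with hs
  have hsep : ∀ r ∈ s, ∀ t ∈ s, r ≠ t → ∀ k : ℤ,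
      1 / ((R ^ 2 : ℕ) : ℝ) ≤ |(r.2 / r.1 : ℝ) - (t.2 / t.1 : ℝ) - k| := by
    rintro ⟨q, b⟩ hr ⟨q', b'⟩ ht hne k
    simp only [hs, mem_sigma, mem_Icc, mem_filter, mem_range] at hr ht
    obtain ⟨⟨hq1, hqR⟩, hbq, hb⟩ := hr
    obtain ⟨⟨hq1', hqR'⟩, hbq', hb'⟩ := ht
    have hq0 : (0 : ℝ) < q := by exact_mod_cast hq1
    have hq0' : (0 : ℝ) < q' := by exact_mod_cast hq1'
    have e : (b / q : ℝ) - (b' / q' : ℝ) - k = ((b * q' - b' * q - k * q * q' : ℤ) : ℝ) / (q * q') := by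
      push_cast; field_simp
    simp only
    rw [e, abs_div, abs_of_pos (mul_pos hq0 hq0')]
    have hnum : (b * q' - b' * q - k * q * q' : ℤ) ≠ 0 := by
      intro h0
      have d1 : (q : ℤ) ∣ b * q' := ⟨b' + k * q', by linarith⟩
      have d2 : (q' : ℤ) ∣ b' * q := ⟨b - k * q, by linarith⟩
      have d1' : q ∣ b * q' := by exact_mod_cast d1
      have d2' : q' ∣ b' * q := by exact_mod_cast d2
      have hqq : q = q' := Nat.dvd_antisymm (hb.symm.dvd_of_dvd_mul_left d1')
        (hb'.symm.dvd_of_dvd_mul_left d2')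
      subst hqq
      have h3 : (q : ℤ) * (b - b' - k * q) = 0 := by linarith
      have hq0z : (q : ℤ) ≠ 0 := by positivity
      have h4 : (b : ℤ) - b' = k * q := by
        have := (mul_eq_zero.mp h3).resolve_left hq0z
        linarith
      have hk : k = 0 := by
        by_contra hk
        have h5 : |(b : ℤ) - b'| < q := by rw [abs_lt]; constructor <;> omega
        rw [h4, abs_mul, abs_of_nonneg (show (0 : ℤ) ≤ q by positivity)] at h5
        have : 1 ≤ |k| := Int.one_le_abs hk
        nlinarith
      rw [hk, zero_mul, sub_eq_zero] at h4
      have : b = b' := by exact_mod_cast h4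
      exact hne (by rw [this])
    have h1 : (1 : ℝ) ≤ |((b * q' - b' * q - k * q * q' : ℤ) : ℝ)| := by
      rw [← Int.cast_abs]; exact_mod_cast Int.one_le_abs hnum
    apply div_le_div₀ (abs_nonneg _) h1 (by positivity)
    push_cast
    have : (q : ℝ) ≤ R := by exact_mod_cast hqR
    have : (q' : ℝ) ≤ R := by exact_mod_cast hqR'
    nlinarith
  have h1 := large_sieve_of_separated s (fun r => (r.2 / r.1 : ℝ)) N (R ^ 2) (Nat.one_le_pow _ _ hR) hsep a
  push_cast at h1
  refine le_trans ?_ h1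
  rw [hs, sum_sigma]
  apply sum_le_sum
  intro q hq
  rw [mem_Icc] at hq
  have : NeZero q := ⟨by omega⟩
  exact sum_primChars_le N a

/-- Fourier coefficients on `ℤ/E` of the indicator function of `[0, K)`. -/
noncomputable def cutCoeff (E K h : ℕ) : ℂ := (1 / E : ℂ) * ∑ k ∈ range K, addExp (k * (-(h / E : ℝ)))

/-- A majorant of the Fourier coefficients `cutCoeff E K h`, uniform in `K`. -/
noncomputable def cutWeight (E h : ℕ) : ℝ := (if h = 0 then 1 else 0) + 1 / h + 1 / (E - h)

lemma sum_addExp_eq_zero (E : ℕ) (e k : ℕ) (he : e < E) (hk : k < E) (hne : e ≠ k) :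
    ∑ h ∈ range E, addExp (h * ((e - k) / E : ℝ)) = 0 := by
  have hE : (0 : ℝ) < E := by exact_mod_cast (Nat.zero_le _).trans_lt he
  simp_rw [addExp.natCast_mul]
  have h1 : addExp ((e - k) / E : ℝ) ≠ 1 := by
    intro h
    unfold addExp at h
    rw [Complex.exp_eq_one_iff] at h
    obtain ⟨n, hn⟩ := h
    have h2 : (((e - k) / E : ℝ) : ℂ) = n := by
      have h3 : (2 * Real.pi * Complex.I : ℂ) ≠ 0 := Complex.two_pi_I_ne_zero
      apply mul_left_cancel₀ h3
      rw [hn]; ring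
    have h3 : ((e - k) / E : ℝ) = n := by exact_mod_cast h2
    rw [div_eq_iff hE.ne'] at h3
    have h4 : (e : ℤ) - k = n * E := by exact_mod_cast h3
    have h5 : (E : ℤ) ∣ (e : ℤ) - k := ⟨n, by rw [h4]; ring⟩
    have h6 := Int.eq_zero_of_abs_lt_dvd h5 (by rw [abs_lt]; constructor <;> omega)
    omega
  rw [geom_sum_eq h1, ← addExp.natCast_mul]
  have : (E * ((e - k) / E : ℝ)) = ((e - k : ℤ) : ℝ) := by
    push_cast; field_simp
  rw [this, addExp.intCast, sub_self, zero_div]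

lemma sum_cutCoeff (E K e : ℕ) (he : e < E) (hK : K ≤ E) :
    ∑ h ∈ range E, cutCoeff E K h * addExp (h * (e / E : ℝ)) = if e < K then 1 else 0 := by
  have hE : (0 : ℝ) < E := by exact_mod_cast (Nat.zero_le _).trans_lt he
  have hE' : (E : ℂ) ≠ 0 := by exact_mod_cast hE.ne'
  unfold cutCoeff
  have h1 : ∀ h ∈ range E, (1 / E : ℂ) * (∑ k ∈ range K, addExp (k * (-(h / E : ℝ)))) * addExp (h * (e / E : ℝ))
      = (1 / E : ℂ) * ∑ k ∈ range K, addExp (h * ((e - k) / E : ℝ)) := by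
    intro h _
    rw [mul_assoc, sum_mul]
    congr 1
    apply sum_congr rfl
    intro k _
    rw [← addExp.add]
    congr 1; ring
  rw [sum_congr rfl h1, ← mul_sum, sum_comm]
  have h2 : ∀ k ∈ range K, ∑ h ∈ range E, addExp (h * ((e - k) / E : ℝ)) = if e = k then (E : ℂ) else 0 := by
    intro k hk
    split_ifs with hek
    · subst hek
      simp [show addExp 0 = 1 by simp [addExp]]
    · exact sum_addExp_eq_zero E e k he (by have := mem_range.mp hk; omega) hek
  rw [sum_congr rfl h2, sum_ite_eq]
  simp only [mem_range]
  split_ifs <;> simp [hE']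

lemma norm_cutCoeff_le (E K h : ℕ) (hh : h < E) (hK : K ≤ E) : ‖cutCoeff E K h‖ ≤ cutWeight E h := by
  have hE : (0 : ℝ) < E := by exact_mod_cast (Nat.zero_le _).trans_lt hh
  have hlt : (h : ℝ) < E := by exact_mod_cast hh
  have hpos : 0 < (E : ℝ) - h := by linarith
  unfold cutCoeff cutWeight
  rw [norm_mul]
  have hn : ‖(1 / E : ℂ)‖ = 1 / E := by simp
  rw [hn]
  split_ifs with h0
  · subst h0
    have h1 := norm_sum_addExp_le_card K (-((0 : ℕ) / E : ℝ))
    have h2 : (K : ℝ) ≤ E := by exact_mod_cast hK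
    calc _ ≤ 1 / (E : ℝ) * E := by gcongr; linarith
      _ = 1 := by field_simp
      _ ≤ _ := by have : 0 < 1 / ((E : ℝ) - (0 : ℕ)) := by positivity
                  simp only [Nat.cast_zero, div_zero] at *; linarith
  · have h0' : (0 : ℝ) < h := by exact_mod_cast Nat.pos_of_ne_zero h0
    rw [zero_add]
    rcases le_total ((h : ℝ) / E) (1 / 2) with hle | hle
    · have hp : 0 < (h : ℝ) / E := by positivity
      have := norm_sum_addExp_le K (-(h / E : ℝ)) (by linarith) (by rw [abs_neg, abs_of_pos hp]; exact hle)
      rw [abs_neg, abs_of_pos hp] at this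
      calc _ ≤ 1 / (E : ℝ) * (1 / (2 * (h / E))) := by gcongr
        _ = (1 / 2) * (1 / h) := by field_simp
        _ ≤ 1 / h := by have : 0 < 1 / (h : ℝ) := by positivity
                        linarith
        _ ≤ _ := by have : 0 < 1 / ((E : ℝ) - h) := by positivity
                    linarith
    · have hp : 0 < 1 - (h : ℝ) / E := by rw [sub_pos, div_lt_one hE]; exact hlt
      have := norm_sum_addExp_le K (-(h / E : ℝ) - (-1 : ℤ)) (by push_cast; linarith)
        (by push_cast; rw [abs_le]; constructor <;> linarith)
      rw [norm_sum_addExp_sub_int] at this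
      rw [show |(-(h / E : ℝ) - (-1 : ℤ))| = (E - h) / E by
        push_cast
        rw [show (-(h / E : ℝ) - (-1)) = (E - h) / E by field_simp; ring]
        exact abs_of_pos (by positivity)] at this
      calc _ ≤ 1 / (E : ℝ) * (1 / (2 * ((E - h) / E))) := by gcongr
        _ = (1 / 2) * (1 / (E - h)) := by field_simp
        _ ≤ 1 / (E - h) := by have : 0 < 1 / ((E : ℝ) - h) := by positivity
                              linarith
        _ ≤ _ := by have : 0 < 1 / (h : ℝ) := by positivity
                    linarith

lemma cutWeight_nonneg (E h : ℕ) (hh : h < E) : 0 ≤ cutWeight E h := by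
  have hlt : (h : ℝ) < E := by exact_mod_cast hh
  have hpos : 0 < (E : ℝ) - h := by linarith
  unfold cutWeight
  have : (0 : ℝ) ≤ if h = 0 then 1 else 0 := by split_ifs <;> norm_num
  positivity

lemma sum_cutWeight_le (E : ℕ) : ∑ h ∈ range E, cutWeight E h ≤ 3 + 2 * Real.log E := by
  rcases Nat.eq_zero_or_pos E with rfl | hE
  · simp
  unfold cutWeight
  rw [sum_add_distrib, sum_add_distrib, sum_ite_eq' (range E) 0]
  have h1 : ∑ h ∈ range E, (1 : ℝ) / h ≤ 1 + Real.log E := by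
    obtain ⟨n, rfl⟩ := Nat.exists_eq_succ_of_ne_zero hE.ne'
    rw [Nat.succ_eq_add_one, sum_range_succ']
    have h2 := sum_inv_le_one_add_log n
    have h3 : Real.log n ≤ Real.log (n + 1 : ℕ) := by
      rcases Nat.eq_zero_or_pos n with rfl | hn
      · simp
      · apply Real.log_le_log (by exact_mod_cast hn); push_cast; linarith
    push_cast at h3 ⊢
    simp only [div_zero, add_zero]
    linarith
  have h2 : ∑ h ∈ range E, (1 : ℝ) / (E - h) ≤ 1 + Real.log E := by
    rw [← sum_range_reflect]
    refine le_trans (le_of_eq ?_) (sum_inv_le_one_add_log E)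
    apply sum_congr rfl
    intro j hj
    have hj' := mem_range.mp hj
    rw [show E - 1 - j = E - (1 + j) by omega, Nat.cast_sub (by omega)]
    push_cast
    congr 1; ring
  have h3 : (if 0 ∈ range E then (1 : ℝ) else 0) ≤ 1 := by split_ifs <;> norm_num
  linarith

/-- The large sieve constant for sequences of length `N` and moduli up to `R`. -/
noncomputable def sieveConst (R N : ℕ) : ℝ := N + 3 * R ^ 2 * (1 + Real.log (R ^ 2 + 1))

lemma sieveConst_nonneg (R N : ℕ) : 0 ≤ sieveConst R N := by
  unfold sieveConst
  have : 0 ≤ Real.log ((R : ℝ) ^ 2 + 1) := Real.log_nonneg (by nlinarith [sq_nonneg (R : ℝ)])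
  positivity

/-- A bilinear form of the large sieve inequality with a truncation condition `e < K d`. -/
theorem bilinear_large_sieve (R D E : ℕ) (α β : ℕ → ℂ) (K : ℕ → ℕ) (hK : ∀ d, K d ≤ E) :
    ∑ q ∈ Icc 1 R, ∑ χ ∈ primChars q,
      ‖∑ d ∈ range D, ∑ e ∈ range E, if e < K d then (α d * χ d) * (β e * χ e) else 0‖ ≤
    (3 + 2 * Real.log E) * (√(sieveConst R D * ∑ d ∈ range D, ‖α d‖ ^ 2) *
      √(sieveConst R E * ∑ e ∈ range E, ‖β e‖ ^ 2)) := by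
  set T := (Icc 1 R).sigma primChars with hT
  have hLS : ∀ (N : ℕ) (a : ℕ → ℂ), ∑ x ∈ T, ‖∑ n ∈ range N, a n * x.2 n‖ ^ 2 ≤
      sieveConst R N * ∑ n ∈ range N, ‖a n‖ ^ 2 := by
    intro N a
    rw [hT, sum_sigma]
    exact large_sieve_primChars R N a
  rw [sum_sigma' (Icc 1 R) primChars
    (fun q χ => ‖∑ d ∈ range D, ∑ e ∈ range E, if e < K d then (α d * χ d) * (β e * χ e) else 0‖), ← hT]
  set A : ℕ → (Σ q, DirichletCharacter ℂ q) → ℂ :=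
    fun h x => ∑ d ∈ range D, (α d * cutCoeff E (K d) h) * x.2 d with hA
  set B : ℕ → (Σ q, DirichletCharacter ℂ q) → ℂ :=
    fun h x => ∑ e ∈ range E, (β e * addExp (h * (e / E : ℝ))) * x.2 e with hB
  have hdec : ∀ x : (Σ q, DirichletCharacter ℂ q),
      ∑ d ∈ range D, ∑ e ∈ range E, (if e < K d then (α d * x.2 d) * (β e * x.2 e) else 0) =
      ∑ h ∈ range E, A h x * B h x := by
    intro x
    simp only [hA, hB, sum_mul_sum]
    rw [sum_comm (s := range E)]
    apply sum_congr rfl; intro d _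
    rw [sum_comm]
    apply sum_congr rfl; intro e he
    have := sum_cutCoeff E (K d) e (mem_range.mp he) (hK d)
    rw [show (if e < K d then (α d * x.2 d) * (β e * x.2 e) else 0) =
      ((α d * x.2 d) * (β e * x.2 e)) * (if e < K d then 1 else 0) by split_ifs <;> simp]
    rw [← this, mul_sum]
    apply sum_congr rfl; intro h _
    ring
  set P := √(sieveConst R D * ∑ d ∈ range D, ‖α d‖ ^ 2) with hP
  set Q := √(sieveConst R E * ∑ e ∈ range E, ‖β e‖ ^ 2) with hQ
  have hAb : ∀ h ∈ range E, √(∑ x ∈ T, ‖A h x‖ ^ 2) ≤ cutWeight E h * P := by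
    intro h hh
    have hw := cutWeight_nonneg E h (mem_range.mp hh)
    rw [Real.sqrt_le_left (by positivity), mul_pow, hP, Real.sq_sqrt (by
      have := sieveConst_nonneg R D; positivity)]
    refine (hLS D _).trans ?_
    rw [mul_left_comm]
    apply mul_le_mul_of_nonneg_left _ (sieveConst_nonneg R D)
    rw [mul_sum]
    apply sum_le_sum; intro d _
    rw [norm_mul, mul_pow, mul_comm]
    gcongr
    exact norm_cutCoeff_le E _ h (mem_range.mp hh) (hK d)
  have hBb : ∀ h ∈ range E, √(∑ x ∈ T, ‖B h x‖ ^ 2) ≤ Q := by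
    intro h hh
    apply Real.sqrt_le_sqrt
    refine (hLS E _).trans (le_of_eq ?_)
    simp [addExp.norm_eq_one]
  calc _ = ∑ x ∈ T, ‖∑ h ∈ range E, A h x * B h x‖ := by
        apply sum_congr rfl; intro x _; rw [← hdec x]
    _ ≤ ∑ x ∈ T, ∑ h ∈ range E, ‖A h x‖ * ‖B h x‖ := by
        apply sum_le_sum; intro x _
        refine (norm_sum_le _ _).trans (le_of_eq ?_)
        simp
    _ = ∑ h ∈ range E, ∑ x ∈ T, ‖A h x‖ * ‖B h x‖ := sum_comm
    _ ≤ ∑ h ∈ range E, (cutWeight E h * P) * Q := by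
        apply sum_le_sum; intro h hh
        refine (Real.sum_mul_le_sqrt_mul_sqrt _ _ _).trans ?_
        have hw := cutWeight_nonneg E h (mem_range.mp hh)
        exact mul_le_mul (hAb h hh) (hBb h hh) (Real.sqrt_nonneg _) (by positivity)
    _ = (∑ h ∈ range E, cutWeight E h) * (P * Q) := by rw [sum_mul]; apply sum_congr rfl; intros; ring
    _ ≤ _ := by gcongr; exact sum_cutWeight_le E

lemma sum_Ioc_inv_le (n : ℕ) : ∑ i ∈ Ioc 0 n, (1 : ℝ) / i ≤ 1 + Real.log n := by
  refine le_trans (le_of_eq ?_) (sum_inv_le_one_add_log n)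
  rw [← Finset.Ico_add_one_add_one_eq_Ioc, Finset.sum_Ico_eq_sum_range]
  simp [add_comm]

lemma sum_Ioc_dvd_inv_le (g n : ℕ) :
    ∑ i ∈ Ioc 0 n with g ∣ i, (1 : ℝ) / i ≤ 1 / g * (1 + Real.log n) := by
  calc ∑ i ∈ Ioc 0 n with g ∣ i, (1 : ℝ) / i ≤ ∑ i ∈ (Ioc 0 n).image (g * ·), (1 : ℝ) / i := by
        apply sum_le_sum_of_subset_of_nonneg
        · intro i hi
          rw [mem_filter, mem_Ioc] at hi
          obtain ⟨⟨h1, h2⟩, k, rfl⟩ := hi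
          have hg : 0 < g := Nat.pos_of_mul_pos_right h1 |> fun _ => Nat.pos_of_ne_zero (by rintro rfl; simp at h1)
          have hk : 0 < k := Nat.pos_of_ne_zero (by rintro rfl; simp at h1)
          rw [mem_image]
          exact ⟨k, mem_Ioc.mpr ⟨hk, (Nat.le_mul_of_pos_left k hg).trans h2⟩, rfl⟩
        · intros; positivity
    _ ≤ ∑ i ∈ Ioc 0 n, (1 : ℝ) / ((g * i : ℕ) : ℝ) := by
        rcases Nat.eq_zero_or_pos g with rfl | hg
        · simp only [zero_mul]
          refine (sum_le_card_nsmul _ _ 0 ?_).trans (by simp)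
          intro x hx
          obtain ⟨_, _, rfl⟩ := mem_image.mp hx
          simp
        · rw [sum_image]
          intro a _ b _ h
          exact Nat.eq_of_mul_eq_mul_left hg h
    _ = 1 / g * ∑ i ∈ Ioc 0 n, (1 : ℝ) / i := by
        rw [mul_sum]; apply sum_congr rfl; intro i _; push_cast; ring
    _ ≤ _ := by gcongr; exact sum_Ioc_inv_le n

lemma sum_card_divisors_sq_le (E : ℕ) :
    ∑ e ∈ Ioc 0 E, ((e.divisors.card : ℝ)) ^ 2 ≤ E * (1 + Real.log E) ^ 3 := by
  have hd : ∀ e ∈ Ioc 0 E, (e.divisors.card : ℝ) = ∑ a ∈ Ioc 0 E, if a ∣ e then 1 else 0 := by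
    intro e he
    rw [mem_Ioc] at he
    rw [sum_boole]
    congr 2
    ext a
    simp only [Nat.mem_divisors, mem_filter, mem_Ioc]
    constructor
    · rintro ⟨h1, h2⟩
      exact ⟨⟨Nat.pos_of_dvd_of_pos h1 he.1, (Nat.le_of_dvd he.1 h1).trans he.2⟩, h1⟩
    · rintro ⟨_, h⟩; exact ⟨h, he.1.ne'⟩
  have hL : 0 ≤ 1 + Real.log E := by
    have := Real.log_natCast_nonneg E; linarith
  calc ∑ e ∈ Ioc 0 E, ((e.divisors.card : ℝ)) ^ 2
      = ∑ e ∈ Ioc 0 E, ∑ a ∈ Ioc 0 E, ∑ b ∈ Ioc 0 E, (if a.lcm b ∣ e then (1 : ℝ) else 0) := by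
        apply sum_congr rfl; intro e he
        rw [hd e he, sq, sum_mul_sum]
        apply sum_congr rfl; intro a _
        apply sum_congr rfl; intro b _
        simp only [Nat.lcm_dvd_iff]
        split_ifs <;> simp_all
    _ = ∑ a ∈ Ioc 0 E, ∑ b ∈ Ioc 0 E, ∑ e ∈ Ioc 0 E, (if a.lcm b ∣ e then (1 : ℝ) else 0) := by
        rw [sum_comm]
        apply sum_congr rfl; intro a _
        rw [sum_comm]
    _ ≤ ∑ a ∈ Ioc 0 E, ∑ b ∈ Ioc 0 E, ∑ g ∈ Ioc 0 E, (if g ∣ a ∧ g ∣ b then (E : ℝ) * (g * (1 / a) * (1 / b)) else 0) := by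
        apply sum_le_sum; intro a ha
        apply sum_le_sum; intro b hb
        rw [mem_Ioc] at ha hb
        rw [sum_boole, Nat.Ioc_filter_dvd_card_eq_div]
        have hg : a.gcd b ∈ Ioc 0 E := mem_Ioc.mpr ⟨Nat.gcd_pos_of_pos_left b ha.1,
          (Nat.gcd_le_left b ha.1).trans ha.2⟩
        refine le_trans ?_ (single_le_sum (f := fun g : ℕ => if g ∣ a ∧ g ∣ b then (E : ℝ) * (g * (1 / a) * (1 / b)) else 0)
          (fun g _ => by split_ifs <;> positivity) hg)
        rw [if_pos ⟨Nat.gcd_dvd_left a b, Nat.gcd_dvd_right a b⟩]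
        refine Nat.cast_div_le.trans (le_of_eq ?_)
        have ha' : (0 : ℝ) < a := by exact_mod_cast ha.1
        have hb' : (0 : ℝ) < b := by exact_mod_cast hb.1
        have hl : (0 : ℝ) < a.lcm b := by exact_mod_cast Nat.lcm_pos ha.1 hb.1
        have hm : (a.gcd b : ℝ) * a.lcm b = a * b := by exact_mod_cast Nat.gcd_mul_lcm a b
        rw [div_eq_iff hl.ne']
        field_simp
        linear_combination (-(E : ℝ)) * hm
    _ = ∑ g ∈ Ioc 0 E, (E : ℝ) * (g * ((∑ a ∈ Ioc 0 E with g ∣ a, (1 : ℝ) / a) * (∑ a ∈ Ioc 0 E with g ∣ a, (1 : ℝ) / a))) := by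
        simp_rw [sum_filter, sum_mul_sum, mul_sum]
        rw [sum_congr rfl (fun a _ => sum_comm), sum_comm]
        apply sum_congr rfl; intro g _
        apply sum_congr rfl; intro a _
        apply sum_congr rfl; intro b _
        by_cases h1 : g ∣ a <;> by_cases h2 : g ∣ b <;> simp [h1, h2, mul_assoc]
    _ ≤ ∑ g ∈ Ioc 0 E, (E : ℝ) * (g * ((1 / g * (1 + Real.log E)) * (1 / g * (1 + Real.log E)))) := by
        apply sum_le_sum; intro g _
        have := sum_Ioc_dvd_inv_le g E
        have h0 : (0 : ℝ) ≤ ∑ a ∈ Ioc 0 E with g ∣ a, (1 : ℝ) / a := sum_nonneg (fun _ _ => by positivity)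
        gcongr
    _ = (E * (1 + Real.log E) ^ 2) * ∑ g ∈ Ioc 0 E, (1 : ℝ) / g := by
        rw [mul_sum]; apply sum_congr rfl; intro g hg
        have : (0 : ℝ) < g := by exact_mod_cast (mem_Ioc.mp hg).1
        field_simp
    _ ≤ (E * (1 + Real.log E) ^ 2) * (1 + Real.log E) := by
        gcongr; exact sum_Ioc_inv_le E
    _ = _ := by ring

namespace ArithmeticFunction

/-- The restriction of an arithmetic function to arguments `n ≤ U`. -/
def low (f : ArithmeticFunction ℝ) (U : ℕ) : ArithmeticFunction ℝ :=
  ⟨fun n => if n ≤ U then f n else 0, by simp⟩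

/-- The restriction of an arithmetic function to arguments `n > U`. -/
def high (f : ArithmeticFunction ℝ) (U : ℕ) : ArithmeticFunction ℝ :=
  ⟨fun n => if n ≤ U then 0 else f n, by simp⟩

/-- The twist of a real arithmetic function by a Dirichlet character. -/
noncomputable def twist {q : ℕ} (χ : DirichletCharacter ℂ q) (f : ArithmeticFunction ℝ) : ArithmeticFunction ℂ :=
  ⟨fun n => (f n : ℂ) * χ n, by simp⟩

lemma low_apply (f : ArithmeticFunction ℝ) (U n : ℕ) : low f U n = if n ≤ U then f n else 0 := rfl

lemma high_apply (f : ArithmeticFunction ℝ) (U n : ℕ) : high f U n = if n ≤ U then 0 else f n := rfl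

lemma low_add_high (f : ArithmeticFunction ℝ) (U : ℕ) : low f U + high f U = f := by
  ext n; rw [add_apply, low_apply, high_apply]; split_ifs <;> simp

lemma twist_apply {q : ℕ} (χ : DirichletCharacter ℂ q) (f : ArithmeticFunction ℝ) (n : ℕ) :
    twist χ f n = (f n : ℂ) * χ n := rfl

lemma twist_add {q : ℕ} (χ : DirichletCharacter ℂ q) (f g : ArithmeticFunction ℝ) :
    twist χ (f + g) = twist χ f + twist χ g := by
  ext n; simp [twist_apply, add_mul]

lemma twist_mul {q : ℕ} (χ : DirichletCharacter ℂ q) (f g : ArithmeticFunction ℝ) :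
    twist χ (f * g) = twist χ f * twist χ g := by
  ext n
  simp only [twist_apply, mul_apply]
  push_cast
  rw [sum_mul]
  apply sum_congr rfl
  intro x hx
  rw [← (Nat.mem_divisorsAntidiagonal.mp hx).1]
  push_cast
  rw [map_mul]
  ring

open scoped ArithmeticFunction.Moebius ArithmeticFunction.zeta

/-- Vaughan's identity. -/
lemma vaughan_identity (U : ℕ) : vonMangoldt = low vonMangoldt U + low (μ : ArithmeticFunction ℝ) U * log
    + (-low vonMangoldt U) * (low (μ : ArithmeticFunction ℝ) U * (ζ : ArithmeticFunction ℝ))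
    + high vonMangoldt U * ((ζ : ArithmeticFunction ℝ) * high (μ : ArithmeticFunction ℝ) U) := by
  have h1 : (ζ : ArithmeticFunction ℝ) * (μ : ArithmeticFunction ℝ) = 1 := coe_zeta_mul_coe_moebius
  rw [← vonMangoldt_mul_zeta]
  have h2 := low_add_high vonMangoldt U
  have h3 := low_add_high (μ : ArithmeticFunction ℝ) U
  rw [eq_sub_of_add_eq' h2, eq_sub_of_add_eq' h3]
  linear_combination (-vonMangoldt + low vonMangoldt U) * h1

lemma zeta_mul_high_eq_zero (U e : ℕ) (he : e ≤ U) :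
    ((ζ : ArithmeticFunction ℝ) * high (μ : ArithmeticFunction ℝ) U) e = 0 := by
  rw [mul_apply]
  apply sum_eq_zero
  intro x hx
  have : x.2 ≤ U := (Nat.snd_mem_divisors_of_mem_antidiagonal hx |> Nat.divisor_le).trans he
  simp [high_apply, this]

lemma abs_zeta_mul_high_le (U e : ℕ) :
    |((ζ : ArithmeticFunction ℝ) * high (μ : ArithmeticFunction ℝ) U) e| ≤ e.divisors.card := by
  rw [mul_apply]
  refine (abs_sum_le_sum_abs _ _).trans ?_
  rw [← Nat.map_div_right_divisors, sum_map]
  refine (sum_le_card_nsmul _ _ 1 ?_).trans (by simp)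
  intro x hx
  have hb : ∀ n, |((μ n : ℤ) : ℝ)| ≤ 1 := fun n => by exact_mod_cast abs_moebius_le_one
  simp only [abs_mul, high_apply, intCoe_apply, natCoe_apply]
  have h1 : |((ζ x : ℕ) : ℝ)| ≤ 1 := by
    rw [zeta_apply]; split_ifs <;> simp
  have h2 : |if e / x ≤ U then 0 else ((μ (e / x) : ℤ) : ℝ)| ≤ 1 := by
    split_ifs
    · simp
    · simpa using hb _
  exact mul_le_one₀ h1 (abs_nonneg _) h2

end ArithmeticFunction

section periodic

lemma sum_range_periodic_eq_mod {q : ℕ} (f : ℕ → ℂ) (hf : ∀ n, f (n + q) = f n)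
    (h0 : ∑ n ∈ range q, f n = 0) (N : ℕ) : ∑ n ∈ range N, f n = ∑ n ∈ range (N % q), f n := by
  have key : ∀ k r, ∑ n ∈ range (q * k + r), f n = ∑ n ∈ range r, f n := by
    intro k
    induction k with
    | zero => simp
    | succ k ih =>
      intro r
      rw [show q * (k + 1) + r = q + (q * k + r) by ring, sum_range_add, h0, zero_add, ← ih r]
      apply sum_congr rfl; intro n _
      rw [add_comm q n, hf]
  conv_lhs => rw [← Nat.div_add_mod N q]
  exact key _ _

lemma norm_sum_range_periodic_le {q : ℕ} (hq : 0 < q) (f : ℕ → ℂ) (hf : ∀ n, f (n + q) = f n)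
    (h0 : ∑ n ∈ range q, f n = 0) (B : ℝ) (hB : ∀ n, ‖f n‖ ≤ B) (N : ℕ) :
    ‖∑ n ∈ range N, f n‖ ≤ q * B := by
  rw [sum_range_periodic_eq_mod f hf h0]
  have hB0 : 0 ≤ B := (norm_nonneg _).trans (hB 0)
  refine (norm_sum_le_of_le _ (fun n _ => hB n)).trans ?_
  rw [sum_const, card_range, nsmul_eq_mul]
  gcongr
  exact (Nat.mod_lt N hq).le

lemma char_zero_eq_zero {q : ℕ} {χ : DirichletCharacter ℂ q} (hχ : χ ≠ 1) : χ ((0 : ℕ) : ZMod q) = 0 := by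
  rw [Nat.cast_zero]
  apply MulChar.map_nonunit
  intro h
  rw [isUnit_zero_iff] at h
  have : Subsingleton (ZMod q) := subsingleton_of_zero_eq_one h
  apply hχ
  ext a
  rw [Subsingleton.elim (a : ZMod q) 1]; simp

variable {q : ℕ} [NeZero q] {χ : DirichletCharacter ℂ q}

lemma sum_range_char_eq_zero (hχ : χ ≠ 1) : ∑ n ∈ range q, χ n = 0 := by
  rw [← MulChar.sum_eq_zero_of_ne_one hχ]
  symm
  refine sum_nbij' (fun a : ZMod q => a.val) (fun n : ℕ => (n : ZMod q)) ?_ ?_ ?_ ?_ ?_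
  · intro a _; exact mem_range.mpr (ZMod.val_lt a)
  · intro a _; exact mem_univ _
  · intro a _; exact ZMod.natCast_zmod_val a
  · intro n hn; exact ZMod.val_cast_of_lt (mem_range.mp hn)
  · intro a _; rw [ZMod.natCast_zmod_val]

lemma norm_sum_range_char_le (hχ : χ ≠ 1) (N : ℕ) : ‖∑ n ∈ range N, χ n‖ ≤ q := by
  have := norm_sum_range_periodic_le (NeZero.pos q) (fun n => χ n) (by intro n; simp)
    (sum_range_char_eq_zero hχ) 1 (fun n => χ.norm_le_one _) N
  simpa using this

lemma sum_Ioc_eq_sum_range (f : ℕ → ℂ) (h0 : f 0 = 0) (N : ℕ) :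
    ∑ n ∈ Ioc 0 N, f n = ∑ n ∈ range (N + 1), f n := by
  rw [sum_range_succ', h0, add_zero, ← Finset.Ico_add_one_add_one_eq_Ioc, Finset.sum_Ico_eq_sum_range]
  simp [add_comm]

lemma norm_sum_Ioc_char_le (hχ : χ ≠ 1) (N : ℕ) : ‖∑ n ∈ Ioc 0 N, χ n‖ ≤ q := by
  rw [sum_Ioc_eq_sum_range (fun n => χ n) (char_zero_eq_zero hχ)]
  exact norm_sum_range_char_le hχ _

lemma norm_sum_Ioc_log_char_le (hχ : χ ≠ 1) (N : ℕ) :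
    ‖∑ n ∈ Ioc 0 N, (Real.log n : ℂ) * χ n‖ ≤ 2 * q * Real.log N := by
  rw [sum_Ioc_eq_sum_range (fun n => (Real.log n : ℂ) * χ n) (by simp)]
  have := sum_range_by_parts (fun n : ℕ => Real.log n) (fun n : ℕ => χ (n : ZMod q)) (N + 1)
  simp only [Complex.real_smul] at this
  rw [this]
  simp only [Nat.add_sub_cancel]
  have hm : ∀ i : ℕ, 0 ≤ Real.log ((i + 1 : ℕ) : ℝ) - Real.log i := by
    intro i
    rcases Nat.eq_zero_or_pos i with rfl | hi
    · simp
    · rw [sub_nonneg]; apply Real.log_le_log (by exact_mod_cast hi); push_cast; linarith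
  refine (norm_sub_le _ _).trans ?_
  have h1 : ‖(Real.log N : ℂ) * ∑ i ∈ range (N + 1), χ (i : ZMod q)‖ ≤ Real.log N * q := by
    rw [norm_mul, Complex.norm_real, Real.norm_of_nonneg (Real.log_natCast_nonneg N)]
    exact mul_le_mul_of_nonneg_left (norm_sum_range_char_le hχ _) (Real.log_natCast_nonneg N)
  have h2 : ‖∑ i ∈ range N, ((Real.log ((i + 1 : ℕ) : ℝ) - Real.log i : ℝ) : ℂ) * ∑ j ∈ range (i + 1), χ (j : ZMod q)‖
      ≤ Real.log N * q := by
    have h3 : ∀ i ∈ range N, ‖((Real.log ((i + 1 : ℕ) : ℝ) - Real.log i : ℝ) : ℂ) * ∑ j ∈ range (i + 1), χ (j : ZMod q)‖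
        ≤ (Real.log ((i + 1 : ℕ) : ℝ) - Real.log i) * q := by
      intro i _
      rw [norm_mul, Complex.norm_real, Real.norm_of_nonneg (hm i)]
      exact mul_le_mul_of_nonneg_left (norm_sum_range_char_le hχ _) (hm i)
    refine (norm_sum_le_of_le (range N) h3).trans ?_
    rw [← sum_mul, sum_range_sub (fun i : ℕ => Real.log i)]
    simp
  linarith

end periodic

namespace ArithmeticFunction
open scoped ArithmeticFunction.Moebius ArithmeticFunction.zeta

variable {q : ℕ} (χ : DirichletCharacter ℂ q)

lemma norm_twist_le (f : ArithmeticFunction ℝ) (n : ℕ) : ‖twist χ f n‖ ≤ |f n| := by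
  rw [twist_apply, norm_mul, Complex.norm_real, Real.norm_eq_abs]
  exact mul_le_of_le_one_right (abs_nonneg _) (χ.norm_le_one _)

lemma norm_sum_twist_mul_le (f g : ArithmeticFunction ℝ) (B : ℝ) (y : ℕ)
    (hB : ∀ z ≤ y, ‖∑ n ∈ Ioc 0 z, twist χ g n‖ ≤ B) :
    ‖∑ n ∈ Ioc 0 y, twist χ (f * g) n‖ ≤ (∑ n ∈ Ioc 0 y, |f n|) * B := by
  rw [twist_mul, sum_Ioc_mul_eq_sum_sum, sum_mul]
  refine norm_sum_le_of_le _ ?_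
  intro n _
  rw [norm_mul]
  exact mul_le_mul (norm_twist_le χ f n) (hB _ (Nat.div_le_self y n)) (norm_nonneg _) (abs_nonneg _)

lemma sum_abs_low_le (f : ArithmeticFunction ℝ) (U y : ℕ) (B : ℝ) (hB : ∀ n ∈ Ioc 0 U, |f n| ≤ B) :
    ∑ n ∈ Ioc 0 y, |low f U n| ≤ U * B := by
  calc ∑ n ∈ Ioc 0 y, |low f U n| = ∑ n ∈ (Ioc 0 y).filter (· ≤ U), |f n| := by
        rw [sum_filter]; apply sum_congr rfl; intro n _; rw [low_apply]; split_ifs <;> simp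
    _ ≤ ∑ n ∈ Ioc 0 U, |f n| := by
        apply sum_le_sum_of_subset_of_nonneg
        · intro n hn; simp only [mem_filter, mem_Ioc] at hn ⊢; exact ⟨hn.1.1, hn.2⟩
        · intros; exact abs_nonneg _
    _ ≤ ∑ n ∈ Ioc 0 U, B := sum_le_sum hB
    _ = U * B := by simp

lemma abs_vonMangoldt_le (U n : ℕ) (hn : n ∈ Ioc 0 U) : |vonMangoldt n| ≤ Real.log U := by
  rw [mem_Ioc] at hn
  rw [abs_of_nonneg vonMangoldt_nonneg]
  exact vonMangoldt_le_log.trans (Real.log_le_log (by exact_mod_cast hn.1) (by exact_mod_cast hn.2))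

lemma abs_moebius_real_le (n : ℕ) : |(μ : ArithmeticFunction ℝ) n| ≤ 1 := by
  rw [intCoe_apply]; exact_mod_cast abs_moebius_le_one

/-- The bilinear part of `∑_{n ≤ y} Λ(n) χ(n)` in Vaughan's identity. -/
noncomputable def typeTwo (U y : ℕ) : ℂ :=
  ∑ n ∈ Ioc 0 y, twist χ (high vonMangoldt U * ((ζ : ArithmeticFunction ℝ) * high (μ : ArithmeticFunction ℝ) U)) n

lemma norm_sum_vonMangoldt_sub_typeTwo_le [NeZero q] (hχ : χ ≠ 1) (U y : ℕ) (hU : 1 ≤ U) (hUy : U ≤ y) :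
    ‖∑ n ∈ Ioc 0 y, twist χ vonMangoldt n - typeTwo χ U y‖ ≤ 4 * q * U ^ 2 * Real.log y := by
  have hU' : (1 : ℝ) ≤ U := by exact_mod_cast hU
  have hUy' : (U : ℝ) ≤ y := by exact_mod_cast hUy
  have hlU := Real.log_nonneg hU'
  have hly := Real.log_le_log (by linarith) hUy'
  have hq : (1 : ℝ) ≤ q := by exact_mod_cast NeZero.one_le
  have h0 : ‖∑ n ∈ Ioc 0 y, twist χ (low vonMangoldt U) n‖ ≤ U * Real.log U := by
    refine (norm_sum_le_of_le _ (fun n _ => norm_twist_le χ _ n)).trans ?_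
    exact sum_abs_low_le _ U y _ (abs_vonMangoldt_le U)
  have h1 : ‖∑ n ∈ Ioc 0 y, twist χ (low (μ : ArithmeticFunction ℝ) U * log) n‖ ≤ (U * 1) * (2 * q * Real.log y) := by
    refine (norm_sum_twist_mul_le χ _ _ (2 * q * Real.log y) y ?_).trans ?_
    · intro z hz
      refine (norm_sum_Ioc_log_char_le hχ z).trans ?_
      rcases Nat.eq_zero_or_pos z with rfl | hz0
      · simp; positivity
      · have := Real.log_le_log (by exact_mod_cast hz0) (show (z : ℝ) ≤ y by exact_mod_cast hz)
        gcongr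
    · gcongr
      exact sum_abs_low_le _ U y _ (fun n _ => abs_moebius_real_le n)
  have h2 : ‖∑ n ∈ Ioc 0 y, twist χ (-low vonMangoldt U * (low (μ : ArithmeticFunction ℝ) U * (ζ : ArithmeticFunction ℝ))) n‖
      ≤ (U * Real.log U) * ((U * 1) * q) := by
    refine (norm_sum_twist_mul_le χ _ _ ((U * 1) * q) y ?_).trans ?_
    · intro z hz
      refine (norm_sum_twist_mul_le χ _ _ q z ?_).trans ?_
      · intro w _
        refine le_trans (le_of_eq ?_) (norm_sum_Ioc_char_le hχ w)
        congr 1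
        apply sum_congr rfl; intro n hn
        have : n ≠ 0 := (mem_Ioc.mp hn).1.ne'
        simp [twist_apply, this]
      · gcongr
        exact sum_abs_low_le _ U z _ (fun n _ => abs_moebius_real_le n)
    · gcongr
      have : ∀ n, |(-low vonMangoldt U) n| = |low vonMangoldt U n| := fun n => abs_neg _
      simp_rw [this]
      exact sum_abs_low_le _ U y _ (abs_vonMangoldt_le U)
  have hdec : ∑ n ∈ Ioc 0 y, twist χ vonMangoldt n - typeTwo χ U y =
      ∑ n ∈ Ioc 0 y, twist χ (low vonMangoldt U) n + ∑ n ∈ Ioc 0 y, twist χ (low (μ : ArithmeticFunction ℝ) U * log) n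
      + ∑ n ∈ Ioc 0 y, twist χ (-low vonMangoldt U * (low (μ : ArithmeticFunction ℝ) U * (ζ : ArithmeticFunction ℝ))) n := by
    unfold typeTwo
    rw [show ∑ n ∈ Ioc 0 y, twist χ vonMangoldt n = _ from
      congrArg (fun f => ∑ n ∈ Ioc 0 y, twist χ f n) (vaughan_identity U)]
    simp only [twist_add, add_apply, sum_add_distrib]
    ring
  rw [hdec]
  refine (norm_add_le _ _).trans ((add_le_add (norm_add_le _ _) le_rfl).trans ?_)
  have e1 : (U : ℝ) * Real.log U ≤ q * U ^ 2 * Real.log y := by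
    have : (U : ℝ) ≤ q * U ^ 2 := by nlinarith
    gcongr
  have e2 : ((U : ℝ) * 1) * (2 * q * Real.log y) ≤ 2 * (q * U ^ 2 * Real.log y) := by
    have : (U : ℝ) ≤ U ^ 2 := by nlinarith
    have h3 : 0 ≤ q * Real.log y := by positivity
    nlinarith
  have e3 : ((U : ℝ) * Real.log U) * ((U * 1) * q) ≤ q * U ^ 2 * Real.log y := by
    have : 0 ≤ (q : ℝ) * U ^ 2 := by positivity
    nlinarith
  linarith

end ArithmeticFunction

namespace ArithmeticFunction
open scoped ArithmeticFunction.Moebius ArithmeticFunction.zeta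

/-- The second factor `ζ * μ_{> U}` of the bilinear part of Vaughan's identity. -/
noncomputable def vaughanTail (U : ℕ) : ArithmeticFunction ℝ :=
  (ζ : ArithmeticFunction ℝ) * high (μ : ArithmeticFunction ℝ) U

/-- The part of `typeTwo` with `D < d ≤ 2 * D`. -/
noncomputable def typeTwoBlock {q : ℕ} (χ : DirichletCharacter ℂ q) (U y D : ℕ) : ℂ :=
  ∑ d ∈ Ioc D (2 * D), twist χ vonMangoldt d * ∑ e ∈ Ioc 0 (y / d), twist χ (vaughanTail U) e

lemma sum_Ioc_dyadic (f : ℕ → ℂ) (U J : ℕ) :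
    ∑ d ∈ Ioc U (U * 2 ^ J), f d = ∑ j ∈ range J, ∑ d ∈ Ioc (U * 2 ^ j) (2 * (U * 2 ^ j)), f d := by
  induction J with
  | zero => simp
  | succ J ih =>
    rw [sum_range_succ, ← ih, ← sum_Ioc_consecutive f (Nat.le_mul_of_pos_right U (by positivity : 0 < 2 ^ J))
      (show U * 2 ^ J ≤ U * 2 ^ (J + 1) by gcongr <;> omega)]
    congr 3
    ring

lemma typeTwo_eq_sum_blocks {q : ℕ} (χ : DirichletCharacter ℂ q) (U y J : ℕ) (hJ : y ≤ U * 2 ^ J) :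
    typeTwo χ U y = ∑ j ∈ range J, typeTwoBlock χ U y (U * 2 ^ j) := by
  unfold typeTwo typeTwoBlock
  rw [← sum_Ioc_dyadic (fun d => twist χ vonMangoldt d * ∑ e ∈ Ioc 0 (y / d), twist χ (vaughanTail U) e),
    twist_mul, sum_Ioc_mul_eq_sum_sum]
  calc _ = ∑ d ∈ Ioc 0 (U * 2 ^ J), twist χ (high vonMangoldt U) d * ∑ e ∈ Ioc 0 (y / d), twist χ (vaughanTail U) e := by
        apply sum_subset (Ioc_subset_Ioc_right hJ)
        intro d _ hd
        rw [mem_Ioc] at *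
        rw [Nat.div_eq_of_lt (by omega)]; simp
    _ = _ := by
        symm
        rw [← sum_subset (Ioc_subset_Ioc_left (Nat.zero_le U))]
        · apply sum_congr rfl; intro d hd
          rw [mem_Ioc] at hd
          rw [twist_apply, twist_apply, high_apply, if_neg (by omega)]
        · intro d hd hd'
          rw [mem_Ioc] at *
          rw [twist_apply, high_apply, if_pos (by omega)]; simp

lemma typeTwoBlock_eq_zero {q : ℕ} (χ : DirichletCharacter ℂ q) (U y D : ℕ) (h : y / D < U) :
    typeTwoBlock χ U y D = 0 := by
  apply sum_eq_zero
  intro d hd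
  rw [mem_Ioc] at hd
  rw [sum_eq_zero, mul_zero]
  intro e he
  rw [mem_Ioc] at he
  rcases Nat.eq_zero_or_pos D with rfl | hD
  · omega
  · have := Nat.div_le_div_left hd.1.le hD (a := y)
    rw [twist_apply, vaughanTail, zeta_mul_high_eq_zero U e (by omega)]; simp

lemma typeTwoBlock_eq_bilinear {q : ℕ} (χ : DirichletCharacter ℂ q) (U y D : ℕ) (hD : 0 < D) :
    typeTwoBlock χ U y D = ∑ d ∈ range (2 * D + 1), ∑ e ∈ range (y / D + 1),
      if e < min (y / d + 1) (y / D + 1) then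
        (((if d ≤ D then 0 else vonMangoldt d : ℝ) : ℂ) * χ d) * ((vaughanTail U e : ℂ) * χ e) else 0 := by
  have h0 : ∀ d ∈ range (2 * D + 1), d ∉ Ioc D (2 * D) →
    ∑ e ∈ range (y / D + 1), (if e < min (y / d + 1) (y / D + 1) then
        (((if d ≤ D then 0 else vonMangoldt d : ℝ) : ℂ) * χ d) * ((vaughanTail U e : ℂ) * χ e) else 0) = 0 := by
    intro d hd hd'
    rw [mem_range] at hd; rw [mem_Ioc] at hd'
    rw [if_pos (by omega)]; simp
  rw [← sum_subset (by intro d; simp only [mem_Ioc, mem_range]; omega) h0]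
  unfold typeTwoBlock
  apply sum_congr rfl; intro d hd
  rw [mem_Ioc] at hd
  have hle := Nat.div_le_div_left hd.1.le hD (a := y)
  rw [sum_Ioc_eq_sum_range (fun e => twist χ (vaughanTail U) e) (by simp), mul_sum, ← sum_filter, if_neg (by omega)]
  apply sum_congr
  · ext e; simp only [mem_range, mem_filter]; omega
  · intros; rfl

set_option maxHeartbeats 1000000 in
lemma sum_norm_typeTwoBlock_le (U y D R : ℕ) (hU : 1 ≤ U) (hD : U ≤ D) (hy : 1 ≤ y) (hR : R ≤ y) :
    ∑ q ∈ Icc 1 R, ∑ χ ∈ primChars q, ‖typeTwoBlock χ U y D‖ ≤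
      30 * (1 + Real.log y) ^ 5 * (y + 2 * R * y / √U + R ^ 2 * √y) := by
  have hy' : (1 : ℝ) ≤ y := by exact_mod_cast hy
  have hly := Real.log_nonneg hy'
  set l := 1 + Real.log y with hl
  have hl1 : 1 ≤ l := by linarith
  rcases lt_or_ge (y / D) U with hlt | hge
  · refine (sum_nonpos ?_).trans (by positivity)
    intro q _
    refine (sum_nonpos ?_)
    intro χ _
    rw [typeTwoBlock_eq_zero χ U y D hlt, norm_zero]
  have hD0 : 0 < D := by omega
  set F := y / D with hF
  have hFD : F * D ≤ y := Nat.div_mul_le_self y D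
  have hF1 : 1 ≤ F := hU.trans hge
  have hDy : D ≤ y := by nlinarith
  have hFy : F ≤ y := Nat.div_le_self y D
  have hlog2 : Real.log 2 ≤ 1 := by have := Real.log_two_lt_d9; linarith
  simp_rw [typeTwoBlock_eq_bilinear _ U y D hD0]
  refine (bilinear_large_sieve R (2 * D + 1) (F + 1) (fun d => ((if d ≤ D then 0 else vonMangoldt d : ℝ) : ℂ))
    (fun e => (vaughanTail U e : ℂ)) (fun d => min (y / d + 1) (F + 1)) (fun d => min_le_right _ _)).trans ?_
  have hα : ∑ d ∈ range (2 * D + 1), ‖((if d ≤ D then 0 else vonMangoldt d : ℝ) : ℂ)‖ ^ 2 ≤ D * l ^ 2 := by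
    have h0 : ∀ d ∈ range (2 * D + 1), d ∉ Ioc D (2 * D) → ‖((if d ≤ D then 0 else vonMangoldt d : ℝ) : ℂ)‖ ^ 2 = 0 := by
      intro d hd hd'
      rw [mem_range] at hd; rw [mem_Ioc] at hd'
      rw [if_pos (by omega)]; simp
    rw [← sum_subset (by intro d; simp only [mem_Ioc, mem_range]; omega) h0]
    refine (sum_le_card_nsmul _ _ (l ^ 2) ?_).trans (by simp [two_mul])
    intro d hd
    rw [mem_Ioc] at hd
    rw [if_neg (by omega), Complex.norm_real]
    gcongr
    refine (abs_vonMangoldt_le (2 * D) d (mem_Ioc.mpr ⟨by omega, hd.2⟩)).trans ?_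
    have h3 : (0 : ℝ) < D := by exact_mod_cast hD0
    push_cast
    rw [Real.log_mul (by norm_num) h3.ne']
    have := Real.log_le_log h3 (show (D : ℝ) ≤ y by exact_mod_cast hDy)
    linarith
  have hFpos : (0 : ℝ) < F := by exact_mod_cast hF1
  have hlogF := Real.log_le_log hFpos (show (F : ℝ) ≤ y by exact_mod_cast hFy)
  have hβ : ∑ e ∈ range (F + 1), ‖(vaughanTail U e : ℂ)‖ ^ 2 ≤ F * l ^ 3 := by
    have h0 : ∀ e ∈ range (F + 1), e ∉ Ioc 0 F → ‖(vaughanTail U e : ℂ)‖ ^ 2 = 0 := by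
      intro e he he'
      rw [mem_range] at he; rw [mem_Ioc] at he'
      rw [show e = 0 by omega]; simp
    rw [← sum_subset (by intro d; simp only [mem_Ioc, mem_range]; omega) h0]
    have hlF := Real.log_nonneg (show (1 : ℝ) ≤ F by exact_mod_cast hF1)
    calc _ ≤ ∑ e ∈ Ioc 0 F, ((e.divisors.card : ℝ)) ^ 2 := by
          apply sum_le_sum; intro e _
          rw [Complex.norm_real]
          gcongr
          exact abs_zeta_mul_high_le U e
      _ ≤ F * (1 + Real.log F) ^ 3 := sum_card_divisors_sq_le F
      _ ≤ _ := by gcongr; linarith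
  have hlR : 1 + Real.log ((R : ℝ) ^ 2 + 1) ≤ 2 * l := by
    have hR' : (R : ℝ) ≤ y := by exact_mod_cast hR
    have h1 : (R : ℝ) ^ 2 + 1 ≤ 2 * y ^ 2 := by nlinarith
    have := Real.log_le_log (by positivity) h1
    rw [Real.log_mul (by norm_num) (by positivity), Real.log_pow] at this
    push_cast at this
    have h2 := Real.log_two_lt_d9
    linarith
  have hS : ∀ N M : ℕ, N ≤ 3 * M → sieveConst R N ≤ 6 * l * (M + R ^ 2) := by
    intro N M hNM
    have h1 : (N : ℝ) ≤ 3 * M := by exact_mod_cast hNM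
    unfold sieveConst
    have h2 : 3 * (R : ℝ) ^ 2 * (1 + Real.log (R ^ 2 + 1)) ≤ 3 * R ^ 2 * (2 * l) := by gcongr
    have h3 : (3 : ℝ) * M ≤ 6 * l * M := by
      have : (0 : ℝ) ≤ M := by positivity
      nlinarith
    linarith
  have hDR : (0 : ℝ) ≤ D + R ^ 2 := by positivity
  have hFR : (0 : ℝ) ≤ F + R ^ 2 := by positivity
  have h1 : sieveConst R (2 * D + 1) * ∑ d ∈ range (2 * D + 1), ‖((if d ≤ D then 0 else vonMangoldt d : ℝ) : ℂ)‖ ^ 2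
      ≤ (6 * l * (D + R ^ 2)) * (D * l ^ 2) :=
    mul_le_mul (hS _ _ (by omega)) hα (sum_nonneg (fun _ _ => by positivity)) (by positivity)
  have h2 : sieveConst R (F + 1) * ∑ e ∈ range (F + 1), ‖(vaughanTail U e : ℂ)‖ ^ 2
      ≤ (6 * l * (F + R ^ 2)) * (F * l ^ 3) :=
    mul_le_mul (hS _ _ (by omega)) hβ (sum_nonneg (fun _ _ => by positivity)) (by positivity)
  have hU' : (1 : ℝ) ≤ U := by exact_mod_cast hU
  have hsU : 0 < √(U : ℝ) := Real.sqrt_pos.mpr (by linarith)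
  have hsU2 : √(U : ℝ) ^ 2 = U := Real.sq_sqrt (by linarith)
  have hsy2 : √(y : ℝ) ^ 2 = y := Real.sq_sqrt (by linarith)
  set B := (y : ℝ) + 2 * R * y / √U + R ^ 2 * √y with hB
  have hB0 : 0 ≤ B := by positivity
  have hFDr : (F : ℝ) * D ≤ y := by exact_mod_cast hFD
  have hDU : (D : ℝ) ≤ y / U := by
    rw [le_div_iff₀ (by linarith)]
    have : (U : ℝ) ≤ F := by exact_mod_cast hge
    have : (0 : ℝ) ≤ D := by positivity
    nlinarith
  have hFU : (F : ℝ) ≤ y / U := by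
    rw [le_div_iff₀ (by linarith)]
    have : (U : ℝ) ≤ D := by exact_mod_cast hD
    nlinarith
  have h3 : (((D : ℝ) + R ^ 2) * (F + R ^ 2)) * (F * D) ≤ B ^ 2 := by
    calc (((D : ℝ) + R ^ 2) * (F + R ^ 2)) * (F * D)
        = (F * D + R ^ 2 * (D + F) + R ^ 4) * (F * D) := by ring
      _ ≤ ((y : ℝ) + R ^ 2 * (y / U + y / U) + R ^ 4) * y := by gcongr
      _ = (y : ℝ) ^ 2 + 2 * R ^ 2 * y ^ 2 / U + (R ^ 2 * √(y : ℝ)) ^ 2 := by rw [mul_pow, hsy2]; ring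
      _ ≤ (y : ℝ) ^ 2 + (2 * R * y / √U) ^ 2 + (R ^ 2 * √y) ^ 2 := by
          rw [div_pow, hsU2]
          gcongr
          nlinarith [sq_nonneg ((R : ℝ) * y)]
      _ ≤ B ^ 2 := by
          have a1 : 0 ≤ 2 * R * y / √(U : ℝ) := by positivity
          have a2 : 0 ≤ (R : ℝ) ^ 2 * √y := by positivity
          have a3 : (0 : ℝ) ≤ y := by linarith
          have a4 : ∀ a b c : ℝ, 0 ≤ a → 0 ≤ b → 0 ≤ c → a ^ 2 + b ^ 2 + c ^ 2 ≤ (a + b + c) ^ 2 := by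
            intro a b c ha hb hc
            nlinarith [mul_nonneg ha hb, mul_nonneg ha hc, mul_nonneg hb hc]
          exact a4 _ _ _ a3 a1 a2
  have h4 : √((6 * l * (D + R ^ 2)) * (D * l ^ 2)) * √((6 * l * (F + R ^ 2)) * (F * l ^ 3)) ≤ 6 * l ^ 4 * B := by
    rw [← Real.sqrt_mul (by positivity), Real.sqrt_le_left (by positivity)]
    calc _ = 36 * l ^ 7 * ((((D : ℝ) + R ^ 2) * (F + R ^ 2)) * (F * D)) := by ring
      _ ≤ 36 * l ^ 8 * B ^ 2 := by gcongr; norm_num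
      _ = _ := by ring
  have h5 : 3 + 2 * Real.log ((F + 1 : ℕ) : ℝ) ≤ 5 * l := by
    have h1 : ((F + 1 : ℕ) : ℝ) ≤ 2 * y := by
      have : F + 1 ≤ 2 * y := by omega
      exact_mod_cast this
    have := Real.log_le_log (by positivity) h1
    rw [Real.log_mul (by norm_num) (by positivity)] at this
    linarith
  calc _ ≤ (5 * l) * (6 * l ^ 4 * B) := by
        refine mul_le_mul h5 (le_trans ?_ h4) (by positivity) (by positivity)
        gcongr
    _ = _ := by ring

lemma norm_typeTwo_sum_le (U y R : ℕ) (hU : 1 ≤ U) (hy : 1 ≤ y) (hR : R ≤ y) :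
    ∑ q ∈ Icc 1 R, ∑ χ ∈ primChars q, ‖typeTwo χ U y‖ ≤
      60 * (1 + Real.log y) ^ 6 * (y + 2 * R * y / √U + R ^ 2 * √y) := by
  set J := Nat.log 2 y + 1 with hJ
  have hy' : (1 : ℝ) ≤ y := by exact_mod_cast hy
  have hly := Real.log_nonneg hy'
  have hJ1 : y ≤ U * 2 ^ J := by
    have := (Nat.lt_pow_succ_log_self (b := 2) (by norm_num) y).le
    exact this.trans (Nat.le_mul_of_pos_left _ hU)
  have hJ2 : (J : ℝ) ≤ 2 * (1 + Real.log y) := by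
    have h1 : (2 : ℝ) ^ Nat.log 2 y ≤ y := by exact_mod_cast Nat.pow_log_le_self 2 (by omega)
    have := Real.log_le_log (by positivity) h1
    rw [Real.log_pow] at this
    have h2 := Real.log_two_gt_d9
    rw [hJ]; push_cast
    have h3 : (0 : ℝ) ≤ Nat.log 2 y := by positivity
    nlinarith
  set X := 30 * (1 + Real.log y) ^ 5 * (y + 2 * R * y / √U + R ^ 2 * √y) with hX
  have hX0 : 0 ≤ X := by positivity
  calc _ ≤ ∑ q ∈ Icc 1 R, ∑ χ ∈ primChars q, ∑ j ∈ range J, ‖typeTwoBlock χ U y (U * 2 ^ j)‖ := by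
        apply sum_le_sum; intro q _
        apply sum_le_sum; intro χ _
        rw [typeTwo_eq_sum_blocks χ U y J hJ1]
        exact norm_sum_le _ _
    _ = ∑ j ∈ range J, ∑ q ∈ Icc 1 R, ∑ χ ∈ primChars q, ‖typeTwoBlock χ U y (U * 2 ^ j)‖ := by
        rw [sum_comm]; apply sum_congr rfl; intro q _; rw [sum_comm]
    _ ≤ ∑ j ∈ range J, X := by
        apply sum_le_sum; intro j _
        exact sum_norm_typeTwoBlock_le U y _ R hU (Nat.le_mul_of_pos_right U (by positivity)) hy hR
    _ = J * X := by simp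
    _ ≤ (2 * (1 + Real.log y)) * X := by gcongr
    _ = _ := by rw [hX]; ring

lemma card_primChars_le (q : ℕ) [NeZero q] : ((primChars q).card : ℝ) ≤ q := by
  have h1 : (primChars q).card ≤ q.totient := by
    refine (card_le_univ _).trans ?_
    rw [← Nat.card_eq_fintype_card, DirichletCharacter.card_eq_totient_of_hasEnoughRootsOfUnity]
  exact_mod_cast h1.trans (Nat.totient_le q)

lemma ne_one_of_mem_primChars {q : ℕ} (hq : 2 ≤ q) {χ : DirichletCharacter ℂ q} (h : χ ∈ primChars q) : χ ≠ 1 := by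
  rintro rfl
  have h1 := mem_primChars.mp h
  rw [DirichletCharacter.isPrimitive_def] at h1
  have : NeZero q := ⟨by omega⟩
  rw [DirichletCharacter.conductor_one] at h1
  omega

/-- A mean value estimate for `∑_{n ≤ y} Λ(n) χ(n)` over all primitive characters of modulus at most `R`. -/
theorem sum_norm_vonMangoldt_primChars_le (U y R : ℕ) (hU : 1 ≤ U) (hUy : U ≤ y) (hR : R ≤ y) :
    ∑ q ∈ Icc 2 R, ∑ χ ∈ primChars q, ‖∑ n ∈ Ioc 0 y, twist χ vonMangoldt n‖ ≤
      60 * (1 + Real.log y) ^ 6 * (y + 2 * R * y / √U + R ^ 2 * √y) + 4 * R ^ 3 * U ^ 2 * Real.log y := by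
  have hy : 1 ≤ y := hU.trans hUy
  have hly := Real.log_natCast_nonneg y
  calc _ ≤ ∑ q ∈ Icc 2 R, ∑ χ ∈ primChars q, (‖typeTwo χ U y‖ + 4 * R * U ^ 2 * Real.log y) := by
        apply sum_le_sum; intro q hq
        apply sum_le_sum; intro χ hχ
        rw [mem_Icc] at hq
        have : NeZero q := ⟨by omega⟩
        have h1 := norm_sum_vonMangoldt_sub_typeTwo_le χ (ne_one_of_mem_primChars hq.1 hχ) U y hU hUy
        have h2 : 4 * (q : ℝ) * U ^ 2 * Real.log y ≤ 4 * R * U ^ 2 * Real.log y := by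
          have : (q : ℝ) ≤ R := by exact_mod_cast hq.2
          gcongr
        have h3 := norm_sub_norm_le (∑ n ∈ Ioc 0 y, twist χ vonMangoldt n) (typeTwo χ U y)
        linarith
    _ = ∑ q ∈ Icc 2 R, ∑ χ ∈ primChars q, ‖typeTwo χ U y‖ +
        ∑ q ∈ Icc 2 R, ∑ χ ∈ primChars q, 4 * R * U ^ 2 * Real.log y := by
        simp_rw [sum_add_distrib]
    _ ≤ _ := by
        apply add_le_add
        · refine le_trans ?_ (norm_typeTwo_sum_le U y R hU hy hR)
          apply sum_le_sum_of_subset_of_nonneg (Icc_subset_Icc_left (by norm_num))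
          intros; exact sum_nonneg (fun _ _ => norm_nonneg _)
        · calc _ ≤ ∑ q ∈ Icc 2 R, (R : ℝ) * (4 * R * U ^ 2 * Real.log y) := by
                apply sum_le_sum; intro q hq
                rw [mem_Icc] at hq
                have : NeZero q := ⟨by omega⟩
                rw [sum_const, nsmul_eq_mul]
                have h2 : (q : ℝ) ≤ R := by exact_mod_cast hq.2
                have := card_primChars_le q
                gcongr; exact_mod_cast this.trans h2
            _ = ((Icc 2 R).card : ℝ) * (R * (4 * R * U ^ 2 * Real.log y)) := by rw [sum_const, nsmul_eq_mul]
            _ ≤ R * (R * (4 * R * U ^ 2 * Real.log y)) := by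
                gcongr; simp
            _ = _ := by ring

end ArithmeticFunction

lemma tsum_mul_eq_tsum_partial_sums (a w : ℕ → ℂ) (C : ℝ)
    (hT : ∀ m, ‖∑ i ∈ range m, a i‖ ≤ C)
    (hw : Filter.Tendsto w Filter.atTop (nhds 0)) (haw : Summable fun n => a n * w n)
    (hs : Summable fun n => (∑ i ∈ range (n + 1), a i) * (w n - w (n + 1))) :
    ∑' n, a n * w n = ∑' n, (∑ i ∈ range (n + 1), a i) * (w n - w (n + 1)) := by
  have key : ∀ m, ∑ i ∈ range m, a i * w i
      = (∑ i ∈ range m, a i) * w m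
        + ∑ n ∈ range m, (∑ i ∈ range (n + 1), a i) * (w n - w (n + 1)) := by
    intro m
    induction m with
    | zero => simp
    | succ m ih =>
      rw [sum_range_succ, ih, sum_range_succ a m,
        sum_range_succ (fun n => (∑ i ∈ range (n + 1), a i) * (w n - w (n + 1))) m,
        sum_range_succ a m]
      ring
  have h1 := haw.hasSum.tendsto_sum_nat
  have h2 := hs.hasSum.tendsto_sum_nat
  have h0 : Filter.Tendsto (fun m => (∑ i ∈ range m, a i) * w m) Filter.atTop (nhds 0) := by
    rw [tendsto_zero_iff_norm_tendsto_zero]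
    have hwn := (tendsto_zero_iff_norm_tendsto_zero.mp hw).const_mul C
    rw [mul_zero] at hwn
    refine squeeze_zero (fun _ => norm_nonneg _) (fun m => ?_) hwn
    rw [norm_mul]
    exact mul_le_mul_of_nonneg_right (hT m) (norm_nonneg _)
  have h3 := h0.add h2
  rw [zero_add] at h3
  refine tendsto_nhds_unique h1 (h3.congr fun m => (key m).symm)

lemma norm_cpow_neg_sub_le {s : ℂ} (hs : 0 < s.re) {x y : ℝ} (hx : 0 < x) (hxy : x ≤ y) :
    ‖(x : ℂ) ^ (-s) - (y : ℂ) ^ (-s)‖ ≤ ‖s‖ * x ^ (-s.re - 1) * (y - x) := by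
  have hd : ∀ u ∈ Set.Icc x y, HasDerivWithinAt (fun u : ℝ => (u : ℂ) ^ (-s))
      (-s * (u : ℂ) ^ (-s - 1)) (Set.Icc x y) u := by
    intro u hu
    have hu0 : 0 < u := hx.trans_le hu.1
    have hs0 : s ≠ 0 := by rintro rfl; simp at hs
    exact (hasDerivAt_ofReal_cpow_const hu0.ne' (by simpa using hs0)).hasDerivWithinAt
  have hb : ∀ u ∈ Set.Icc x y, ‖-s * (u : ℂ) ^ (-s - 1)‖ ≤ ‖s‖ * x ^ (-s.re - 1) := by
    intro u hu
    have hu0 : 0 < u := hx.trans_le hu.1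
    rw [norm_mul, norm_neg, Complex.norm_cpow_eq_rpow_re_of_pos hu0]
    refine mul_le_mul_of_nonneg_left ?_ (norm_nonneg _)
    simp only [Complex.sub_re, Complex.neg_re, Complex.one_re]
    exact Real.rpow_le_rpow_of_nonpos hx hu.1 (by linarith)
  have := (convex_Icc x y).norm_image_sub_le_of_norm_hasDerivWithin_le hd hb
    (Set.right_mem_Icc.mpr hxy) (Set.left_mem_Icc.mpr hxy)
  rw [Real.norm_eq_abs, abs_sub_comm, abs_of_nonneg (by linarith)] at this
  exact this

lemma norm_cpow_one_sub_taylor_le {s : ℂ} (hs : 0 < s.re) {x : ℝ} (hx : 0 < x) :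
    ‖(s - 1) * (x : ℂ) ^ (-s) - (x : ℂ) ^ (1 - s) + ((x + 1 : ℝ) : ℂ) ^ (1 - s)‖
      ≤ ‖s - 1‖ * ‖s‖ * x ^ (-s.re - 1) := by
  by_cases hs1 : s = 1
  · subst hs1; simp
  have hd : ∀ u ∈ Set.Icc x (x + 1), HasDerivWithinAt
      (fun u : ℝ => (u : ℂ) ^ (1 - s) + (s - 1) * (x : ℂ) ^ (-s) * (u : ℂ))
      ((1 - s) * (u : ℂ) ^ (1 - s - 1) + (s - 1) * (x : ℂ) ^ (-s) * 1) (Set.Icc x (x + 1)) u := by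
    intro u hu
    have hu0 : 0 < u := hx.trans_le hu.1
    exact ((hasDerivAt_ofReal_cpow_const hu0.ne' (sub_ne_zero.mpr (Ne.symm hs1))).add
      ((Complex.ofRealCLM.hasDerivAt).const_mul _)).hasDerivWithinAt
  have hb : ∀ u ∈ Set.Icc x (x + 1),
      ‖(1 - s) * (u : ℂ) ^ (1 - s - 1) + (s - 1) * (x : ℂ) ^ (-s) * 1‖
        ≤ ‖s - 1‖ * ‖s‖ * x ^ (-s.re - 1) := by
    intro u hu
    have hu0 : 0 < u := hx.trans_le hu.1
    have e : (1 - s) * (u : ℂ) ^ (1 - s - 1) + (s - 1) * (x : ℂ) ^ (-s) * 1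
        = (s - 1) * ((x : ℂ) ^ (-s) - (u : ℂ) ^ (-s)) := by
      rw [show 1 - s - 1 = -s by ring]; ring
    rw [e, norm_mul, mul_assoc]
    refine mul_le_mul_of_nonneg_left ((norm_cpow_neg_sub_le hs hx hu.1).trans ?_) (norm_nonneg _)
    have h1 : u - x ≤ 1 := by linarith [hu.2]
    have h2 : 0 ≤ ‖s‖ * x ^ (-s.re - 1) := by positivity
    nlinarith
  have := (convex_Icc x (x + 1)).norm_image_sub_le_of_norm_hasDerivWithin_le hd hb
    (Set.left_mem_Icc.mpr (by linarith)) (Set.right_mem_Icc.mpr (by linarith))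
  simp only [add_sub_cancel_left, norm_one, mul_one] at this
  refine le_trans (le_of_eq ?_) this
  congr 1
  push_cast
  ring

lemma summable_succ_rpow {p : ℝ} (hp : 1 < p) :
    Summable fun n : ℕ => ((n : ℝ) + 1) ^ (-p) := by
  have := (summable_nat_add_iff 1).mpr (Real.summable_nat_rpow.mpr (by linarith : -p < -1))
  simpa using this

lemma eq_tsum_of_continuation (F : ℂ → ℂ) (u : ℕ → ℂ → ℂ) (A : ℝ)
    (hF : DifferentiableOn ℂ F {s | 0 < s.re})
    (hu : ∀ n, DifferentiableOn ℂ (u n) {s | 0 < s.re})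
    (hb : ∀ n s, 0 < s.re → ‖u n s‖ ≤ A * (1 + ‖s‖) ^ 2 * ((n : ℝ) + 1) ^ (-s.re - 1))
    (heq : ∀ s, 1 < s.re → F s = ∑' n, u n s) {s : ℂ} (hs : 0 < s.re) :
    F s = ∑' n, u n s := by
  have hA : 0 ≤ A := by
    have h := (norm_nonneg _).trans (hb 0 1 (by simp))
    norm_num at h
    linarith
  have hU : IsOpen {s : ℂ | 0 < s.re} := isOpen_lt continuous_const Complex.continuous_re
  have hE : DifferentiableOn ℂ (fun s => ∑' n, u n s) {s | 0 < s.re} := by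
    intro z hz
    have hz' : 0 < z.re := hz
    set V : Set ℂ := {w | z.re / 2 < w.re} ∩ Metric.ball 0 (‖z‖ + 1) with hV
    have hVo : IsOpen V :=
      (isOpen_lt continuous_const Complex.continuous_re).inter Metric.isOpen_ball
    have hzV : z ∈ V := ⟨by simp only [Set.mem_ofPred_eq]; linarith, by simp⟩
    have hsub : V ⊆ {s : ℂ | 0 < s.re} := fun w hw => by
      have := hw.1
      simp only [Set.mem_ofPred_eq] at this ⊢
      linarith
    have hd : DifferentiableOn ℂ (fun s => ∑' n, u n s) V := by
      refine Complex.differentiableOn_tsum_of_summable_norm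
        (u := fun n : ℕ => A * (2 + ‖z‖) ^ 2 * ((n : ℝ) + 1) ^ (-(z.re / 2 + 1)))
        ((summable_succ_rpow (by linarith)).mul_left _) (fun n => (hu n).mono hsub) hVo ?_
      intro n w hw
      have h1 : z.re / 2 < w.re := hw.1
      have h2 : ‖w‖ < ‖z‖ + 1 := by simpa using hw.2
      refine (hb n w (hsub hw)).trans ?_
      gcongr ?_ * ?_ ^ 2 * ?_
      · linarith
      · exact Real.rpow_le_rpow_of_exponent_le (by linarith [n.cast_nonneg (α := ℝ)])
          (by linarith)
    exact (hd.differentiableAt (hVo.mem_nhds hzV)).differentiableWithinAt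
  have hconv : IsPreconnected {s : ℂ | 0 < s.re} :=
    (convex_halfSpace_re_gt 0).isPreconnected
  have h2 : (2 : ℂ) ∈ {s : ℂ | 0 < s.re} := by simp
  refine (hF.analyticOnNhd hU).eqOn_of_preconnected_of_eventuallyEq (hE.analyticOnNhd hU) hconv h2
    ?_ hs
  have : {s : ℂ | 1 < s.re} ∈ nhds (2 : ℂ) :=
    (isOpen_lt continuous_const Complex.continuous_re).mem_nhds (by simp)
  filter_upwards [this] with w hw using heq w hw

lemma LSeries_eq_sum_add_tsum {f : ℕ → ℂ} {s : ℂ} (hs : LSeriesSummable f s) {N : ℕ} (hN : 1 ≤ N) :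
    (Summable fun n : ℕ => f (N + n) * ((N + n : ℕ) : ℂ) ^ (-s)) ∧
    LSeries f s = ∑ n ∈ Ico 1 N, f n * (n : ℂ) ^ (-s)
      + ∑' n : ℕ, f (N + n) * ((N + n : ℕ) : ℂ) ^ (-s) := by
  have e : ∀ n : ℕ, 1 ≤ n → LSeries.term f s n = f n * (n : ℂ) ^ (-s) := by
    intro n hn
    rw [LSeries.term_of_ne_zero (by omega), Complex.cpow_neg, div_eq_mul_inv]
  have h1 : (fun n : ℕ => f (N + n) * ((N + n : ℕ) : ℂ) ^ (-s))
      = fun n => LSeries.term f s (n + N) := by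
    funext n
    rw [e (n + N) (by omega), add_comm n N]
  rw [h1]
  refine ⟨(summable_nat_add_iff N).mpr hs, ?_⟩
  rw [LSeries, ← Summable.sum_add_tsum_nat_add N hs, range_eq_Ico, sum_eq_sum_Ico_succ_bot (by omega)]
  simp only [LSeries.term_zero, zero_add]
  congr 1
  exact sum_congr rfl fun n hn => e n (mem_Ico.mp hn).1

lemma tendsto_natCast_cpow_neg {s : ℂ} (hs : 0 < s.re) (N : ℕ) (hN : 1 ≤ N) :
    Filter.Tendsto (fun n : ℕ => ((N + n : ℕ) : ℂ) ^ (-s)) Filter.atTop (nhds 0) := by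
  rw [tendsto_zero_iff_norm_tendsto_zero]
  have h : ∀ n : ℕ, ‖((N + n : ℕ) : ℂ) ^ (-s)‖ = ((N + n : ℕ) : ℝ) ^ (-s.re) := by
    intro n
    rw [Complex.norm_natCast_cpow_of_pos (by omega)]; simp
  simp_rw [h]
  refine (tendsto_rpow_neg_atTop hs).comp (tendsto_natCast_atTop_atTop.comp ?_)
  exact Filter.tendsto_atTop_mono (fun n => Nat.le_add_left n N) Filter.tendsto_id

lemma norm_natCast_cpow_neg_sub_le {s : ℂ} (hs : 0 < s.re) {n : ℕ} (hn : 1 ≤ n) :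
    ‖(n : ℂ) ^ (-s) - ((n + 1 : ℕ) : ℂ) ^ (-s)‖ ≤ ‖s‖ * (n : ℝ) ^ (-s.re - 1) := by
  have := norm_cpow_neg_sub_le hs (x := n) (y := (n + 1 : ℕ)) (by positivity) (by simp)
  simpa using this

lemma add_rpow_neg_le {p : ℝ} (hp : 0 ≤ p) {N : ℕ} (hN : 1 ≤ N) (n : ℕ) :
    ((N + n : ℕ) : ℝ) ^ (-p - 1) ≤ ((n : ℝ) + 1) ^ (-p - 1) := by
  refine Real.rpow_le_rpow_of_nonpos (by positivity) ?_ (by linarith)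
  have : (1 : ℝ) ≤ N := by exact_mod_cast hN
  push_cast; linarith

section Periodic

variable {q : ℕ} [NeZero q] (g : ZMod q → ℂ)

lemma norm_sum_range_window_le (h0 : ∑ j, g j = 0) {B : ℝ} (hB : ∀ j, ‖g j‖ ≤ B) (N m : ℕ) :
    ‖∑ i ∈ range m, g ((N + i : ℕ) : ZMod q)‖ ≤ q * B := by
  refine norm_sum_range_periodic_le (NeZero.pos q) (fun i => g ((N + i : ℕ) : ZMod q))
    (fun n => by simp) ?_ B (fun n => hB _) m
  rw [← h0, ← Equiv.sum_comp (Equiv.addLeft (N : ZMod q))]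
  symm
  refine sum_nbij' (fun a : ZMod q => a.val) (fun n : ℕ => (n : ZMod q)) ?_ ?_ ?_ ?_ ?_
  · intro a _; exact mem_range.mpr (ZMod.val_lt a)
  · intro a _; exact mem_univ _
  · intro a _; exact ZMod.natCast_zmod_val a
  · intro n hn; exact ZMod.val_cast_of_lt (mem_range.mp hn)
  · intro a _; simp

lemma norm_window_term_le (h0 : ∑ j, g j = 0) {B : ℝ} (hB : ∀ j, ‖g j‖ ≤ B) {N : ℕ} (hN : 1 ≤ N)
    (n : ℕ) {s : ℂ} (hs : 0 < s.re) :
    ‖(∑ i ∈ range (n + 1), g ((N + i : ℕ) : ZMod q)) *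
      (((N + n : ℕ) : ℂ) ^ (-s) - ((N + (n + 1) : ℕ) : ℂ) ^ (-s))‖
      ≤ q * B * (‖s‖ * ((N + n : ℕ) : ℝ) ^ (-s.re - 1)) := by
  rw [norm_mul]
  have hB0 : 0 ≤ B := (norm_nonneg _).trans (hB 0)
  exact mul_le_mul (norm_sum_range_window_le g h0 hB N (n + 1))
    (norm_natCast_cpow_neg_sub_le hs (n := N + n) (by omega)) (norm_nonneg _) (by positivity)

lemma summable_add_rpow {p : ℝ} (hp : 0 < p) {N : ℕ} (hN : 1 ≤ N) :
    Summable fun n : ℕ => ((N + n : ℕ) : ℝ) ^ (-p - 1) := by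
  have := summable_succ_rpow (p := p + 1) (by linarith)
  rw [show -(p + 1) = -p - 1 by ring] at this
  exact this.of_nonneg_of_le (fun n => by positivity) (fun n => add_rpow_neg_le hp.le hN n)

lemma ZMod.LFunction_eq_sum_add_tsum (h0 : ∑ j, g j = 0) {N : ℕ} (hN : 1 ≤ N)
    {s : ℂ} (hs : 0 < s.re) :
    ZMod.LFunction g s = ∑ n ∈ Ico 1 N, g n * (n : ℂ) ^ (-s)
      + ∑' n : ℕ, (∑ i ∈ range (n + 1), g ((N + i : ℕ) : ZMod q)) *
      (((N + n : ℕ) : ℂ) ^ (-s) - ((N + (n + 1) : ℕ) : ℂ) ^ (-s)) := by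
  obtain ⟨B, hB⟩ : ∃ B : ℝ, ∀ j, ‖g j‖ ≤ B :=
    ⟨∑ j, ‖g j‖, fun j => single_le_sum (f := fun j => ‖g j‖) (fun i _ => norm_nonneg _) (mem_univ j)⟩
  have hB0 : 0 ≤ B := (norm_nonneg _).trans (hB 0)
  rw [← sub_eq_iff_eq_add']
  have hdn : ∀ n : ℕ, 1 ≤ n → Differentiable ℂ fun s : ℂ => (n : ℂ) ^ (-s) := by
    intro n hn
    have : (n : ℂ) ≠ 0 := by exact_mod_cast (by omega : n ≠ 0)
    intro z
    exact (differentiableAt_id.neg).const_cpow (Or.inl this)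
  refine eq_tsum_of_continuation (fun s => ZMod.LFunction g s - ∑ n ∈ Ico 1 N, g n * (n : ℂ) ^ (-s))
    (fun n s => (∑ i ∈ range (n + 1), g ((N + i : ℕ) : ZMod q)) *
      (((N + n : ℕ) : ℂ) ^ (-s) - ((N + (n + 1) : ℕ) : ℂ) ^ (-s))) (q * B) ?_ ?_ ?_ ?_ hs
  · refine Differentiable.differentiableOn ?_
    refine (ZMod.differentiable_LFunction_of_sum_zero h0).sub ?_
    exact Differentiable.fun_sum fun n hn => (hdn n (mem_Ico.mp hn).1).const_mul _
  · intro n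
    exact (((hdn _ (by omega)).sub (hdn _ (by omega))).const_mul _).differentiableOn
  · intro n z hz
    refine (norm_window_term_le g h0 hB hN n hz).trans ?_
    rw [mul_assoc (_ * B)]
    have h1 := add_rpow_neg_le hz.le hN n
    have h2 : ‖z‖ ≤ (1 + ‖z‖) ^ 2 := by nlinarith [norm_nonneg z]
    gcongr
  · intro z hz
    have hz0 : 0 < z.re := by linarith
    have hsum := ZMod.LSeriesSummable_of_one_lt_re g hz
    obtain ⟨hs1, hs2⟩ := LSeries_eq_sum_add_tsum hsum hN
    rw [ZMod.LFunction_eq_LSeries g hz, hs2, add_sub_cancel_left]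
    refine tsum_mul_eq_tsum_partial_sums (fun n => g ((N + n : ℕ) : ZMod q))
      (fun n => ((N + n : ℕ) : ℂ) ^ (-z)) (q * B) (norm_sum_range_window_le g h0 hB N)
      (tendsto_natCast_cpow_neg hz0 N hN) hs1 ?_
    refine Summable.of_norm_bounded
      (((summable_add_rpow hz0 hN).mul_left ‖z‖).mul_left (q * B)) fun n => ?_
    exact norm_window_term_le g h0 hB hN n hz0

end Periodic

lemma riemannZeta₁_eq_sum_add_tsum {N : ℕ} (hN : 1 ≤ N) {s : ℂ} (hs : 0 < s.re) :
    riemannZeta₁ s = (s - 1) * ∑ n ∈ Ico 1 N, (n : ℂ) ^ (-s) + (N : ℂ) ^ (1 - s)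
      + ∑' n : ℕ, ((s - 1) * ((N + n : ℕ) : ℂ) ^ (-s) - ((N + n : ℕ) : ℂ) ^ (1 - s)
        + ((N + (n + 1) : ℕ) : ℂ) ^ (1 - s)) := by
  rw [← sub_eq_iff_eq_add']
  have hdn : ∀ n : ℕ, 1 ≤ n → Differentiable ℂ fun s : ℂ => (n : ℂ) ^ (-s) := by
    intro n hn
    have : (n : ℂ) ≠ 0 := by exact_mod_cast (by omega : n ≠ 0)
    intro z
    exact (differentiableAt_id.neg).const_cpow (Or.inl this)
  have hdn' : ∀ n : ℕ, 1 ≤ n → Differentiable ℂ fun s : ℂ => (n : ℂ) ^ (1 - s) := by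
    intro n hn
    have : (n : ℂ) ≠ 0 := by exact_mod_cast (by omega : n ≠ 0)
    intro z
    exact (differentiableAt_id.const_sub 1).const_cpow (Or.inl this)
  have hlin : Differentiable ℂ fun s : ℂ => s - 1 := by fun_prop
  have hterm : ∀ (n : ℕ) (z : ℂ), 0 < z.re →
      ‖(z - 1) * ((N + n : ℕ) : ℂ) ^ (-z) - ((N + n : ℕ) : ℂ) ^ (1 - z)
        + ((N + (n + 1) : ℕ) : ℂ) ^ (1 - z)‖ ≤ 1 * (1 + ‖z‖) ^ 2 * ((n : ℝ) + 1) ^ (-z.re - 1) := by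
    intro n z hz
    have := norm_cpow_one_sub_taylor_le hz (x := (N + n : ℕ)) (by positivity)
    push_cast at this ⊢
    rw [← add_assoc]
    refine this.trans ?_
    have h1 := add_rpow_neg_le hz.le hN n
    push_cast at h1
    have h2 : ‖z - 1‖ ≤ 1 + ‖z‖ := (norm_sub_le _ _).trans (by rw [norm_one]; linarith)
    have h3 : ‖z - 1‖ * ‖z‖ ≤ 1 * (1 + ‖z‖) ^ 2 := by
      nlinarith [norm_nonneg z, norm_nonneg (z - 1)]
    gcongr
  refine eq_tsum_of_continuation (fun s => riemannZeta₁ s - ((s - 1) * ∑ n ∈ Ico 1 N, (n : ℂ) ^ (-s)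
    + (N : ℂ) ^ (1 - s))) (fun n s => (s - 1) * ((N + n : ℕ) : ℂ) ^ (-s) - ((N + n : ℕ) : ℂ) ^ (1 - s)
        + ((N + (n + 1) : ℕ) : ℂ) ^ (1 - s)) 1 ?_ ?_ (fun n z hz => hterm n z hz) ?_ hs
  · refine Differentiable.differentiableOn ?_
    refine differentiable_riemannZeta₁.sub ((hlin.mul ?_).add (hdn' N hN))
    exact Differentiable.fun_sum fun n hn => (hdn n (mem_Ico.mp hn).1)
  · intro n
    exact (((hlin.mul (hdn _ (by omega))).sub (hdn' _ (by omega))).add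
      (hdn' _ (by omega))).differentiableOn
  · intro z hz
    have hz0 : 0 < z.re := by linarith
    have hz1 : z ≠ 1 := by rintro rfl; simp at hz
    have hsum : LSeriesSummable 1 z := LSeriesSummable_one_iff.mpr hz
    obtain ⟨hs1, hs2⟩ := LSeries_eq_sum_add_tsum hsum hN
    simp only [Pi.one_apply, one_mul] at hs1 hs2
    have e1 : riemannZeta₁ z = (z - 1) * riemannZeta z := by
      rw [riemannZeta_eq_inv_sub_mul hz1, mul_inv_cancel_left₀ (sub_ne_zero.mpr hz1)]
    have htel : HasSum (fun n : ℕ => ((N + (n + 1) : ℕ) : ℂ) ^ (1 - z) - ((N + n : ℕ) : ℂ) ^ (1 - z))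
        (0 - (N : ℂ) ^ (1 - z)) := by
      have hA : Summable (fun n : ℕ => ((N + (n + 1) : ℕ) : ℂ) ^ (1 - z) - ((N + n : ℕ) : ℂ) ^ (1 - z)) := by
        have h1 : Summable (fun n : ℕ => (z - 1) * ((N + n : ℕ) : ℂ) ^ (-z) - ((N + n : ℕ) : ℂ) ^ (1 - z)
            + ((N + (n + 1) : ℕ) : ℂ) ^ (1 - z)) := by
          have h2 := (summable_succ_rpow (p := z.re + 1) (by linarith)).mul_left (1 * (1 + ‖z‖) ^ 2)
          rw [show -(z.re + 1) = -z.re - 1 by ring] at h2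
          exact Summable.of_norm_bounded h2 fun n => hterm n z hz0
        refine (h1.sub (hs1.mul_left (z - 1))).congr fun n => ?_
        ring
      have := hA.hasSum.tendsto_sum_nat
      have h3 : Filter.Tendsto (fun m : ℕ => ∑ n ∈ range m,
          (((N + (n + 1) : ℕ) : ℂ) ^ (1 - z) - ((N + n : ℕ) : ℂ) ^ (1 - z)))
          Filter.atTop (nhds (0 - (N : ℂ) ^ (1 - z))) := by
        simp_rw [sum_range_sub (fun n : ℕ => ((N + n : ℕ) : ℂ) ^ (1 - z)), add_zero]
        have := tendsto_natCast_cpow_neg (s := z - 1) (by simpa using hz) N hN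
        rw [neg_sub] at this
        exact this.sub tendsto_const_nhds
      rw [← tendsto_nhds_unique this h3]
      exact hA.hasSum
    rw [e1, ← LSeries_one_eq_riemannZeta hz, hs2]
    have h4 := (hs1.hasSum.mul_left (z - 1)).add htel
    have h5 : (fun n : ℕ => (z - 1) * ((N + n : ℕ) : ℂ) ^ (-z) - ((N + n : ℕ) : ℂ) ^ (1 - z)
        + ((N + (n + 1) : ℕ) : ℂ) ^ (1 - z)) = fun n : ℕ => (z - 1) * ((N + n : ℕ) : ℂ) ^ (-z) +
        (((N + (n + 1) : ℕ) : ℂ) ^ (1 - z) - ((N + n : ℕ) : ℂ) ^ (1 - z)) := by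
      funext n; ring
    rw [h5, h4.tsum_eq]
    ring

lemma exists_sum_rpow_neg_le {η : ℝ} (hη : 0 < η) :
    ∃ C : ℝ, 0 < C ∧ ∀ (N : ℕ) (σ : ℝ), 1 - η ≤ σ →
      ∑ n ∈ Ico 1 N, (n : ℝ) ^ (-σ) ≤ C * (N : ℝ) ^ (2 * η) := by
  have hsum := summable_succ_rpow (p := 1 + η) (by linarith)
  refine ⟨∑' n : ℕ, ((n : ℝ) + 1) ^ (-(1 + η)) + 1, ?_, fun N σ hσ => ?_⟩
  · have : 0 ≤ ∑' n : ℕ, ((n : ℝ) + 1) ^ (-(1 + η)) := tsum_nonneg fun n => by positivity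
    linarith
  have h1 : ∀ n ∈ Ico 1 N, (n : ℝ) ^ (-σ) ≤ (n : ℝ) ^ (-(1 + η)) * (N : ℝ) ^ (2 * η) := by
    intro n hn
    obtain ⟨hn1, hn2⟩ := mem_Ico.mp hn
    have hn1' : (1 : ℝ) ≤ n := by exact_mod_cast hn1
    calc (n : ℝ) ^ (-σ) ≤ (n : ℝ) ^ (-(1 + η) + 2 * η) :=
          Real.rpow_le_rpow_of_exponent_le hn1' (by linarith)
      _ = (n : ℝ) ^ (-(1 + η)) * (n : ℝ) ^ (2 * η) := Real.rpow_add (by linarith) _ _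
      _ ≤ _ := by gcongr
  refine (sum_le_sum h1).trans ?_
  rw [← sum_mul]
  gcongr
  have h2 : ∑ n ∈ Ico 1 N, (n : ℝ) ^ (-(1 + η)) ≤ ∑' n : ℕ, ((n : ℝ) + 1) ^ (-(1 + η)) := by
    rw [sum_Ico_eq_sum_range]
    refine le_trans (le_of_eq (sum_congr rfl fun n _ => ?_))
      (hsum.sum_le_tsum (range (N - 1)) fun n _ => by positivity)
    push_cast; rw [add_comm]
  linarith

lemma exists_tsum_rpow_neg_le :
    ∃ C : ℝ, 0 < C ∧ ∀ (N : ℕ) (σ : ℝ), 1 ≤ N → 1 / 2 ≤ σ →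
      ∑' n : ℕ, ((N + n : ℕ) : ℝ) ^ (-σ - 1) ≤ C * (N : ℝ) ^ (-(1 / 4) : ℝ) := by
  have hsum := summable_succ_rpow (p := 5 / 4) (by norm_num)
  refine ⟨∑' n : ℕ, ((n : ℝ) + 1) ^ (-(5 / 4) : ℝ) + 1, ?_, fun N σ hN hσ => ?_⟩
  · have : 0 ≤ ∑' n : ℕ, ((n : ℝ) + 1) ^ (-(5 / 4) : ℝ) := tsum_nonneg fun n => by positivity
    linarith
  have hN' : (1 : ℝ) ≤ N := by exact_mod_cast hN
  have h1 : ∀ n : ℕ, ((N + n : ℕ) : ℝ) ^ (-σ - 1)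
      ≤ ((n : ℝ) + 1) ^ (-(5 / 4) : ℝ) * (N : ℝ) ^ (-(1 / 4) : ℝ) := by
    intro n
    have hn0 : (0 : ℝ) ≤ n := n.cast_nonneg
    calc ((N + n : ℕ) : ℝ) ^ (-σ - 1) ≤ ((N + n : ℕ) : ℝ) ^ (-(5 / 4) + -(1 / 4) : ℝ) :=
          Real.rpow_le_rpow_of_exponent_le (by push_cast; linarith) (by linarith)
      _ = ((N + n : ℕ) : ℝ) ^ (-(5 / 4) : ℝ) * ((N + n : ℕ) : ℝ) ^ (-(1 / 4) : ℝ) :=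
          Real.rpow_add (by push_cast; linarith) _ _
      _ ≤ _ := by
          gcongr ?_ * ?_
          · exact Real.rpow_le_rpow_of_nonpos (by positivity) (by push_cast; linarith) (by norm_num)
          · exact Real.rpow_le_rpow_of_nonpos (by positivity) (by push_cast; linarith) (by norm_num)
  refine (Summable.tsum_le_tsum h1 (summable_add_rpow (by linarith) hN) (hsum.mul_right _)).trans ?_
  rw [tsum_mul_right]
  gcongr
  linarith

lemma norm_sum_Ico_cpow_le {f : ℕ → ℂ} {B : ℝ} (hf : ∀ n, ‖f n‖ ≤ B) (s : ℂ) (N : ℕ) :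
    ‖∑ n ∈ Ico 1 N, f n * (n : ℂ) ^ (-s)‖ ≤ B * ∑ n ∈ Ico 1 N, (n : ℝ) ^ (-s.re) := by
  rw [mul_sum]
  refine norm_sum_le_of_le _ fun n hn => ?_
  rw [norm_mul, Complex.norm_natCast_cpow_of_pos (mem_Ico.mp hn).1, Complex.neg_re]
  exact mul_le_mul_of_nonneg_right (hf n) (by positivity)

lemma norm_LFunction_le_of_split {q : ℕ} [NeZero q] (g : ZMod q → ℂ) (h0 : ∑ j, g j = 0) {B : ℝ}
    (hB : ∀ j, ‖g j‖ ≤ B) {N : ℕ} (hN : 1 ≤ N) {s : ℂ} (hs : 0 < s.re) :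
    ‖ZMod.LFunction g s‖ ≤ B * ∑ n ∈ Ico 1 N, (n : ℝ) ^ (-s.re)
      + q * B * (‖s‖ * ∑' n : ℕ, ((N + n : ℕ) : ℝ) ^ (-s.re - 1)) := by
  rw [ZMod.LFunction_eq_sum_add_tsum g h0 hN hs]
  refine (norm_add_le _ _).trans (add_le_add (norm_sum_Ico_cpow_le (fun n => hB _) s N) ?_)
  rw [← tsum_mul_left, ← tsum_mul_left]
  have hsum := (((summable_add_rpow hs hN).mul_left ‖s‖).mul_left (q * B))
  exact tsum_of_norm_bounded hsum.hasSum fun n => norm_window_term_le g h0 hB hN n hs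

/-- The analytic conductor of an `L`-function of modulus `q` at the point `s`. -/
noncomputable def anaCond (q : ℕ) (s : ℂ) : ℝ := q * (|s.im| + 4)

lemma four_le_anaCond (q : ℕ) [NeZero q] (s : ℂ) : 4 ≤ anaCond q s := by
  have h1 : (1 : ℝ) ≤ q := by exact_mod_cast NeZero.one_le
  unfold anaCond
  nlinarith [abs_nonneg s.im]

lemma anaCond_one_le (q : ℕ) [NeZero q] (s : ℂ) : anaCond 1 s ≤ anaCond q s := by
  have h1 : (1 : ℝ) ≤ q := by exact_mod_cast NeZero.one_le
  unfold anaCond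
  push_cast
  nlinarith [abs_nonneg s.im]

lemma norm_le_add_abs_im {s : ℂ} (h0 : 0 ≤ s.re) (h3 : s.re ≤ 3) : ‖s‖ ≤ |s.im| + 4 := by
  have := Complex.norm_le_abs_re_add_abs_im s
  rw [abs_of_nonneg h0] at this
  linarith

lemma exists_split_point {X : ℝ} (hX : 4 ≤ X) :
    ∃ N : ℕ, 1 ≤ N ∧ (N : ℝ) ^ (-(1 / 4) : ℝ) ≤ X⁻¹ ∧
      ∀ η : ℝ, 0 < η → η ≤ 1 / 8 → (N : ℝ) ^ (2 * η) ≤ 2 * X ^ (8 * η) := by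
  have hX0 : 0 < X := by linarith
  have hX4 : (1 : ℝ) ≤ X ^ 4 := one_le_pow₀ (by linarith)
  have hc : X ^ 4 ≤ (⌈X ^ 4⌉₊ : ℝ) := Nat.le_ceil _
  refine ⟨⌈X ^ 4⌉₊, Nat.one_le_ceil_iff.mpr (by linarith), ?_, fun η h0 h1 => ?_⟩
  · calc (⌈X ^ 4⌉₊ : ℝ) ^ (-(1 / 4) : ℝ) ≤ (X ^ 4) ^ (-(1 / 4) : ℝ) :=
          Real.rpow_le_rpow_of_nonpos (by positivity) hc (by norm_num)
      _ = X⁻¹ := by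
          rw [← Real.rpow_natCast, ← Real.rpow_mul hX0.le, ← Real.rpow_neg_one]
          norm_num
  · have h2 : (⌈X ^ 4⌉₊ : ℝ) ≤ 2 * X ^ 4 := by
      linarith [(Nat.ceil_lt_add_one (by positivity : 0 ≤ X ^ 4)).le]
    calc (⌈X ^ 4⌉₊ : ℝ) ^ (2 * η) ≤ (2 * X ^ 4) ^ (2 * η) := by gcongr
      _ = 2 ^ (2 * η) * X ^ (8 * η) := by
          rw [Real.mul_rpow (by norm_num) (by positivity), ← Real.rpow_natCast X 4,
            ← Real.rpow_mul hX0.le]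
          norm_num
          left; ring_nf
      _ ≤ 2 * X ^ (8 * η) := by
          gcongr
          calc (2 : ℝ) ^ (2 * η) ≤ 2 ^ (1 : ℝ) :=
                Real.rpow_le_rpow_of_exponent_le (by norm_num) (by linarith)
            _ = 2 := Real.rpow_one 2

lemma exists_norm_LFunction_le {η : ℝ} (h0 : 0 < η) (h1 : η ≤ 1 / 8) :
    ∃ C : ℝ, 0 < C ∧ ∀ (q : ℕ) [NeZero q] (g : ZMod q → ℂ) (B : ℝ), ∑ j, g j = 0 →
      (∀ j, ‖g j‖ ≤ B) → ∀ s : ℂ, 1 - η ≤ s.re → s.re ≤ 3 →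
      ‖ZMod.LFunction g s‖ ≤ C * B * anaCond q s ^ (8 * η) := by
  obtain ⟨C₁, hC₁, h₁⟩ := exists_sum_rpow_neg_le h0
  obtain ⟨C₂, hC₂, h₂⟩ := exists_tsum_rpow_neg_le
  refine ⟨2 * C₁ + C₂, by positivity, fun q _ g B hg hB s hs1 hs3 => ?_⟩
  have hX := four_le_anaCond q s
  obtain ⟨N, hN, hN1, hN2⟩ := exists_split_point hX
  have hs0 : 0 < s.re := by linarith
  have hB0 : 0 ≤ B := (norm_nonneg _).trans (hB 0)
  have hXp : 1 ≤ anaCond q s ^ (8 * η) := Real.one_le_rpow (by linarith) (by linarith)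
  refine (norm_LFunction_le_of_split g hg hB hN hs0).trans ?_
  have e1 : ∑ n ∈ Ico 1 N, (n : ℝ) ^ (-s.re) ≤ C₁ * (2 * anaCond q s ^ (8 * η)) :=
    (h₁ N s.re hs1).trans (by gcongr; exact hN2 η h0 h1)
  have e2 : ∑' n : ℕ, ((N + n : ℕ) : ℝ) ^ (-s.re - 1) ≤ C₂ * (anaCond q s)⁻¹ :=
    (h₂ N s.re hN (by linarith)).trans (by gcongr)
  have e3 : q * (‖s‖ * ∑' n : ℕ, ((N + n : ℕ) : ℝ) ^ (-s.re - 1)) ≤ C₂ := by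
    calc q * (‖s‖ * ∑' n : ℕ, ((N + n : ℕ) : ℝ) ^ (-s.re - 1))
        ≤ q * ((|s.im| + 4) * (C₂ * (anaCond q s)⁻¹)) := by
          gcongr; exact norm_le_add_abs_im hs0.le hs3
      _ = C₂ * (anaCond q s * (anaCond q s)⁻¹) := by rw [anaCond]; ring
      _ = C₂ := by rw [mul_inv_cancel₀ (by linarith), mul_one]
  have e4 : C₂ ≤ C₂ * anaCond q s ^ (8 * η) := le_mul_of_one_le_right hC₂.le hXp
  calc B * ∑ n ∈ Ico 1 N, (n : ℝ) ^ (-s.re)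
      + q * B * (‖s‖ * ∑' n : ℕ, ((N + n : ℕ) : ℝ) ^ (-s.re - 1))
      = B * (∑ n ∈ Ico 1 N, (n : ℝ) ^ (-s.re)
        + q * (‖s‖ * ∑' n : ℕ, ((N + n : ℕ) : ℝ) ^ (-s.re - 1))) := by ring
    _ ≤ B * (C₁ * (2 * anaCond q s ^ (8 * η)) + C₂ * anaCond q s ^ (8 * η)) := by
        exact mul_le_mul_of_nonneg_left (add_le_add e1 (e3.trans e4)) hB0
    _ = _ := by ring

lemma exists_norm_LFunction_le_half :
    ∃ C : ℝ, 0 < C ∧ ∀ (q : ℕ) [NeZero q] (g : ZMod q → ℂ) (B : ℝ), ∑ j, g j = 0 →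
      (∀ j, ‖g j‖ ≤ B) → ∀ s : ℂ, 1 / 2 ≤ s.re → ‖ZMod.LFunction g s‖ ≤ C * B * q * ‖s‖ := by
  obtain ⟨C₂, hC₂, h₂⟩ := exists_tsum_rpow_neg_le
  refine ⟨C₂, hC₂, fun q _ g B hg hB s hs1 => ?_⟩
  have hB0 : 0 ≤ B := (norm_nonneg _).trans (hB 0)
  refine (norm_LFunction_le_of_split g hg hB le_rfl (by linarith)).trans ?_
  have := h₂ 1 s.re le_rfl hs1
  simp only [Nat.cast_one, Real.one_rpow, mul_one] at this
  simp only [Ico_self, sum_empty, mul_zero, zero_add]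
  calc q * B * (‖s‖ * ∑' n : ℕ, ((1 + n : ℕ) : ℝ) ^ (-s.re - 1)) ≤ q * B * (‖s‖ * C₂) := by gcongr
    _ = _ := by ring

lemma exists_norm_riemannZeta₀_le {η : ℝ} (h0 : 0 < η) (h1 : η ≤ 1 / 8) :
    ∃ C : ℝ, 0 < C ∧ ∀ s : ℂ, 1 - η ≤ s.re → s.re ≤ 3 →
      ‖riemannZeta₀ s‖ ≤ C * anaCond 1 s ^ (8 * η) := by
  obtain ⟨C₁, hC₁, h₁⟩ := exists_sum_rpow_neg_le h0
  obtain ⟨C₂, hC₂, h₂⟩ := exists_tsum_rpow_neg_le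
  obtain ⟨C₃, hC₃⟩ := (isCompact_closedBall (1 : ℂ) (1 / 2)).exists_bound_of_continuousOn
    differentiable_riemannZeta₀.continuous.continuousOn
  refine ⟨2 * C₁ + 6 + C₂ + |C₃|, by positivity, fun s hs1 hs3 => ?_⟩
  have hX := four_le_anaCond 1 s
  have hXp : 1 ≤ anaCond 1 s ^ (8 * η) := Real.one_le_rpow (by linarith) (by linarith)
  by_cases hs : ‖s - 1‖ ≤ 1 / 2
  · have := hC₃ s (by simpa [dist_eq_norm] using hs)
    calc ‖riemannZeta₀ s‖ ≤ |C₃| := this.trans (le_abs_self _)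
      _ ≤ (2 * C₁ + 6 + C₂ + |C₃|) * 1 := by linarith
      _ ≤ _ := by gcongr
  push Not at hs
  have hsne : s - 1 ≠ 0 := by rw [← norm_pos_iff]; linarith
  obtain ⟨N, hN, hN1, hN2⟩ := exists_split_point hX
  have hs0 : 0 < s.re := by linarith
  have hz : riemannZeta₀ s = (s - 1)⁻¹ * riemannZeta₁ s - (s - 1)⁻¹ := by
    rw [riemannZeta₁]; field_simp; ring
  rw [hz]
  have hinv : ‖(s - 1)⁻¹‖ ≤ 2 := by
    rw [norm_inv]
    exact (inv_anti₀ (by norm_num) hs.le).trans (by norm_num)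
  have e1 : ∑ n ∈ Ico 1 N, (n : ℝ) ^ (-s.re) ≤ C₁ * (2 * anaCond 1 s ^ (8 * η)) :=
    (h₁ N s.re hs1).trans (by gcongr; exact hN2 η h0 h1)
  have e2 : ∑' n : ℕ, ((N + n : ℕ) : ℝ) ^ (-s.re - 1) ≤ C₂ * (anaCond 1 s)⁻¹ :=
    (h₂ N s.re hN (by linarith)).trans (by gcongr)
  have e3 : ‖s‖ * ∑' n : ℕ, ((N + n : ℕ) : ℝ) ^ (-s.re - 1) ≤ C₂ := by
    calc ‖s‖ * ∑' n : ℕ, ((N + n : ℕ) : ℝ) ^ (-s.re - 1)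
        ≤ (|s.im| + 4) * (C₂ * (anaCond 1 s)⁻¹) := by
          gcongr; exact norm_le_add_abs_im hs0.le hs3
      _ = C₂ * (anaCond 1 s * (anaCond 1 s)⁻¹) := by rw [anaCond]; push_cast; ring
      _ = C₂ := by rw [mul_inv_cancel₀ (by linarith), mul_one]
  have e4 : ‖(N : ℂ) ^ (1 - s)‖ ≤ 2 * anaCond 1 s ^ (8 * η) := by
    rw [Complex.norm_natCast_cpow_of_pos hN]
    refine le_trans ?_ (hN2 η h0 h1)
    refine Real.rpow_le_rpow_of_exponent_le (by exact_mod_cast hN) ?_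
    simp only [Complex.sub_re, Complex.one_re]; linarith
  have e5 : ‖∑ n ∈ Ico 1 N, (n : ℂ) ^ (-s)‖ ≤ ∑ n ∈ Ico 1 N, (n : ℝ) ^ (-s.re) := by
    have := norm_sum_Ico_cpow_le (f := fun _ => 1) (B := 1) (by simp) s N
    simpa using this
  have e6 : ‖(s - 1)⁻¹ * ∑' n : ℕ, ((s - 1) * ((N + n : ℕ) : ℂ) ^ (-s) - ((N + n : ℕ) : ℂ) ^ (1 - s)
        + ((N + (n + 1) : ℕ) : ℂ) ^ (1 - s))‖ ≤ C₂ := by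
    refine le_trans ?_ e3
    rw [← tsum_mul_left, ← tsum_mul_left]
    refine tsum_of_norm_bounded ((summable_add_rpow hs0 hN).mul_left ‖s‖).hasSum fun n => ?_
    have := norm_cpow_one_sub_taylor_le hs0 (x := (N + n : ℕ)) (by positivity)
    rw [norm_mul, norm_inv, inv_mul_le_iff₀ (norm_pos_iff.mpr hsne), ← mul_assoc]
    push_cast at this ⊢
    rw [← add_assoc]
    exact this
  rw [riemannZeta₁_eq_sum_add_tsum hN hs0, mul_add, mul_add, inv_mul_cancel_left₀ hsne]
  refine (norm_sub_le _ _).trans ?_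
  refine (add_le_add (norm_add₃_le.trans (add_le_add_three (e5.trans e1)
    ((norm_mul _ _).le.trans (mul_le_mul hinv e4 (norm_nonneg _) (by norm_num))) e6)) hinv).trans ?_
  have : 0 ≤ |C₃| := abs_nonneg _
  nlinarith

lemma anaCond_le_two_mul {q : ℕ} {s w : ℂ} (h : ‖w - s‖ ≤ 1) : anaCond q w ≤ 2 * anaCond q s := by
  have h1 : |w.im| ≤ |s.im| + 1 := by
    have h2 : |w.im - s.im| ≤ 1 := by
      rw [← Complex.sub_im]; exact (Complex.abs_im_le_norm _).trans h
    have h3 := abs_sub_abs_le_abs_sub w.im s.im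
    linarith
  unfold anaCond
  have : (0 : ℝ) ≤ q := q.cast_nonneg
  nlinarith [abs_nonneg s.im]

lemma anaCond_pos (q : ℕ) [NeZero q] (s : ℂ) : 0 < anaCond q s := by
  linarith [four_le_anaCond q s]

lemma norm_iteratedDeriv_le_of_anaCond {f : ℂ → ℂ} (k : ℕ) {q : ℕ} [NeZero q] {s : ℂ} {r η C : ℝ}
    (hr0 : 0 < r) (hr1 : r ≤ 1) (hη0 : 0 ≤ η) (hη : η ≤ 1) (hC : 0 ≤ C)
    (hf : DifferentiableOn ℂ f (Metric.closedBall s r))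
    (hb : ∀ w ∈ Metric.closedBall s r, ‖f w‖ ≤ C * anaCond q w ^ η) :
    ‖iteratedDeriv k f s‖ ≤ (k.factorial * (2 * C) / r ^ k) * anaCond q s ^ η := by
  have h1 : ∀ z ∈ Metric.sphere s r, ‖f z‖ ≤ 2 * C * anaCond q s ^ η := by
    intro z hz
    refine (hb z (Metric.sphere_subset_closedBall hz)).trans ?_
    have hz' : ‖z - s‖ ≤ 1 := by rw [mem_sphere_iff_norm.mp hz]; exact hr1
    have h2 : anaCond q z ^ η ≤ 2 * anaCond q s ^ η := by
      calc anaCond q z ^ η ≤ (2 * anaCond q s) ^ η :=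
            Real.rpow_le_rpow (anaCond_pos q z).le (anaCond_le_two_mul hz') hη0
        _ = 2 ^ η * anaCond q s ^ η := Real.mul_rpow (by norm_num) (anaCond_pos q s).le
        _ ≤ 2 ^ (1 : ℝ) * anaCond q s ^ η := by
            have := anaCond_pos q s
            gcongr; norm_num
        _ = _ := by rw [Real.rpow_one]
    calc C * anaCond q z ^ η ≤ C * (2 * anaCond q s ^ η) := by gcongr
      _ = _ := by ring
  have h3 := Complex.norm_iteratedDeriv_le_of_forall_mem_sphere_norm_le k hr0
    (hf.diffContOnCl_ball (le_refl _)) h1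
  refine h3.trans (le_of_eq ?_)
  ring

lemma re_mem_of_mem_closedBall {s w : ℂ} {r : ℝ} (h : w ∈ Metric.closedBall s r) :
    s.re - r ≤ w.re ∧ w.re ≤ s.re + r := by
  have h1 : |w.re - s.re| ≤ r := by
    rw [← Complex.sub_re]
    exact (Complex.abs_re_le_norm _).trans (by simpa [dist_eq_norm] using h)
  obtain ⟨h2, h3⟩ := abs_le.mp h1
  constructor <;> linarith

lemma exists_norm_iteratedDeriv_LFunction_le {η : ℝ} (hη : 0 < η) (k : ℕ) :
    ∃ C : ℝ, 0 < C ∧ ∀ (q : ℕ) [NeZero q] (χ : DirichletCharacter ℂ q), χ ≠ 1 →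
      ∀ s : ℂ, 1 ≤ s.re → s.re ≤ 2 →
      ‖iteratedDeriv k (DirichletCharacter.LFunction χ) s‖ ≤ C * anaCond q s ^ η := by
  set η' := min (η / 8) (1 / 8) with hη'
  have h0 : 0 < η' := by positivity
  have h1 : η' ≤ 1 / 8 := min_le_right _ _
  have h2 : 8 * η' ≤ η := by linarith [min_le_left (η / 8) (1 / 8)]
  obtain ⟨C, hC, h⟩ := exists_norm_LFunction_le h0 h1
  refine ⟨k.factorial * (2 * C) / η' ^ k, by positivity, fun q _ χ hχ s hs1 hs2 => ?_⟩
  refine (norm_iteratedDeriv_le_of_anaCond k h0 (by linarith) (η := 8 * η') (by positivity)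
    (by linarith) hC.le (q := q)
    (DirichletCharacter.differentiable_LFunction hχ).differentiableOn ?_).trans ?_
  · intro w hw
    obtain ⟨h3, h4⟩ := re_mem_of_mem_closedBall hw
    have := h q (χ ·) 1 (MulChar.sum_eq_zero_of_ne_one hχ) (fun j => χ.norm_le_one j) w
      (by linarith) (by linarith)
    rwa [mul_one] at this
  · gcongr
    linarith [four_le_anaCond q s]

lemma exists_norm_iteratedDeriv_riemannZeta_le {η : ℝ} (hη : 0 < η) (k : ℕ) :
    ∃ C : ℝ, 0 < C ∧ ∀ s : ℂ, 1 ≤ s.re → s.re ≤ 2 → 1 ≤ |s.im| →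
      ‖iteratedDeriv k riemannZeta s‖ ≤ C * anaCond 1 s ^ η := by
  set η' := min (η / 8) (1 / 8) with hη'
  have h0 : 0 < η' := by positivity
  have h1 : η' ≤ 1 / 8 := min_le_right _ _
  have h2 : 8 * η' ≤ η := by linarith [min_le_left (η / 8) (1 / 8)]
  obtain ⟨C, hC, h⟩ := exists_norm_riemannZeta₀_le h0 h1
  refine ⟨k.factorial * (2 * (C + 2)) / η' ^ k, by positivity, fun s hs1 hs2 ht => ?_⟩
  have hne : ∀ w ∈ Metric.closedBall s η', 1 / 2 ≤ ‖w - 1‖ := by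
    intro w hw
    have h3 : |w.im - s.im| ≤ η' := by
      rw [← Complex.sub_im]
      exact (Complex.abs_im_le_norm _).trans (by simpa [dist_eq_norm] using hw)
    have h4 := abs_sub_abs_le_abs_sub s.im w.im
    rw [abs_sub_comm] at h4
    have h5 : |w.im| ≤ ‖w - 1‖ := by
      have := Complex.abs_im_le_norm (w - 1)
      simpa using this
    linarith
  have hne' : ∀ w ∈ Metric.closedBall s η', w ≠ 1 := by
    rintro w hw rfl
    have := hne _ hw
    norm_num at this
  refine (norm_iteratedDeriv_le_of_anaCond k h0 (by linarith) (η := 8 * η') (by positivity)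
    (by linarith) (by linarith : 0 ≤ C + 2) (q := 1) ?_ ?_).trans ?_
  · intro w hw
    exact (differentiableAt_riemannZeta (hne' w hw)).differentiableWithinAt
  · intro w hw
    obtain ⟨h3, h4⟩ := re_mem_of_mem_closedBall hw
    rw [riemannZeta_eq_inv_sub_add (hne' w hw)]
    have h5 : ‖(w - 1)⁻¹‖ ≤ 2 := by
      rw [norm_inv]
      exact (inv_anti₀ (by norm_num) (hne w hw)).trans (by norm_num)
    have h6 : 1 ≤ anaCond 1 w ^ (8 * η') :=
      Real.one_le_rpow (by linarith [four_le_anaCond 1 w]) (by positivity)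
    have h7 := h w (by linarith) (by linarith)
    refine (norm_add_le _ _).trans ?_
    nlinarith
  · gcongr
    linarith [four_le_anaCond 1 s]

/-- A bound for `L(s, χ)` valid for principal characters as well. -/
lemma exists_norm_LFunction_le_inv_add {η : ℝ} (hη : 0 < η) :
    ∃ C : ℝ, 0 < C ∧ ∀ (q : ℕ) [NeZero q] (χ : DirichletCharacter ℂ q), ∀ s : ℂ, 1 < s.re →
      s.re ≤ 3 →
      ‖DirichletCharacter.LFunction χ s‖ ≤ ‖s - 1‖⁻¹ + C * anaCond q s ^ η := by
  set η' := min (η / 8) (1 / 8) with hη'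
  have h0 : 0 < η' := by positivity
  have h1 : η' ≤ 1 / 8 := min_le_right _ _
  have h2 : 8 * η' ≤ η := by linarith [min_le_left (η / 8) (1 / 8)]
  obtain ⟨C, hC, h⟩ := exists_norm_LFunction_le h0 h1
  obtain ⟨D, hD, hz⟩ := exists_norm_riemannZeta₀_le h0 h1
  refine ⟨2 * C + D, by positivity, fun q _ χ s hs1 hs3 => ?_⟩
  have hq : (q : ℂ) ≠ 0 := NeZero.ne _
  set l : ℂ := (∑ j, χ j) / q with hl
  have hl1 : ‖l‖ ≤ 1 := by
    rw [hl, norm_div, Complex.norm_natCast, div_le_one (by exact_mod_cast NeZero.pos q)]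
    refine (norm_sum_le_of_le univ fun j _ => χ.norm_le_one j).trans ?_
    simp [ZMod.card]
  set g : ZMod q → ℂ := fun j => χ j - l with hg
  have hg0 : ∑ j, g j = 0 := by
    simp only [hg, sum_sub_distrib, sum_const, card_univ, ZMod.card, nsmul_eq_mul]
    rw [hl, mul_div_cancel₀ _ hq, sub_self]
  have hg2 : ∀ j, ‖g j‖ ≤ 2 := fun j =>
    (norm_sub_le _ _).trans (by linarith [χ.norm_le_one j])
  have hs1' : s ≠ 1 := by rintro rfl; simp at hs1
  have e : DirichletCharacter.LFunction χ s = ZMod.LFunction g s + l * riemannZeta s := by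
    rw [DirichletCharacter.LFunction_eq_LSeries χ hs1, ZMod.LFunction_eq_LSeries g hs1,
      ← LSeries_one_eq_riemannZeta hs1, ← LSeries_smul, ← LSeries_add]
    · congr 1; funext n; simp [hg]
    · exact ZMod.LSeriesSummable_of_one_lt_re g hs1
    · exact (LSeriesSummable_one_iff.mpr hs1).smul l
  have hX : anaCond q s ^ (8 * η') ≤ anaCond q s ^ η := by
    gcongr; linarith [four_le_anaCond q s]
  have e1 := h q g 2 hg0 hg2 s (by linarith) hs3
  have e2 := hz s (by linarith) hs3
  have e3 : anaCond 1 s ^ (8 * η') ≤ anaCond q s ^ (8 * η') :=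
    Real.rpow_le_rpow (anaCond_pos 1 s).le (anaCond_one_le q s) (by positivity)
  have e4 : ‖l * riemannZeta s‖ ≤ ‖s - 1‖⁻¹ + D * anaCond q s ^ η := by
    rw [norm_mul, riemannZeta_eq_inv_sub_add hs1']
    refine (mul_le_of_le_one_left (norm_nonneg _) hl1).trans ((norm_add_le _ _).trans ?_)
    rw [norm_inv]
    gcongr
    exact e2.trans (mul_le_mul_of_nonneg_left (e3.trans hX) hD.le)
  rw [e]
  refine (norm_add_le _ _).trans ?_
  nlinarith

lemma iteratedDeriv_const_mul_inv_sub_one_two (c : ℂ) (m : ℕ) :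
    iteratedDeriv m (fun s : ℂ => c * (s - 1)⁻¹) 2 = c * ((-1) ^ m * m.factorial) := by
  have h := iter_deriv_inv_linear_sub (𝕜 := ℂ) m 1 1
  have h2 : iteratedDeriv m (fun s : ℂ => (s - 1)⁻¹) 2 = (-1) ^ m * m.factorial := by
    rw [iteratedDeriv_eq_iterate]
    have h3 := congrFun h 2
    simp only [one_mul] at h3
    rw [h3]
    norm_num
  rw [iteratedDeriv_const_mul_field, h2]

lemma one_le_re_LSeries_two {a : ℕ → ℂ} (ha : ∀ n, 0 ≤ (a n).re ∧ (a n).im = 0) (ha1 : a 1 = 1)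
    (hs : LSeriesSummable a 2) : 1 ≤ (LSeries a 2).re := by
  have h1 : ∀ n, 0 ≤ (LSeries.term a 2 n).re := by
    intro n
    rcases Nat.eq_zero_or_pos n with rfl | hn
    · simp
    · rw [LSeries.term_of_ne_zero hn.ne']
      have : ((n : ℂ) ^ (2 : ℂ)) = (((n : ℝ) ^ 2 : ℝ) : ℂ) := by
        push_cast
        exact_mod_cast Complex.cpow_natCast (n : ℂ) 2
      rw [this, Complex.div_ofReal_re]
      exact div_nonneg (ha n).1 (by positivity)
  rw [LSeries, Complex.re_tsum hs]
  have h2 : Summable fun n => (LSeries.term a 2 n).re := by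
    exact (Complex.hasSum_re hs.hasSum).summable
  have h3 := h2.le_tsum 1 (fun n _ => h1 n)
  rw [LSeries.term_of_ne_zero one_ne_zero, ha1] at h3
  simpa using h3

open ComplexOrder in
lemma exists_one_le_add_of_nonneg : ∃ K : ℝ, 1 ≤ K ∧ ∀ (H : ℂ → ℂ), Differentiable ℂ H →
    ∀ M : ℝ, (∀ z ∈ Metric.closedBall (2 : ℂ) (3 / 2), ‖H z‖ ≤ M) →
    ∀ a : ℕ → ℂ, 0 ≤ a → a 1 = 1 → LSeries.abscissaOfAbsConv a ≤ 1 →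
    (∀ s : ℂ, 1 < s.re → LSeries a s = riemannZeta s * H s) →
    ∀ β : ℝ, 7 / 8 ≤ β → β < 1 → (riemannZeta β * H β).re ≤ 0 → ∀ m₀ : ℕ,
      1 ≤ ‖H 1‖ * (2 - β) ^ m₀ / (1 - β) + K * M * (3 / 4) ^ m₀ := by
  obtain ⟨Z, hZ⟩ := (isCompact_closedBall (2 : ℂ) (3 / 2)).exists_bound_of_continuousOn
    differentiable_riemannZeta₀.continuous.continuousOn
  have hZ0 : 0 ≤ Z := (norm_nonneg _).trans (hZ 2 (Metric.mem_closedBall_self (by norm_num)))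
  refine ⟨4 * (Z + 4), by linarith, fun H hH M hM a ha ha1 habs heq β hβ hβ1 hneg m₀ => ?_⟩
  have hM0 : 0 ≤ M := (norm_nonneg _).trans (hM 2 (Metric.mem_closedBall_self (by norm_num)))
  have h1ball : (1 : ℂ) ∈ Metric.closedBall (2 : ℂ) (3 / 2) := by
    rw [mem_closedBall_iff_norm]; norm_num
  set G : ℂ → ℂ := fun s => riemannZeta₀ s * H s + dslope H 1 s with hG
  have hGd : Differentiable ℂ G := by
    refine (differentiable_riemannZeta₀.mul hH).add ?_
    rw [← differentiableOn_univ, Complex.differentiableOn_dslope Filter.univ_mem]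
    exact hH.differentiableOn
  have hFG : ∀ s : ℂ, s ≠ 1 → riemannZeta s * H s = G s + H 1 * (s - 1)⁻¹ := by
    intro s hs
    simp only [hG]
    rw [riemannZeta_eq_inv_sub_add hs, dslope_of_ne _ hs, slope_def_field]
    have : s - 1 ≠ 0 := sub_ne_zero.mpr hs
    field_simp
    ring
  have hGb : ∀ z ∈ Metric.sphere (2 : ℂ) (3 / 2), ‖G z‖ ≤ (Z + 4) * M := by
    intro z hz
    have hzb := Metric.sphere_subset_closedBall hz
    have h12 : 1 / 2 ≤ ‖z - 1‖ := by
      have h3 : ‖z - 2‖ = 3 / 2 := mem_sphere_iff_norm.mp hz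
      have h4 := norm_sub_le (z - 1) 1
      rw [show z - 1 - 1 = z - 2 by ring, h3, norm_one] at h4
      linarith
    have hz1 : z ≠ 1 := by
      rintro rfl
      norm_num at h12
    have e1 : ‖dslope H 1 z‖ ≤ 4 * M := by
      rw [dslope_of_ne _ hz1, slope_def_field, norm_div, div_le_iff₀ (by linarith)]
      have := norm_sub_le (H z) (H 1)
      have := hM z hzb
      have := hM 1 h1ball
      nlinarith
    have e2 : ‖riemannZeta₀ z * H z‖ ≤ Z * M := by
      rw [norm_mul]
      exact mul_le_mul (hZ z hzb) (hM z hzb) (norm_nonneg _) hZ0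
    calc ‖G z‖ ≤ Z * M + 4 * M := (norm_add_le _ _).trans (add_le_add e2 e1)
      _ = _ := by ring
  have hcauchy : ∀ m : ℕ, ‖iteratedDeriv m G 2‖ ≤ m.factorial * ((Z + 4) * M) / (3 / 2) ^ m :=
    fun m => Complex.norm_iteratedDeriv_le_of_forall_mem_sphere_norm_le m (by norm_num)
      hGd.diffContOnCl hGb
  have hder : ∀ m : ℕ, iteratedDeriv m (LSeries a) 2
      = iteratedDeriv m G 2 + H 1 * ((-1) ^ m * m.factorial) := by
    intro m
    have hev : LSeries a =ᶠ[nhds 2] fun s => G s + H 1 * (s - 1)⁻¹ := by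
      have : {s : ℂ | 1 < s.re} ∈ nhds (2 : ℂ) :=
        (isOpen_lt continuous_const Complex.continuous_re).mem_nhds (by simp)
      filter_upwards [this] with w hw
      rw [heq w hw, hFG w (by rintro rfl; simp at hw)]
    rw [hev.iteratedDeriv_eq, iteratedDeriv_fun_add, iteratedDeriv_const_mul_inv_sub_one_two]
    · exact hGd.contDiff.contDiffAt
    · refine contDiffAt_const.mul (ContDiffAt.inv (contDiffAt_id.sub contDiffAt_const) ?_)
      norm_num
  have habs2 : LSeries.abscissaOfAbsConv a < (2 : ℝ) :=
    habs.trans_lt (by exact_mod_cast one_lt_two)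
  set x : ℕ → ℝ := fun m => (((m.factorial : ℂ)⁻¹ • ((β : ℂ) - 2) ^ m • iteratedDeriv m G 2)).re
    with hx
  have hxs : HasSum x (G β).re :=
    Complex.hasSum_re (Complex.hasSum_taylorSeries_of_entire hGd 2 β)
  have hpow : ∀ m : ℕ, ((β : ℂ) - 2) ^ m = (((2 - β) ^ m : ℝ) : ℂ) * (-1) ^ m := by
    intro m
    push_cast
    rw [← mul_pow]; congr 1; ring
  have hxeq : ∀ m, x m = (2 - β) ^ m * ((m.factorial : ℝ)⁻¹ * ((-1) ^ m * iteratedDeriv m G 2).re) := by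
    intro m
    simp only [hx, smul_eq_mul]
    rw [hpow m, show (m.factorial : ℂ)⁻¹ * (((((2 - β) ^ m : ℝ) : ℂ) * (-1) ^ m) * iteratedDeriv m G 2)
      = (((m.factorial : ℝ)⁻¹ * (2 - β) ^ m : ℝ) : ℂ) * ((-1) ^ m * iteratedDeriv m G 2) by
        push_cast; ring, Complex.re_ofReal_mul]
    ring
  have hsq : ∀ m : ℕ, ((-1 : ℂ) ^ m) * (-1) ^ m = 1 := fun m => by
    rw [← mul_pow]; norm_num
  have hlow : ∀ m, -(H 1).re * (2 - β) ^ m ≤ x m := by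
    intro m
    have h1 := LSeries.iteratedDeriv_alternating ha habs2 m
    rw [Complex.ofReal_ofNat, hder m, mul_add, show (-1 : ℂ) ^ m * (H 1 * ((-1) ^ m * m.factorial))
      = (m.factorial : ℝ) * H 1 * (((-1 : ℂ) ^ m) * (-1) ^ m) by push_cast; ring, hsq, mul_one] at h1
    have h2 := (Complex.le_def.mp h1).1
    rw [Complex.zero_re, Complex.add_re, Complex.re_ofReal_mul] at h2
    have hf : (0 : ℝ) < m.factorial := by positivity
    have h3 : -(H 1).re ≤ (m.factorial : ℝ)⁻¹ * ((-1) ^ m * iteratedDeriv m G 2).re := by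
      rw [le_inv_mul_iff₀ hf]; linarith
    rw [hxeq, mul_comm]
    exact mul_le_mul_of_nonneg_left h3 (pow_nonneg (by linarith) m)
  have hlow0 : 1 - (H 1).re ≤ x 0 := by
    have h1 : 1 ≤ (LSeries a 2).re := by
      refine one_le_re_LSeries_two (fun n => ?_) ha1 ?_
      · have := Complex.le_def.mp (ha n)
        exact ⟨this.1, this.2.symm⟩
      · exact LSeriesSummable_of_abscissaOfAbsConv_lt_re (by simpa using habs2)
    have h2 := hder 0
    rw [iteratedDeriv_zero] at h2
    rw [h2] at h1
    rw [hxeq]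
    simp at h1 ⊢
    linarith
  have htail : ∀ m, |x m| ≤ (Z + 4) * M * (3 / 4) ^ m := by
    intro m
    rw [hxeq, abs_mul, abs_mul, abs_of_nonneg (pow_nonneg (by linarith : 0 ≤ 2 - β) m),
      abs_of_nonneg (by positivity : 0 ≤ (m.factorial : ℝ)⁻¹)]
    have hf : (0 : ℝ) < m.factorial := by positivity
    have h1 : |((-1) ^ m * iteratedDeriv m G 2).re| ≤ m.factorial * ((Z + 4) * M) / (3 / 2) ^ m := by
      refine (Complex.abs_re_le_norm _).trans ?_
      rw [norm_mul, norm_pow, norm_neg, norm_one, one_pow, one_mul]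
      exact hcauchy m
    calc (2 - β) ^ m * ((m.factorial : ℝ)⁻¹ * |((-1) ^ m * iteratedDeriv m G 2).re|)
        ≤ (9 / 8) ^ m * ((m.factorial : ℝ)⁻¹ * (m.factorial * ((Z + 4) * M) / (3 / 2) ^ m)) := by
          gcongr
          · linarith
          · linarith
      _ = (Z + 4) * M * ((9 / 8) ^ m / (3 / 2) ^ m) := by field_simp
      _ = _ := by rw [← div_pow]; norm_num
  have hsplit := hxs.summable.sum_add_tsum_nat_add m₀
  rw [hxs.tsum_eq] at hsplit
  have hgeo : HasSum (fun m : ℕ => (Z + 4) * M * (3 / 4 : ℝ) ^ (m + m₀))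
      (4 * (Z + 4) * M * (3 / 4) ^ m₀) := by
    have h1 := (hasSum_geometric_of_lt_one (r := (3 / 4 : ℝ)) (by norm_num) (by norm_num)).mul_left
      ((Z + 4) * M * (3 / 4) ^ m₀)
    have e : (fun m : ℕ => (Z + 4) * M * (3 / 4 : ℝ) ^ (m + m₀))
        = fun m => (Z + 4) * M * (3 / 4) ^ m₀ * (3 / 4) ^ m := by
      funext m; rw [pow_add]; ring
    have e2 : 4 * (Z + 4) * M * (3 / 4 : ℝ) ^ m₀ = (Z + 4) * M * (3 / 4) ^ m₀ * (1 - 3 / 4)⁻¹ := by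
      rw [show (1 - 3 / 4 : ℝ)⁻¹ = 4 by norm_num]; ring
    rw [e, e2]
    exact h1
  have ht : |∑' m : ℕ, x (m + m₀)| ≤ 4 * (Z + 4) * M * (3 / 4) ^ m₀ := by
    rw [← Real.norm_eq_abs]
    exact tsum_of_norm_bounded hgeo fun m => (Real.norm_eq_abs _).trans_le (htail (m + m₀))
  have hfin : ∑ m ∈ range m₀, x m ≥ (if m₀ = 0 then 0 else 1) - (H 1).re * (((2 - β) ^ m₀ - 1) / (1 - β)) := by
    have hg : ((2 - β) ^ m₀ - 1) / (1 - β) = ∑ m ∈ range m₀, (2 - β) ^ m := by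
      rw [geom_sum_eq (by linarith)]; congr 1; ring
    rw [hg]
    cases m₀ with
    | zero => simp
    | succ k =>
      rw [sum_range_succ', sum_range_succ' _ k]
      have : ∑ m ∈ range k, x (m + 1) ≥ ∑ m ∈ range k, -(H 1).re * (2 - β) ^ (m + 1) :=
        sum_le_sum fun m _ => hlow (m + 1)
      rw [← mul_sum] at this
      simp only [Nat.add_eq_zero_iff, one_ne_zero, and_false, if_false, pow_zero]
      nlinarith
  have hFβ : (riemannZeta β * H β).re = (G β).re - (H 1).re / (1 - β) := by
    rw [hFG β (by exact_mod_cast hβ1.ne)]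
    have : ((β : ℂ) - 1)⁻¹ = (((β - 1)⁻¹ : ℝ) : ℂ) := by push_cast; rfl
    rw [this, Complex.add_re, Complex.re_mul_ofReal, show β - 1 = -(1 - β) by ring, inv_neg]
    ring
  have hb : 0 < 1 - β := by linarith
  have hK : 4 * (Z + 4) * M * (3 / 4) ^ m₀ ≥ 0 := by positivity
  have hH1 : (H 1).re ≤ ‖H 1‖ := Complex.re_le_norm _
  have hfin2 : (if m₀ = 0 then (0 : ℝ) else 1) - (H 1).re * ((2 - β) ^ m₀ / (1 - β))
      ≤ 4 * (Z + 4) * M * (3 / 4) ^ m₀ := by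
    have h1 := (abs_le.mp ht).1
    have h2 : (H 1).re * (((2 - β) ^ m₀ - 1) / (1 - β))
        = (H 1).re * ((2 - β) ^ m₀ / (1 - β)) - (H 1).re / (1 - β) := by ring
    linarith
  have hle : (H 1).re * ((2 - β) ^ m₀ / (1 - β)) ≤ ‖H 1‖ * ((2 - β) ^ m₀ / (1 - β)) := by
    have : 0 ≤ (2 - β) ^ m₀ / (1 - β) := div_nonneg (pow_nonneg (by linarith) _) hb.le
    gcongr
  rw [mul_div_assoc]
  by_cases hm : m₀ = 0
  · subst hm
    have e0 : 1 - (H 1).re ≤ 4 * (Z + 4) * M := by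
      have h5 := (le_abs_self _).trans (htail 0)
      simp only [pow_zero, mul_one] at h5
      have : 0 ≤ (Z + 4) * M := by positivity
      linarith
    have h6 : ‖H 1‖ ≤ ‖H 1‖ * ((2 - β) ^ 0 / (1 - β)) := by
      refine le_mul_of_one_le_right (norm_nonneg _) ?_
      rw [pow_zero, le_div_iff₀ hb]; linarith
    simp only [pow_zero, mul_one] at h6 ⊢
    linarith
  · rw [if_neg hm] at hfin2
    linarith

open ComplexOrder in
lemma exists_one_sub_le_of_nonneg : ∃ K : ℝ, 1 ≤ K ∧ ∀ (H : ℂ → ℂ), Differentiable ℂ H →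
    ∀ M : ℝ, 1 ≤ M → (∀ z ∈ Metric.closedBall (2 : ℂ) (3 / 2), ‖H z‖ ≤ M) →
    ∀ a : ℕ → ℂ, 0 ≤ a → a 1 = 1 → LSeries.abscissaOfAbsConv a ≤ 1 →
    (∀ s : ℂ, 1 < s.re → LSeries a s = riemannZeta s * H s) →
    ∀ β : ℝ, 7 / 8 ≤ β → β < 1 → (riemannZeta β * H β).re ≤ 0 →
      1 - β ≤ 6 * ‖H 1‖ * (K * M) ^ (4 * (1 - β)) := by
  obtain ⟨K, hK1, hK⟩ := exists_one_le_add_of_nonneg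
  refine ⟨2 * K, by linarith, fun H hH M hM1 hM a ha ha1 habs heq β hβ hβ1 hneg => ?_⟩
  have h := hK H hH M hM a ha ha1 habs heq β hβ hβ1 hneg ⌈4 * Real.log (2 * K * M)⌉₊
  set m₀ := ⌈4 * Real.log (2 * K * M)⌉₊ with hm
  have hKM : 1 ≤ 2 * K * M := by nlinarith
  have hKM0 : 0 < 2 * K * M := by linarith
  have hlog : 0 ≤ Real.log (2 * K * M) := Real.log_nonneg hKM
  have hm1 : 4 * Real.log (2 * K * M) ≤ m₀ := Nat.le_ceil _
  have hm2 : (m₀ : ℝ) ≤ 4 * Real.log (2 * K * M) + 1 := (Nat.ceil_lt_add_one (by positivity)).le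
  have hb : 0 < 1 - β := by linarith
  have e1 : (3 / 4 : ℝ) ^ m₀ ≤ (2 * K * M)⁻¹ := by
    have h1 : (3 / 4 : ℝ) ≤ Real.exp (-(1 / 4)) := by
      have := Real.add_one_le_exp (-(1 / 4) : ℝ); linarith
    calc (3 / 4 : ℝ) ^ m₀ ≤ Real.exp (-(1 / 4)) ^ m₀ := by gcongr
      _ = Real.exp (-(m₀ / 4)) := by rw [← Real.exp_nat_mul]; congr 1; ring
      _ ≤ Real.exp (-Real.log (2 * K * M)) := Real.exp_le_exp.mpr (by linarith)
      _ = _ := by rw [Real.exp_neg, Real.exp_log hKM0]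
  have e2 : (2 - β) ^ m₀ ≤ 3 * (2 * K * M) ^ (4 * (1 - β)) := by
    have h1 : 2 - β ≤ Real.exp (1 - β) := by
      have := Real.add_one_le_exp (1 - β : ℝ); linarith
    calc (2 - β) ^ m₀ ≤ Real.exp (1 - β) ^ m₀ := by
          have : 0 ≤ 2 - β := by linarith
          gcongr
      _ = Real.exp (m₀ * (1 - β)) := by rw [← Real.exp_nat_mul]
      _ ≤ Real.exp (1 + Real.log (2 * K * M) * (4 * (1 - β))) := Real.exp_le_exp.mpr (by nlinarith)
      _ = Real.exp 1 * (2 * K * M) ^ (4 * (1 - β)) := by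
        rw [Real.exp_add, Real.rpow_def_of_pos hKM0]
      _ ≤ _ := by
        have := Real.exp_one_lt_d9
        gcongr; linarith
  have e3 : K * M * (3 / 4) ^ m₀ ≤ 1 / 2 := by
    calc K * M * (3 / 4) ^ m₀ ≤ K * M * (2 * K * M)⁻¹ := by gcongr
      _ = 1 / 2 := by
        have : K ≠ 0 := by positivity
        have : M ≠ 0 := by positivity
        field_simp
  have e4 : 1 / 2 ≤ ‖H 1‖ * (2 - β) ^ m₀ / (1 - β) := by linarith
  rw [le_div_iff₀ hb] at e4
  have e5 : ‖H 1‖ * (2 - β) ^ m₀ ≤ ‖H 1‖ * (3 * (2 * K * M) ^ (4 * (1 - β))) := by gcongr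
  linarith

namespace ArithmeticFunction

lemma pmul_log_mul {L f g F G : ArithmeticFunction ℂ}
    (hL : ∀ a b, a ≠ 0 → b ≠ 0 → L (a * b) = L a + L b)
    (hf : f.pmul L = F * f) (hg : g.pmul L = G * g) : (f * g).pmul L = (F + G) * (f * g) := by
  have h : (f * g).pmul L = f.pmul L * g + f * g.pmul L := by
    ext n
    simp only [pmul_apply, mul_apply, add_apply, sum_mul, ← sum_add_distrib]
    refine sum_congr rfl fun x hx => ?_
    obtain ⟨rfl, hn⟩ := Nat.mem_divisorsAntidiagonal.mp hx
    rw [hL _ _ (left_ne_zero_of_mul hn) (right_ne_zero_of_mul hn)]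
    ring
  rw [h, hf, hg]; ring

open ComplexOrder in
lemma nonneg_of_pmul_log {L f F : ArithmeticFunction ℂ} (hL : ∀ n, 2 ≤ n → 0 < L n)
    (hF : ∀ n, 0 ≤ F n) (hF1 : F 1 = 0) (hf1 : 0 ≤ f 1) (h : f.pmul L = F * f) (n : ℕ) :
    0 ≤ f n := by
  induction n using Nat.strong_induction_on with
  | _ n ih =>
    rcases Nat.lt_or_ge n 2 with hn | hn
    · interval_cases n
      · simp
      · exact hf1
    · have h1 : f n * L n = (F * f) n := by rw [← h, pmul_apply]
      have h2 : 0 ≤ (F * f) n := by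
        rw [mul_apply]
        refine sum_nonneg fun x hx => ?_
        obtain ⟨hx1, hx2⟩ := Nat.mem_divisorsAntidiagonal.mp hx
        rcases eq_or_ne x.1 1 with h3 | h3
        · rw [h3, hF1, zero_mul]
        · refine mul_nonneg (hF _) (ih _ ?_)
          have : x.1 ≠ 0 := by rintro h0; rw [h0] at hx1; omega
          have h5 : x.2 ≠ 0 := by rintro h0; rw [h0] at hx1; omega
          have h4 : 2 ≤ x.1 := by omega
          nlinarith [Nat.pos_of_ne_zero h5]
      have h3 : f n = (F * f) n * (L n)⁻¹ := by
        rw [← h1, mul_assoc, mul_inv_cancel₀ (hL n hn).ne', mul_one]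
      rw [h3]
      exact mul_nonneg h2 (inv_nonneg.mpr (hL n hn).le)

lemma twist_zeta_pmul_log {q : ℕ} (χ : DirichletCharacter ℂ q) :
    (twist χ (zeta : ArithmeticFunction ℝ)).pmul (twist (1 : DirichletCharacter ℂ 1) log)
      = twist χ vonMangoldt * twist χ (zeta : ArithmeticFunction ℝ) := by
  rw [← twist_mul, vonMangoldt_mul_zeta]
  ext n
  have h1 : (1 : DirichletCharacter ℂ 1) n = 1 := by
    rw [MulChar.one_apply]; exact isUnit_of_subsingleton _
  simp only [pmul_apply, twist_apply, h1]
  rcases eq_or_ne n 0 with rfl | hn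
  · simp
  · simp [hn, mul_comm]

lemma LSeriesSummable_twist_zeta {q : ℕ} (χ : DirichletCharacter ℂ q) {s : ℂ} (hs : 1 < s.re) :
    LSeriesSummable (fun n => twist χ (zeta : ArithmeticFunction ℝ) n) s := by
  rw [LSeriesSummable_congr s (g := fun n => χ n)]
  · exact χ.LSeriesSummable_of_one_lt_re hs
  · intro n hn; simp [twist_apply, hn]

lemma LSeries_twist_zeta {q : ℕ} [NeZero q] (χ : DirichletCharacter ℂ q) {s : ℂ} (hs : 1 < s.re) :
    LSeries (fun n => twist χ (zeta : ArithmeticFunction ℝ) n) s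
      = DirichletCharacter.LFunction χ s := by
  rw [LSeries_congr (g := fun n => χ n), DirichletCharacter.LFunction_eq_LSeries χ hs]
  intro n hn; simp [twist_apply, hn]

open ComplexOrder in
lemma twist_log_pos {n : ℕ} (hn : 2 ≤ n) : 0 < twist (1 : DirichletCharacter ℂ 1) log n := by
  have h1 : (1 : DirichletCharacter ℂ 1) n = 1 := by
    rw [MulChar.one_apply]; exact isUnit_of_subsingleton _
  rw [twist_apply, h1, mul_one, log_apply]
  have : 0 < Real.log n := Real.log_pos (by exact_mod_cast hn)
  exact_mod_cast this

lemma twist_log_mul (a b : ℕ) (ha : a ≠ 0) (hb : b ≠ 0) :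
    twist (1 : DirichletCharacter ℂ 1) log (a * b)
      = twist (1 : DirichletCharacter ℂ 1) log a + twist (1 : DirichletCharacter ℂ 1) log b := by
  have h1 : ∀ n : ZMod 1, (1 : DirichletCharacter ℂ 1) n = 1 := fun n => by
    rw [MulChar.one_apply]; exact isUnit_of_subsingleton _
  simp only [twist_apply, h1, log_apply, mul_one]
  push_cast
  rw [Real.log_mul (by exact_mod_cast ha) (by exact_mod_cast hb)]
  push_cast; rfl

lemma twist_zeta_one {q : ℕ} (χ : DirichletCharacter ℂ q) :
    twist χ (zeta : ArithmeticFunction ℝ) 1 = 1 := by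
  simp [twist_apply]

lemma twist_vonMangoldt_one {q : ℕ} (χ : DirichletCharacter ℂ q) :
    twist χ vonMangoldt 1 = 0 := by
  simp [twist_apply]

end ArithmeticFunction

namespace DirichletCharacter
open ArithmeticFunction (twist vonMangoldt zeta)

/-- The product of two Dirichlet characters, at the product of their levels. -/
noncomputable def prodChar {q r : ℕ} (χ : DirichletCharacter ℂ q) (ψ : DirichletCharacter ℂ r) :
    DirichletCharacter ℂ (q * r) :=
  changeLevel (Dvd.intro r rfl) χ * changeLevel (Dvd.intro_left q rfl) ψ

lemma prodChar_apply {q r : ℕ} (χ : DirichletCharacter ℂ q) (ψ : DirichletCharacter ℂ r) (n : ℕ) :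
    prodChar χ ψ n = χ n * ψ n := by
  by_cases h : IsUnit (n : ZMod (q * r))
  · obtain ⟨u, hu⟩ := h
    rw [prodChar, MulChar.mul_apply, ← hu, changeLevel_eq_cast_of_dvd, changeLevel_eq_cast_of_dvd, hu,
      ZMod.cast_natCast (Dvd.intro r rfl), ZMod.cast_natCast (Dvd.intro_left q rfl)]
  · rw [MulChar.map_nonunit _ h]
    rw [ZMod.isUnit_iff_coprime, Nat.coprime_mul_iff_right, not_and_or] at h
    rcases h with h | h
    · rw [MulChar.map_nonunit χ (by rwa [ZMod.isUnit_iff_coprime]), zero_mul]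
    · rw [MulChar.map_nonunit ψ (by rwa [ZMod.isUnit_iff_coprime]), mul_zero]

lemma prodChar_eq_one_imp {q r : ℕ} [NeZero q] [NeZero r] {χ : DirichletCharacter ℂ q}
    {ψ : DirichletCharacter ℂ r} (hχ : χ.IsPrimitive) (hψ : ψ.IsPrimitive) (hψ2 : ψ ^ 2 = 1)
    (h : prodChar χ ψ = 1) : q = r := by
  have h1 : changeLevel (Dvd.intro r rfl : q ∣ q * r) χ
      = changeLevel (Dvd.intro_left q rfl : r ∣ q * r) ψ := by
    have h2 : changeLevel (Dvd.intro_left q rfl : r ∣ q * r) ψ ^ 2 = 1 := by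
      rw [← map_pow, hψ2, map_one]
    rw [prodChar] at h
    rw [eq_inv_of_mul_eq_one_left h]
    exact inv_eq_of_mul_eq_one_left (by rwa [sq] at h2)
  have h2 := congrArg conductor h1
  rwa [conductor_changeLevel, conductor_changeLevel, (isPrimitive_def _).mp hχ,
    (isPrimitive_def _).mp hψ] at h2

open ComplexOrder in
lemma one_add_nonneg_of_sq_eq_one {q : ℕ} {χ : DirichletCharacter ℂ q} (h : χ ^ 2 = 1) (n : ZMod q) :
    0 ≤ 1 + χ n := by
  rcases MulChar.isQuadratic_iff_sq_eq_one.mpr h n with h | h | h <;> rw [h] <;> norm_num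

lemma one_mod_one_apply (n : ZMod 1) : (1 : DirichletCharacter ℂ 1) n = 1 := by
  rw [MulChar.one_apply]; exact isUnit_of_subsingleton _

open ComplexOrder in
lemma vonMangoldt_nonneg' (n : ℕ) : (0 : ℂ) ≤ (vonMangoldt n : ℝ) := by
  exact_mod_cast ArithmeticFunction.vonMangoldt_nonneg

lemma abscissa_le_one {f : ArithmeticFunction ℂ}
    (hf : ∀ s : ℂ, 1 < s.re → LSeriesSummable (fun n => f n) s) :
    LSeries.abscissaOfAbsConv f ≤ 1 := by
  have := LSeries.abscissaOfAbsConv_le_of_forall_lt_LSeriesSummable (f := f) (x := 1)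
    fun y hy => hf y (by simpa using hy)
  simpa using this

open ComplexOrder in
lemma exists_coeff_one_char {q : ℕ} [NeZero q] {χ : DirichletCharacter ℂ q} (h : χ ^ 2 = 1) :
    ∃ a : ℕ → ℂ, 0 ≤ a ∧ a 1 = 1 ∧ LSeries.abscissaOfAbsConv a ≤ 1 ∧
      ∀ s : ℂ, 1 < s.re → LSeries a s = riemannZeta s * LFunction χ s := by
  set f₀ := twist (1 : DirichletCharacter ℂ 1) (zeta : ArithmeticFunction ℝ)
  set f₁ := twist χ (zeta : ArithmeticFunction ℝ)
  refine ⟨fun n => (f₀ * f₁ : ArithmeticFunction ℂ) n, ?_, ?_, ?_, ?_⟩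
  · refine ArithmeticFunction.nonneg_of_pmul_log (fun n hn => ArithmeticFunction.twist_log_pos hn)
      ?_ ?_ ?_
      (ArithmeticFunction.pmul_log_mul ArithmeticFunction.twist_log_mul
        (ArithmeticFunction.twist_zeta_pmul_log _) (ArithmeticFunction.twist_zeta_pmul_log _))
    · intro n
      rw [ArithmeticFunction.add_apply, ArithmeticFunction.twist_apply,
        ArithmeticFunction.twist_apply, one_mod_one_apply, ← mul_add]
      exact mul_nonneg (vonMangoldt_nonneg' n) (one_add_nonneg_of_sq_eq_one h _)
    · simp [ArithmeticFunction.twist_vonMangoldt_one]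
    · simp [f₀, f₁, ArithmeticFunction.twist_zeta_one]
  · simp [f₀, f₁, ArithmeticFunction.twist_zeta_one]
  · exact abscissa_le_one fun s hs => ArithmeticFunction.LSeriesSummable_mul
      (ArithmeticFunction.LSeriesSummable_twist_zeta _ hs)
      (ArithmeticFunction.LSeriesSummable_twist_zeta _ hs)
  · intro s hs
    rw [ArithmeticFunction.LSeries_mul' (ArithmeticFunction.LSeriesSummable_twist_zeta _ hs)
      (ArithmeticFunction.LSeriesSummable_twist_zeta _ hs), ArithmeticFunction.LSeries_twist_zeta _ hs,
      ArithmeticFunction.LSeries_twist_zeta _ hs, LFunction_modOne_eq]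

open ComplexOrder in
lemma exists_coeff_two_char {q r : ℕ} [NeZero q] [NeZero r] {χ : DirichletCharacter ℂ q}
    {ψ : DirichletCharacter ℂ r} (h : χ ^ 2 = 1) (h' : ψ ^ 2 = 1) :
    ∃ a : ℕ → ℂ, 0 ≤ a ∧ a 1 = 1 ∧ LSeries.abscissaOfAbsConv a ≤ 1 ∧
      ∀ s : ℂ, 1 < s.re → LSeries a s
        = riemannZeta s * (LFunction χ s * LFunction ψ s * LFunction (prodChar χ ψ) s) := by
  set f₀ := twist (1 : DirichletCharacter ℂ 1) (zeta : ArithmeticFunction ℝ)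
  set f₁ := twist χ (zeta : ArithmeticFunction ℝ)
  set f₂ := twist ψ (zeta : ArithmeticFunction ℝ)
  set f₃ := twist (prodChar χ ψ) (zeta : ArithmeticFunction ℝ)
  have hs01 : ∀ s : ℂ, 1 < s.re → LSeriesSummable (fun n => (f₀ * f₁) n) s := fun s hs =>
    ArithmeticFunction.LSeriesSummable_mul
      (ArithmeticFunction.LSeriesSummable_twist_zeta _ hs)
      (ArithmeticFunction.LSeriesSummable_twist_zeta _ hs)
  have hs23 : ∀ s : ℂ, 1 < s.re → LSeriesSummable (fun n => (f₂ * f₃) n) s := fun s hs =>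
    ArithmeticFunction.LSeriesSummable_mul
      (ArithmeticFunction.LSeriesSummable_twist_zeta _ hs)
      (ArithmeticFunction.LSeriesSummable_twist_zeta _ hs)
  refine ⟨fun n => (f₀ * f₁ * (f₂ * f₃) : ArithmeticFunction ℂ) n, ?_, ?_, ?_, ?_⟩
  · refine ArithmeticFunction.nonneg_of_pmul_log (fun n hn => ArithmeticFunction.twist_log_pos hn)
      ?_ ?_ ?_
      (ArithmeticFunction.pmul_log_mul ArithmeticFunction.twist_log_mul
        (ArithmeticFunction.pmul_log_mul ArithmeticFunction.twist_log_mul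
          (ArithmeticFunction.twist_zeta_pmul_log _) (ArithmeticFunction.twist_zeta_pmul_log _))
        (ArithmeticFunction.pmul_log_mul ArithmeticFunction.twist_log_mul
          (ArithmeticFunction.twist_zeta_pmul_log _) (ArithmeticFunction.twist_zeta_pmul_log _)))
    · intro n
      simp only [ArithmeticFunction.add_apply, ArithmeticFunction.twist_apply, prodChar_apply]
      rw [one_mod_one_apply, show ∀ l x y : ℂ, l * 1 + l * x + (l * y + l * (x * y))
        = l * ((1 + x) * (1 + y)) by intros; ring]
      exact mul_nonneg (vonMangoldt_nonneg' n) (mul_nonneg (one_add_nonneg_of_sq_eq_one h _)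
        (one_add_nonneg_of_sq_eq_one h' _))
    · simp [ArithmeticFunction.twist_vonMangoldt_one]
    · simp [f₀, f₁, f₂, f₃, ArithmeticFunction.twist_zeta_one]
  · simp [f₀, f₁, f₂, f₃, ArithmeticFunction.twist_zeta_one]
  · exact abscissa_le_one fun s hs => ArithmeticFunction.LSeriesSummable_mul (hs01 s hs) (hs23 s hs)
  · intro s hs
    rw [ArithmeticFunction.LSeries_mul' (hs01 s hs) (hs23 s hs),
      ArithmeticFunction.LSeries_mul' (ArithmeticFunction.LSeriesSummable_twist_zeta _ hs)
      (ArithmeticFunction.LSeriesSummable_twist_zeta _ hs),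
      ArithmeticFunction.LSeries_mul' (ArithmeticFunction.LSeriesSummable_twist_zeta _ hs)
      (ArithmeticFunction.LSeriesSummable_twist_zeta _ hs), ArithmeticFunction.LSeries_twist_zeta _ hs,
      ArithmeticFunction.LSeries_twist_zeta _ hs, ArithmeticFunction.LSeries_twist_zeta _ hs,
      ArithmeticFunction.LSeries_twist_zeta _ hs, LFunction_modOne_eq]
    ring

lemma LFunction_real {q : ℕ} [NeZero q] {χ : DirichletCharacter ℂ q} (h : χ ^ 2 = 1) (h1 : χ ≠ 1)
    {s : ℝ} (hs : 0 < s) : LFunction χ s = ((LFunction χ s).re : ℂ) := by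
  have hre : ∀ a : ZMod q, χ a = (((χ a).re : ℝ) : ℂ) := by
    intro a
    rcases MulChar.isQuadratic_iff_sq_eq_one.mpr h a with h | h | h <;> rw [h] <;> simp
  have hpow : ∀ n : ℕ, ((n : ℕ) : ℂ) ^ (-(s : ℂ)) = (((n : ℝ) ^ (-s) : ℝ) : ℂ) := by
    intro n
    rw [Complex.ofReal_cpow (Nat.cast_nonneg n)]; push_cast; rfl
  have key : ∃ r : ℝ, LFunction χ s = r := by
    refine ⟨∑' n : ℕ, (∑ i ∈ range (n + 1), (χ ((1 + i : ℕ) : ZMod q)).re) *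
      ((((1 + n : ℕ) : ℝ) ^ (-s)) - (((1 + (n + 1) : ℕ) : ℝ) ^ (-s))), ?_⟩
    rw [LFunction, ZMod.LFunction_eq_sum_add_tsum (N := 1) _ (MulChar.sum_eq_zero_of_ne_one h1)
      le_rfl (by simpa using hs), Ico_self, sum_empty, zero_add, Complex.ofReal_tsum]
    refine tsum_congr fun n => ?_
    rw [hpow, hpow, Complex.ofReal_mul, Complex.ofReal_sub, Complex.ofReal_sum]
    congr 1
    exact sum_congr rfl fun i _ => hre _
  obtain ⟨r, hr⟩ := key
  rw [hr, Complex.ofReal_re]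

lemma exists_norm_LFunction_ball_le : ∃ C : ℝ, 1 ≤ C ∧ ∀ (q : ℕ) [NeZero q]
    (χ : DirichletCharacter ℂ q), χ ≠ 1 → ∀ z ∈ Metric.closedBall (2 : ℂ) (3 / 2),
      ‖LFunction χ z‖ ≤ C * q := by
  obtain ⟨C, hC, h⟩ := exists_norm_LFunction_le_half
  refine ⟨C * (7 / 2) + 1, by linarith, fun q _ χ hχ z hz => ?_⟩
  have hz' : ‖z - 2‖ ≤ 3 / 2 := mem_closedBall_iff_norm.mp hz
  have h1 : 1 / 2 ≤ z.re := by
    have := (abs_le.mp ((Complex.abs_re_le_norm (z - 2)).trans hz')).1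
    simp at this; linarith
  have h2 : ‖z‖ ≤ 7 / 2 := by
    have := norm_add_le (z - 2) 2
    rw [sub_add_cancel, Complex.norm_ofNat] at this
    linarith
  have h3 := h q χ 1 (MulChar.sum_eq_zero_of_ne_one hχ) (fun j => χ.norm_le_one j) z h1
  have hq : (0 : ℝ) < q := by exact_mod_cast Nat.pos_of_ne_zero (NeZero.ne q)
  calc ‖LFunction χ z‖ ≤ C * 1 * q * ‖z‖ := h3
    _ ≤ C * 1 * q * (7 / 2) := by gcongr
    _ ≤ _ := by nlinarith

lemma exists_le_norm_LFunction_one_of_zero {η : ℝ} (hη : 0 < η) {r : ℕ} [NeZero r]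
    {ψ : DirichletCharacter ℂ r} (hψ : ψ.IsPrimitive) (hψ2 : ψ ^ 2 = 1) (hψ1 : ψ ≠ 1) {β : ℝ}
    (hβ : 7 / 8 ≤ β) (hβ1 : β < 1) (hβη : 16 * (1 - β) ≤ η) (h0 : LFunction ψ β = 0) :
    ∃ c : ℝ, 0 < c ∧ ∀ (q : ℕ) [NeZero q] (χ : DirichletCharacter ℂ q), χ.IsPrimitive → χ ^ 2 = 1 →
      χ ≠ 1 → q ≠ r → c * (q : ℝ) ^ (-η) ≤ ‖LFunction χ 1‖ := by
  obtain ⟨K, hK, hmain⟩ := exists_one_sub_le_of_nonneg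
  obtain ⟨C, hC, hball⟩ := exists_norm_LFunction_ball_le
  obtain ⟨C₂, hC₂, hder⟩ := exists_norm_iteratedDeriv_LFunction_le (half_pos hη) 0
  have hr : (1 : ℝ) ≤ r := by exact_mod_cast Nat.pos_of_ne_zero (NeZero.ne r)
  have hb : 0 < 1 - β := by linarith
  set A := K * (C ^ 3 * (r : ℝ) ^ 2) with hA
  have hC3 : 1 ≤ C ^ 3 := one_le_pow₀ hC
  have hr2 : 1 ≤ (r : ℝ) ^ 2 := one_le_pow₀ hr
  have hA0 : 0 ≤ A := by positivity
  set D := 6 * ‖LFunction ψ 1‖ * (C₂ * (4 * r) ^ (η / 2)) * A ^ (4 * (1 - β)) with hD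
  have hD0 : 0 ≤ D := by positivity
  refine ⟨(1 - β) / (D + 1), by positivity, fun q _ χ hχ hχ2 hχ1 hqr => ?_⟩
  have hq : (1 : ℝ) ≤ q := by exact_mod_cast Nat.pos_of_ne_zero (NeZero.ne q)
  have hκ : prodChar χ ψ ≠ 1 := fun h => hqr (prodChar_eq_one_imp hχ hψ hψ2 h)
  obtain ⟨a, ha, ha1, habs, hLa⟩ := exists_coeff_two_char hχ2 hψ2
  have h1 := hmain _ (((differentiable_LFunction hχ1).mul (differentiable_LFunction hψ1)).mul
    (differentiable_LFunction hκ)) (C ^ 3 * (r : ℝ) ^ 2 * (q : ℝ) ^ 2)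
    (one_le_mul_of_one_le_of_one_le (one_le_mul_of_one_le_of_one_le hC3 hr2) (one_le_pow₀ hq)) ?_ a ha
    ha1 habs hLa β hβ hβ1 (by simp [h0])
  swap
  · intro z hz
    rw [Pi.mul_apply, Pi.mul_apply, norm_mul, norm_mul]
    have e1 := hball q χ hχ1 z hz
    have e2 := hball r ψ hψ1 z hz
    have e3 := hball (q * r) _ hκ z hz
    calc _ ≤ (C * q) * (C * r) * (C * (q * r : ℕ)) := by gcongr
      _ = _ := by push_cast; ring
  rw [Pi.mul_apply, Pi.mul_apply, norm_mul, norm_mul] at h1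
  have h2 := hder (q * r) _ hκ 1 (by simp) (by norm_num)
  rw [iteratedDeriv_zero, anaCond] at h2
  have e1 : ((q * r : ℕ) * (|(1 : ℂ).im| + 4) : ℝ) ^ (η / 2) = (4 * r) ^ (η / 2) * (q : ℝ) ^ (η / 2) := by
    rw [← Real.mul_rpow (by positivity) (by positivity)]
    congr 1
    simp; ring
  rw [e1] at h2
  have e2 : (K * (C ^ 3 * (r : ℝ) ^ 2 * (q : ℝ) ^ 2)) ^ (4 * (1 - β))
      ≤ A ^ (4 * (1 - β)) * (q : ℝ) ^ (η / 2) := by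
    rw [show K * (C ^ 3 * (r : ℝ) ^ 2 * (q : ℝ) ^ 2) = A * (q : ℝ) ^ (2 : ℝ) by
      rw [hA, Real.rpow_two]; ring, Real.mul_rpow hA0 (by positivity), ← Real.rpow_mul (by positivity)]
    gcongr
    linarith
  have h3 : 1 - β ≤ D * (q : ℝ) ^ η * ‖LFunction χ 1‖ := by
    calc 1 - β ≤ _ := h1
      _ ≤ 6 * (‖LFunction χ 1‖ * ‖LFunction ψ 1‖ * (C₂ * ((4 * r) ^ (η / 2) * (q : ℝ) ^ (η / 2))))
          * (A ^ (4 * (1 - β)) * (q : ℝ) ^ (η / 2)) := by gcongr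
      _ = D * ((q : ℝ) ^ (η / 2) * (q : ℝ) ^ (η / 2)) * ‖LFunction χ 1‖ := by rw [hD]; ring
      _ = _ := by rw [← Real.rpow_add (by linarith)]; norm_num
  rw [Real.rpow_neg (by positivity), ← div_eq_mul_inv, div_div, div_le_iff₀ (by positivity)]
  have : 0 ≤ (q : ℝ) ^ η * ‖LFunction χ 1‖ := by positivity
  nlinarith

lemma exists_le_norm_LFunction_one_of_forall_ne_zero {η : ℝ} (hη : 0 < η)
    (hz : ∃ η' : ℝ, 0 < η' ∧ ∀ (q : ℕ) [NeZero q] (χ : DirichletCharacter ℂ q), χ.IsPrimitive →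
      χ ^ 2 = 1 → χ ≠ 1 → ∀ β : ℝ, 1 - η' < β → β < 1 → LFunction χ β ≠ 0) :
    ∃ c : ℝ, 0 < c ∧ ∀ (q : ℕ) [NeZero q] (χ : DirichletCharacter ℂ q), χ.IsPrimitive → χ ^ 2 = 1 →
      χ ≠ 1 → c * (q : ℝ) ^ (-η) ≤ ‖LFunction χ 1‖ := by
  obtain ⟨η', hη', hz⟩ := hz
  obtain ⟨K, hK, hmain⟩ := exists_one_sub_le_of_nonneg
  obtain ⟨C, hC, hball⟩ := exists_norm_LFunction_ball_le
  obtain ⟨Z, hZ⟩ := (isCompact_closedBall (2 : ℂ) (3 / 2)).exists_bound_of_continuousOn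
    differentiable_riemannZeta₀.continuous.continuousOn
  have hZ0 : 0 ≤ Z := (norm_nonneg _).trans (hZ 2 (Metric.mem_closedBall_self (by norm_num)))
  obtain ⟨b, hb0, hb1, hb2, hb3, hb4⟩ : ∃ b : ℝ, 0 < b ∧ b ≤ 1 / 8 ∧ b < η' ∧ 4 * b ≤ η ∧
      b * Z ≤ 1 := by
    refine ⟨min (min (1 / 8) (η' / 2)) (min (η / 4) (1 / (Z + 1))), by positivity, ?_, ?_, ?_, ?_⟩
    · exact (min_le_left _ _).trans (min_le_left _ _)
    · refine ((min_le_left _ _).trans (min_le_right _ _)).trans_lt (by linarith)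
    · have := (min_le_right (min (1 / 8) (η' / 2)) (min (η / 4) (1 / (Z + 1)))).trans (min_le_left _ _)
      linarith
    · have := (min_le_right (min (1 / 8) (η' / 2)) (min (η / 4) (1 / (Z + 1)))).trans
        (min_le_right _ _)
      refine (mul_le_mul_of_nonneg_right this hZ0).trans ?_
      rw [one_div, inv_mul_le_iff₀ (by linarith)]; linarith
  set β : ℝ := 1 - b with hβ
  have hKC : 0 < K * C := by positivity
  refine ⟨b / (6 * (K * C) ^ (4 * b)), by positivity, fun q _ χ hχ hχ2 hχ1 => ?_⟩
  have hq : (1 : ℝ) ≤ q := by exact_mod_cast Nat.pos_of_ne_zero (NeZero.ne q)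
  obtain ⟨a, ha, ha1, habs, hLa⟩ := exists_coeff_one_char hχ2
  have hcont : Continuous fun s : ℝ => (LFunction χ s).re :=
    Complex.continuous_re.comp ((differentiable_LFunction hχ1).continuous.comp
      Complex.continuous_ofReal)
  have hne : ∀ s : ℝ, β ≤ s → (LFunction χ s).re ≠ 0 := by
    intro s hs h
    have h1 : LFunction χ s = 0 := by
      rw [LFunction_real hχ2 hχ1 (by linarith : 0 < s), h, Complex.ofReal_zero]
    rcases lt_or_ge s 1 with h2 | h2
    · exact hz q χ hχ hχ2 hχ1 s (by linarith) h2 h1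
    · exact LFunction_ne_zero_of_one_le_re χ (Or.inl hχ1) (by simpa using h2) h1
  have hpos : 0 < (LFunction χ β).re := by
    have hlim : Filter.Tendsto (fun s : ℝ => (LFunction χ s).re) Filter.atTop (nhds 1) := by
      have h1 : LSeries.abscissaOfAbsConv (fun n => χ n) < ⊤ :=
        (LSeries.abscissaOfAbsConv_le_of_forall_lt_LSeriesSummable (x := 1) fun y hy =>
          χ.LSeriesSummable_of_one_lt_re (by simpa using hy)).trans_lt (EReal.coe_lt_top _)
      have h2 := (Complex.continuous_re.tendsto _).comp (LSeries.tendsto_atTop h1)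
      simp only [Nat.cast_one, map_one, Complex.one_re] at h2
      refine h2.congr' ?_
      filter_upwards [Filter.eventually_gt_atTop 1] with s hs
      rw [Function.comp_apply, LFunction_eq_LSeries χ (by simpa using hs)]
    obtain ⟨T, hT0, hT⟩ := ((hlim.eventually_const_lt one_pos).and
      (Filter.eventually_ge_atTop β)).exists
    by_contra! hneg
    obtain ⟨s, hs, hs0⟩ := intermediate_value_Icc hT hcont.continuousOn
      (Set.mem_Icc.mpr ⟨hneg, hT0.le⟩)
    exact hne s hs.1 hs0
  have hq0 : (0 : ℝ) < q := by linarith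
  have h1 := hmain _ (differentiable_LFunction hχ1) (C * q) (by nlinarith) (hball q χ hχ1) a ha ha1
    habs hLa β (by linarith) (by linarith) ?_
  · rw [show 1 - β = b by simp [hβ], ← mul_assoc, Real.mul_rpow hKC.le hq0.le] at h1
    have h2 : (q : ℝ) ^ (4 * b) ≤ (q : ℝ) ^ η := Real.rpow_le_rpow_of_exponent_le hq hb3
    rw [Real.rpow_neg hq0.le, ← div_eq_mul_inv, div_div, div_le_iff₀ (by positivity)]
    calc b ≤ _ := h1
      _ ≤ 6 * ‖LFunction χ 1‖ * ((K * C) ^ (4 * b) * (q : ℝ) ^ η) := by gcongr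
      _ = _ := by ring
  · rw [LFunction_real hχ2 hχ1 (by linarith : 0 < β), Complex.re_mul_ofReal]
    refine mul_nonpos_of_nonpos_of_nonneg ?_ hpos.le
    have hβ1 : (β : ℂ) ≠ 1 := by
      have : β ≠ 1 := by linarith
      exact_mod_cast this
    rw [riemannZeta_eq_inv_sub_add hβ1, Complex.add_re]
    have e1 : ((β : ℂ) - 1)⁻¹ = ((-(b⁻¹) : ℝ) : ℂ) := by
      rw [hβ]; push_cast; rw [← inv_neg]; congr 1; ring
    have e2 : (riemannZeta₀ β).re ≤ Z := by
      refine (Complex.re_le_norm _).trans (hZ _ ?_)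
      rw [mem_closedBall_iff_norm, show (β : ℂ) - 2 = ((β - 2 : ℝ) : ℂ) by push_cast; rfl,
        Complex.norm_real, Real.norm_eq_abs, abs_le]
      constructor <;> linarith
    have e3 : Z ≤ b⁻¹ := by
      rw [← one_div, le_div_iff₀ hb0]; linarith
    rw [e1, Complex.ofReal_re]
    linarith

/-- **Siegel's theorem**: a lower bound for `L(1, χ)` for primitive quadratic `χ`. -/
theorem exists_le_norm_LFunction_one {η : ℝ} (hη : 0 < η) :
    ∃ c : ℝ, 0 < c ∧ ∀ (q : ℕ) [NeZero q] (χ : DirichletCharacter ℂ q), χ.IsPrimitive → χ ^ 2 = 1 →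
      χ ≠ 1 → c * (q : ℝ) ^ (-η) ≤ ‖LFunction χ 1‖ := by
  set η' := min (1 / 8) (η / 16) with hη'
  by_cases hz : ∀ (q : ℕ) [NeZero q] (χ : DirichletCharacter ℂ q), χ.IsPrimitive →
      χ ^ 2 = 1 → χ ≠ 1 → ∀ β : ℝ, 1 - η' < β → β < 1 → LFunction χ β ≠ 0
  · exact exists_le_norm_LFunction_one_of_forall_ne_zero hη ⟨η', by positivity, hz⟩
  · push Not at hz
    obtain ⟨r, _, ψ, hψ, hψ2, hψ1, β, hβ, hβ1, h0⟩ := hz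
    have h8 := min_le_left (1 / 8) (η / 16)
    have h16 := min_le_right (1 / 8) (η / 16)
    obtain ⟨c, hc, h⟩ := exists_le_norm_LFunction_one_of_zero hη hψ hψ2 hψ1 (by linarith) hβ1
      (by linarith) h0
    have hfin : ∃ c' : ℝ, 0 < c' ∧ ∀ χ : DirichletCharacter ℂ r, χ ≠ 1 → c' ≤ ‖LFunction χ 1‖ := by
      have := (univ.filter fun χ : DirichletCharacter ℂ r => χ ≠ 1).exists_min_image
        (fun χ => ‖LFunction χ 1‖) ⟨ψ, by simp [hψ1]⟩
      obtain ⟨χ, hχ, hmin⟩ := this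
      refine ⟨‖LFunction χ 1‖, ?_, fun χ' h' => hmin χ' (by simp [h'])⟩
      exact norm_pos_iff.mpr (LFunction_apply_one_ne_zero (by simpa using hχ))
    obtain ⟨c', hc', h'⟩ := hfin
    refine ⟨min c c', by positivity, fun q _ χ hχ hχ2 hχ1 => ?_⟩
    have hq : (1 : ℝ) ≤ q := by exact_mod_cast Nat.pos_of_ne_zero (NeZero.ne q)
    by_cases hqr : q = r
    · subst hqr
      refine le_trans ?_ (h' χ hχ1)
      refine (mul_le_of_le_one_right (by positivity) ?_).trans (min_le_right _ _)
      exact Real.rpow_le_one_of_one_le_of_nonpos hq (by linarith)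
    · refine le_trans ?_ (h q χ hχ hχ2 hχ1 hqr)
      gcongr
      exact min_le_left _ _

end DirichletCharacter

namespace DirichletCharacter

lemma le_norm_LFunction_of_norm_le {q : ℕ} [NeZero q] {χ : DirichletCharacter ℂ q} {B y : ℝ}
    (hB : 1 ≤ B)
    (h1 : ∀ x : ℝ, 0 < x → x ≤ 1 → ‖LFunction (1 : DirichletCharacter ℂ q) (1 + x)‖ ≤ B / x)
    (h2 : ∀ z : ℂ, 1 < z.re → z.re ≤ 2 → z.im = y → ‖deriv (LFunction χ) z‖ ≤ B)
    {x : ℝ} (hx : 0 < x) (hx1 : x ≤ 1)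
    (h3 : ∀ x' : ℝ, x ≤ x' → x' ≤ 1 → ‖LFunction (χ ^ 2) (1 + x' + 2 * Complex.I * y)‖ ≤ B) :
    (16 * B ^ 7)⁻¹ ≤ ‖LFunction χ (1 + x + Complex.I * y)‖ := by
  have hB0 : 0 < B := by linarith
  have lower : ∀ x' : ℝ, x ≤ x' → x' ≤ 1 → ∀ v : ℝ, 0 ≤ v → v ^ 4 ≤ x' →
      v ^ 3 ≤ B * ‖LFunction χ (1 + x' + Complex.I * y)‖ := by
    intro x hxx hx1 v hv hvx
    replace hx := hx.trans_le hxx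
    have h := norm_LSeries_product_ge_one χ hx y
    rw [← LFunction_eq_LSeries _ (by simpa using hx), ← LFunction_eq_LSeries _ (by simpa using hx),
      ← LFunction_eq_LSeries _ (by simpa using hx), norm_mul, norm_mul, norm_pow, norm_pow] at h
    set N := ‖LFunction χ (1 + x + Complex.I * y)‖ with hN
    have h4 : 1 ≤ (B / x) ^ 3 * N ^ 4 * B := by
      refine h.le.trans ?_
      have e1 := h1 x hx hx1
      have e3 := h3 x hxx hx1
      gcongr
    have h5 : x ^ 3 ≤ (B * N) ^ 4 := by
      have : (B / x) ^ 3 * N ^ 4 * B = (B * N) ^ 4 / x ^ 3 := by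
        field_simp
      rwa [this, le_div_iff₀ (by positivity), one_mul] at h4
    have h6 : (v ^ 3) ^ 4 ≤ (B * N) ^ 4 := by
      refine le_trans ?_ h5
      calc (v ^ 3) ^ 4 = (v ^ 4) ^ 3 := by ring
        _ ≤ x ^ 3 := by gcongr
    exact (pow_le_pow_iff_left₀ (by positivity) (by positivity) (by norm_num)).mp h6
  set u : ℝ := (2 * B ^ 2)⁻¹ with hu
  have hu0 : 0 < u := by positivity
  have hu1 : u ≤ 1 := inv_le_one_of_one_le₀ (by nlinarith)
  have hδ1 : u ^ 4 ≤ 1 := pow_le_one₀ hu0.le hu1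
  have hval : u ^ 3 / (2 * B) = (16 * B ^ 7)⁻¹ := by
    rw [hu]; field_simp; norm_num
  rw [← hval]
  rcases le_or_gt (u ^ 4) x with hux | hux
  · have h := lower x le_rfl hx1 u hu0.le hux
    rw [div_le_iff₀ (by positivity)]
    nlinarith [norm_nonneg (LFunction χ (1 + x + Complex.I * y))]
  · have h := lower (u ^ 4) hux.le hδ1 u hu0.le le_rfl
    set a : ℂ := 1 + x + Complex.I * y with ha
    set b : ℂ := 1 + (u ^ 4 : ℝ) + Complex.I * y with hb
    have hconv : Convex ℝ {z : ℂ | (1 < z.re ∧ z.re ≤ 2) ∧ z.im = y} := by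
      refine ((convex_halfSpace_re_gt 1).inter (convex_halfSpace_re_le 2)).inter ?_
      intro z hz w hw s t hs ht hst
      change (s • z + t • w).im = y
      have hz' : z.im = y := hz
      have hw' : w.im = y := hw
      simp [hz', hw', ← add_mul, hst]
    have hab := hconv.norm_image_sub_le_of_norm_deriv_le (f := LFunction χ) (C := B) (x := a) (y := b)
      (fun z hz => differentiableAt_LFunction χ z (Or.inl (by
        rintro rfl; simpa using hz.1.1))) (fun z hz => h2 z hz.1.1 hz.1.2 hz.2)
      (by refine ⟨⟨?_, ?_⟩, ?_⟩ <;> simp [ha] <;> linarith)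
      (by refine ⟨⟨?_, ?_⟩, ?_⟩ <;> simp only [hb, Complex.add_re, Complex.one_re,
            Complex.ofReal_re, Complex.mul_re, Complex.I_re, Complex.I_im, Complex.ofReal_im,
            Complex.add_im, Complex.one_im, Complex.mul_im] <;> nlinarith)
    have hba : ‖b - a‖ ≤ u ^ 4 := by
      rw [show b - a = ((u ^ 4 - x : ℝ) : ℂ) by rw [ha, hb]; push_cast; ring, Complex.norm_real,
        Real.norm_eq_abs, abs_of_nonneg (by linarith)]
      linarith
    have h7 : ‖LFunction χ b‖ ≤ ‖LFunction χ a‖ + B * u ^ 4 := by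
      have := norm_sub_norm_le (LFunction χ b) (LFunction χ a)
      have : B * ‖b - a‖ ≤ B * u ^ 4 := by gcongr
      linarith
    have h8 : u ^ 3 / B ≤ ‖LFunction χ b‖ := by
      rw [div_le_iff₀ hB0]; linarith
    have h9 : u ^ 3 / B = 2 * (u ^ 3 / (2 * B)) := by field_simp
    have h10 : B * u ^ 4 = u ^ 3 / (2 * B) := by
      rw [show B * u ^ 4 = u ^ 3 * (B * u) by ring, hu]; field_simp
    linarith

lemma exists_norm_LFunction_one_le {η : ℝ} (hη : 0 < η) : ∃ C : ℝ, 0 < C ∧ ∀ (q : ℕ) [NeZero q]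
    (x : ℝ), 0 < x → x ≤ 1 →
      ‖LFunction (1 : DirichletCharacter ℂ q) (1 + x)‖ ≤ C * (4 * q : ℝ) ^ η / x := by
  obtain ⟨C, hC, h⟩ := exists_norm_LFunction_le_inv_add hη
  refine ⟨1 + C, by linarith, fun q _ x hx hx1 => ?_⟩
  have hq : (1 : ℝ) ≤ q := by exact_mod_cast Nat.pos_of_ne_zero (NeZero.ne q)
  have h1 := h q 1 (1 + x) (by simpa using hx) (by simp; linarith)
  have h2 : anaCond q (1 + (x : ℂ)) = 4 * q := by rw [anaCond]; simp; ring
  have h3 : 1 ≤ (4 * q : ℝ) ^ η := Real.one_le_rpow (by linarith) hη.le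
  rw [h2, add_sub_cancel_left, Complex.norm_real, Real.norm_eq_abs, abs_of_pos hx] at h1
  rw [le_div_iff₀ hx]
  calc _ ≤ (x⁻¹ + C * (4 * q : ℝ) ^ η) * x := by gcongr
    _ = 1 + C * (4 * q : ℝ) ^ η * x := by field_simp
    _ ≤ 1 * (4 * q : ℝ) ^ η + C * (4 * q : ℝ) ^ η * 1 := by gcongr; linarith
    _ = _ := by ring

lemma anaCond_two_im_le {q : ℕ} {s w : ℂ} (h : |w.im| ≤ 2 * |s.im|) : anaCond q w ≤ 2 * anaCond q s := by
  rw [anaCond, anaCond]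
  have : (0 : ℝ) ≤ q := Nat.cast_nonneg q
  nlinarith

lemma exists_le_norm_LFunction {η : ℝ} (hη : 0 < η) : ∃ c : ℝ, 0 < c ∧ ∀ (q : ℕ) [NeZero q]
    (χ : DirichletCharacter ℂ q), χ.IsPrimitive → χ ≠ 1 → ∀ s : ℂ, 1 < s.re → s.re ≤ 2 →
      c * anaCond q s ^ (-η) ≤ ‖LFunction χ s‖ := by
  have hη' : 0 < η / 14 := by positivity
  obtain ⟨C₁, hC₁, h1⟩ := exists_norm_LFunction_one_le hη'
  obtain ⟨C₀, hC₀, h0⟩ := exists_norm_iteratedDeriv_LFunction_le hη' 0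
  obtain ⟨C₂, hC₂, h2⟩ := exists_norm_iteratedDeriv_LFunction_le hη' 1
  obtain ⟨C₃, hC₃, h3⟩ := exists_norm_LFunction_le_inv_add hη'
  obtain ⟨c₄, hc₄, h4⟩ := exists_le_norm_LFunction_one hη'
  set D : ℝ := max (max C₁ (max C₂ (C₀ * 2 ^ (η / 14)))) (max (C₃ * 2 ^ (η / 14)) (max c₄⁻¹ 1)) with hD
  have hD1 : C₁ ≤ D := (le_max_left _ _).trans (le_max_left _ _)
  have hD2 : C₂ ≤ D := (le_max_left _ _).trans ((le_max_right _ _).trans (le_max_left _ _))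
  have hD0' : C₀ * 2 ^ (η / 14) ≤ D :=
    (le_max_right _ _).trans ((le_max_right _ _).trans (le_max_left _ _))
  have hD3 : C₃ * 2 ^ (η / 14) ≤ D := (le_max_left _ _).trans (le_max_right _ _)
  have hD4 : c₄⁻¹ ≤ D := ((le_max_left _ _).trans (le_max_right _ _)).trans (le_max_right _ _)
  have hD5 : 1 ≤ D := ((le_max_right _ _).trans (le_max_right _ _)).trans (le_max_right _ _)
  have hD0 : 0 < D := by linarith
  refine ⟨(16 * (5 * D ^ 2) ^ 7)⁻¹, by positivity, fun q _ χ hχ hχ1 s hs hs2 => ?_⟩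
  have hq : (1 : ℝ) ≤ q := by exact_mod_cast Nat.pos_of_ne_zero (NeZero.ne q)
  set X := anaCond q s with hX
  have hX4 : 4 ≤ X := four_le_anaCond q s
  have hX1 : 1 ≤ X ^ (η / 14) := Real.one_le_rpow (by linarith) hη'.le
  set A := D * X ^ (η / 14) with hA
  have hA1 : 1 ≤ A := by nlinarith
  have h4qX : 4 * (q : ℝ) ≤ X := by
    rw [hX, anaCond]; nlinarith [abs_nonneg s.im]
  have hgoal : (16 * (5 * D ^ 2) ^ 7)⁻¹ * X ^ (-η) = (16 * (5 * A ^ 2) ^ 7)⁻¹ := by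
    rw [Real.rpow_neg (by linarith), ← mul_inv]
    congr 1
    have hp : X ^ η = (X ^ (η / 14)) ^ 14 := by
      rw [← Real.rpow_natCast (X ^ _), ← Real.rpow_mul (by linarith)]
      congr 1; push_cast; ring
    rw [hp, hA]
    ring
  rw [hgoal]
  have hB1 : 1 ≤ 5 * A ^ 2 := by nlinarith
  have hAB : A ≤ 5 * A ^ 2 := by nlinarith
  have hder : ∀ z : ℂ, 1 ≤ z.re → z.re ≤ 2 → |z.im| ≤ |s.im| → ‖deriv (LFunction χ) z‖ ≤ A := by
    intro z hz1 hz2 hz3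
    have := h2 q χ hχ1 z hz1 hz2
    rw [iteratedDeriv_one] at this
    refine this.trans ?_
    rw [hA]
    have : anaCond q z ≤ X := by rw [hX, anaCond, anaCond]; gcongr
    have : 0 ≤ anaCond q z := by linarith [four_le_anaCond q z]
    gcongr
  have hA1' : ∀ x : ℝ, 0 < x → x ≤ 1 → ‖LFunction (1 : DirichletCharacter ℂ q) (1 + x)‖ ≤ A / x := by
    intro x hx hx1
    refine (h1 q x hx hx1).trans ?_
    rw [hA]; gcongr
  have hs_eq : s = 1 + ((s.re - 1 : ℝ) : ℂ) + Complex.I * s.im := by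
    apply Complex.ext <;> simp
  have main : (∀ x : ℝ, s.re - 1 ≤ x → x ≤ 1 →
      ‖LFunction (χ ^ 2) (1 + x + 2 * Complex.I * s.im)‖ ≤ 5 * A ^ 2) →
      (16 * (5 * A ^ 2) ^ 7)⁻¹ ≤ ‖LFunction χ s‖ := by
    intro h5
    have := le_norm_LFunction_of_norm_le (χ := χ) (y := s.im) hB1
      (fun x hx hx1 => (hA1' x hx hx1).trans (by gcongr))
      (fun z hz1 hz2 hz3 => (hder z hz1.le hz2 (by rw [hz3])).trans hAB)
      (x := s.re - 1) (by linarith) (by linarith) h5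
    rwa [← hs_eq] at this
  have hcond : ∀ x : ℝ, ∀ c : ℝ, 0 < c → c * 2 ^ (η / 14) ≤ D →
      c * anaCond q (1 + x + 2 * Complex.I * s.im) ^ (η / 14) ≤ A := by
    intro x c hc hcD
    have e1 : anaCond q (1 + x + 2 * Complex.I * s.im) ≤ 2 * X :=
      anaCond_two_im_le (by simp [abs_mul])
    have : 0 ≤ anaCond q (1 + x + 2 * Complex.I * s.im) := by
      linarith [four_le_anaCond q (1 + x + 2 * Complex.I * s.im)]
    calc c * anaCond q (1 + x + 2 * Complex.I * s.im) ^ (η / 14)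
        ≤ c * (2 * X) ^ (η / 14) := by gcongr
      _ = c * 2 ^ (η / 14) * X ^ (η / 14) := by
        rw [Real.mul_rpow (by norm_num) (by linarith)]; ring
      _ ≤ A := by rw [hA]; gcongr
  by_cases hχ2 : χ ^ 2 = 1
  · rcases lt_or_ge ‖s - 1‖ (2 * A ^ 2)⁻¹ with hlt | hge
    · have hone : A⁻¹ ≤ ‖LFunction χ 1‖ := by
        refine le_trans ?_ (h4 q χ hχ hχ2 hχ1)
        rw [hA, mul_inv, Real.rpow_neg (by linarith)]
        gcongr
        · exact inv_le_of_inv_le₀ hc₄ hD4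
        · linarith
      have hconv : Convex ℝ {z : ℂ | (1 ≤ z.re ∧ z.re ≤ 2) ∧ (-|s.im| ≤ z.im ∧ z.im ≤ |s.im|)} :=
        ((convex_halfSpace_re_ge 1).inter (convex_halfSpace_re_le 2)).inter
          ((convex_halfSpace_im_ge _).inter (convex_halfSpace_im_le _))
      have hab := hconv.norm_image_sub_le_of_norm_deriv_le (f := LFunction χ) (C := A) (x := s) (y := 1)
        (fun z _ => (differentiable_LFunction hχ1) z)
        (fun z hz => hder z hz.1.1 hz.1.2 (abs_le.mpr hz.2))
        ⟨⟨hs.le, hs2⟩, ⟨neg_abs_le _, le_abs_self _⟩⟩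
        ⟨⟨by simp, by norm_num⟩, ⟨by simp, by simp⟩⟩
      have e1 := norm_sub_norm_le (LFunction χ 1) (LFunction χ s)
      rw [norm_sub_rev 1 s] at hab
      have e2 : A * ‖s - 1‖ ≤ A⁻¹ / 2 := by
        calc A * ‖s - 1‖ ≤ A * (2 * A ^ 2)⁻¹ := by gcongr
          _ = A⁻¹ / 2 := by field_simp
      have e3 : (16 * (5 * A ^ 2) ^ 7)⁻¹ ≤ A⁻¹ / 2 := by
        rw [div_eq_mul_inv, ← mul_inv]
        apply inv_anti₀ (by positivity)
        have : 5 * A ^ 2 ≤ (5 * A ^ 2) ^ 7 := le_self_pow₀ hB1 (by norm_num)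
        nlinarith
      linarith
    · refine main fun x hx hx1 => ?_
      have hx0 : 0 < x := by linarith
      have h5 := h3 q (χ ^ 2) (1 + x + 2 * Complex.I * s.im) (by simpa using hx0) (by simp; linarith)
      rw [show (1 + x + 2 * Complex.I * s.im : ℂ) - 1 = x + 2 * Complex.I * s.im by ring] at h5
      have h6 := hcond x C₃ hC₃ hD3
      have h7 : (4 * A ^ 2)⁻¹ ≤ ‖(x : ℂ) + 2 * Complex.I * s.im‖ := by
        have e1 := Complex.abs_re_le_norm ((x : ℂ) + 2 * Complex.I * s.im)
        have e2 := Complex.abs_im_le_norm ((x : ℂ) + 2 * Complex.I * s.im)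
        simp [abs_mul] at e1 e2
        rw [abs_of_pos hx0] at e1
        have e3 := Complex.norm_le_abs_re_add_abs_im (s - 1)
        simp at e3
        rw [abs_of_pos (by linarith)] at e3
        have e4 : (2 * A ^ 2)⁻¹ = 2 * (4 * A ^ 2)⁻¹ := by field_simp; norm_num
        linarith
      have h8 := inv_le_of_inv_le₀ (by positivity) h7
      nlinarith
  · refine main fun x hx hx1 => ?_
    have h5 := h0 q (χ ^ 2) hχ2 (1 + x + 2 * Complex.I * s.im) (by simp; linarith) (by simp; linarith)
    rw [iteratedDeriv_zero] at h5
    exact (h5.trans (hcond x C₀ hC₀ hD0')).trans hAB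

end DirichletCharacter

lemma exists_norm_iteratedDeriv_le_of_deriv_eq_mul (k : ℕ) : ∃ C : ℝ, 1 ≤ C ∧ ∀ j ≤ k,
    ∀ (f h : ℂ → ℂ) (s : ℂ) (A : ℝ), 1 ≤ A → AnalyticAt ℂ f s → AnalyticAt ℂ h s →
    (deriv f =ᶠ[nhds s] fun z => f z * h z) → (∀ i ≤ j + 1, ‖iteratedDeriv i f s‖ ≤ A) →
    A⁻¹ ≤ ‖f s‖ → ‖iteratedDeriv j h s‖ ≤ C * A ^ (2 * j + 2) := by
  have step : ∀ (j : ℕ) (C : ℝ), 1 ≤ C → ∀ (f h : ℂ → ℂ) (s : ℂ) (A : ℝ), 1 ≤ A → AnalyticAt ℂ f s →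
      AnalyticAt ℂ h s → (deriv f =ᶠ[nhds s] fun z => f z * h z) →
      (∀ i ≤ j + 1, ‖iteratedDeriv i f s‖ ≤ A) → A⁻¹ ≤ ‖f s‖ →
      (∀ i < j, ‖iteratedDeriv i h s‖ ≤ C * A ^ (2 * i + 2)) →
      ‖iteratedDeriv j h s‖ ≤ (1 + 2 ^ j * C) * A ^ (2 * j + 2) := by
    intro j C hC f h s A hA hf hh hfh hi h0 hlow
    have hA0 : 0 < A := by linarith
    have e1 : iteratedDeriv (j + 1) f s = ∑ i ∈ range (j + 1),
        (j.choose i : ℂ) * iteratedDeriv i f s * iteratedDeriv (j - i) h s := by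
      rw [iteratedDeriv_succ', hfh.iteratedDeriv_eq, iteratedDeriv_fun_mul hf.contDiffAt hh.contDiffAt]
    rw [sum_range_succ', Nat.choose_zero_right, Nat.cast_one, one_mul, iteratedDeriv_zero,
      Nat.sub_zero] at e1
    have e2 : ‖∑ i ∈ range j, (j.choose (i + 1) : ℂ) * iteratedDeriv (i + 1) f s *
        iteratedDeriv (j - (i + 1)) h s‖ ≤ 2 ^ j * C * A ^ (2 * j + 1) := by
      have e3 : ∑ i ∈ range j, (j.choose (i + 1) : ℝ) ≤ 2 ^ j := by
        have := Nat.sum_range_choose j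
        rw [sum_range_succ'] at this
        have h2 : ∑ i ∈ range j, j.choose (i + 1) ≤ 2 ^ j := by omega
        exact_mod_cast h2
      calc _ ≤ ∑ i ∈ range j, (j.choose (i + 1) : ℝ) * (C * A ^ (2 * j + 1)) := by
            refine norm_sum_le_of_le _ fun i hir => ?_
            rw [norm_mul, norm_mul, Complex.norm_natCast, mul_assoc]
            have hij := mem_range.mp hir
            have f1 := hi (i + 1) (by omega)
            have f2 := hlow (j - (i + 1)) (by omega)
            refine mul_le_mul_of_nonneg_left ?_ (Nat.cast_nonneg _)
            calc _ ≤ A * (C * A ^ (2 * (j - (i + 1)) + 2)) :=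
                  mul_le_mul f1 f2 (norm_nonneg _) hA0.le
              _ = C * A ^ (2 * (j - (i + 1)) + 3) := by ring
              _ ≤ C * A ^ (2 * j + 1) := mul_le_mul_of_nonneg_left
                  (pow_le_pow_right₀ hA (by omega)) (by linarith)
        _ ≤ _ := by
          rw [← sum_mul, mul_assoc]; gcongr
    have e3 : ‖f s‖ * ‖iteratedDeriv j h s‖ ≤ A + 2 ^ j * C * A ^ (2 * j + 1) := by
      rw [← norm_mul, ← sub_eq_iff_eq_add'.mpr e1]
      exact (norm_sub_le _ _).trans (add_le_add (hi _ le_rfl) e2)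
    have e4 : A⁻¹ * ‖iteratedDeriv j h s‖ ≤ A + 2 ^ j * C * A ^ (2 * j + 1) :=
      le_trans (by gcongr) e3
    rw [inv_mul_le_iff₀ hA0] at e4
    refine e4.trans ?_
    have e5 : A ^ 2 ≤ A ^ (2 * j + 2) := pow_le_pow_right₀ hA (by omega)
    calc A * (A + 2 ^ j * C * A ^ (2 * j + 1)) = A ^ 2 + 2 ^ j * C * A ^ (2 * j + 2) := by ring
      _ ≤ _ := by linarith
  induction k with
  | zero =>
    refine ⟨2, by norm_num, fun j hj f h s A hA hf hh hfh hi h0 => ?_⟩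
    obtain rfl : j = 0 := by omega
    have := step 0 1 le_rfl f h s A hA hf hh hfh hi h0 (by simp)
    norm_num at this ⊢
    linarith
  | succ k ih =>
    obtain ⟨C, hC, ih⟩ := ih
    refine ⟨1 + 2 ^ (k + 1) * C, by nlinarith [pow_pos (two_pos (α := ℝ)) (k + 1)],
      fun j hj f h s A hA hf hh hfh hi h0 => ?_⟩
    rcases Nat.lt_or_ge k j with hjk | hjk
    · obtain rfl : j = k + 1 := by omega
      exact step (k + 1) C hC f h s A hA hf hh hfh hi h0 fun i hik =>
        ih i (by omega) f h s A hA hf hh hfh (fun l hl => hi l (by omega)) h0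
    · refine (ih j hjk f h s A hA hf hh hfh hi h0).trans ?_
      have : 1 ≤ (2 : ℝ) ^ (k + 1) := one_le_pow₀ (by norm_num)
      gcongr
      nlinarith

lemma exists_norm_iteratedDeriv_logDeriv_le_of_bounds (k : ℕ) : ∃ C : ℝ, 1 ≤ C ∧
    ∀ (f : ℂ → ℂ) (s : ℂ) (A : ℝ), 1 ≤ A → AnalyticAt ℂ f s →
    (∀ i ≤ k + 1, ‖iteratedDeriv i f s‖ ≤ A) →
    A⁻¹ ≤ ‖f s‖ → ‖iteratedDeriv k (logDeriv f) s‖ ≤ C * A ^ (2 * k + 2) := by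
  obtain ⟨C, hC, h⟩ := exists_norm_iteratedDeriv_le_of_deriv_eq_mul k
  refine ⟨C, hC, fun f s A hA hf hi h0 => ?_⟩
  have hf0 : f s ≠ 0 := norm_pos_iff.mp ((inv_pos.mpr (by linarith)).trans_le h0)
  refine h k le_rfl f (logDeriv f) s A hA hf (hf.deriv.div hf hf0) ?_ hi h0
  filter_upwards [hf.continuousAt.eventually_ne hf0] with z hz
  rw [logDeriv_apply]; field_simp

namespace DirichletCharacter

lemma exists_norm_iteratedDeriv_logDeriv_le {η : ℝ} (hη : 0 < η) (k : ℕ) : ∃ C : ℝ, 0 < C ∧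
    ∀ (q : ℕ) [NeZero q] (χ : DirichletCharacter ℂ q), χ.IsPrimitive → χ ≠ 1 → ∀ s : ℂ, 1 < s.re →
      s.re ≤ 2 → ‖iteratedDeriv k (logDeriv (LFunction χ)) s‖ ≤ C * anaCond q s ^ η := by
  have hη' : 0 < η / (2 * k + 2) := by positivity
  obtain ⟨C, hC, h⟩ := exists_norm_iteratedDeriv_logDeriv_le_of_bounds k
  obtain ⟨c, hc, hlow⟩ := exists_le_norm_LFunction hη'
  choose D hD0 hD using fun i : ℕ => exists_norm_iteratedDeriv_LFunction_le hη' i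
  set E : ℝ := c⁻¹ + 1 + ∑ i ∈ range (k + 2), D i with hE
  have hDs : 0 ≤ ∑ i ∈ range (k + 2), D i := sum_nonneg fun i _ => (hD0 i).le
  have hE1 : 1 ≤ E := by have : 0 < c⁻¹ := by positivity
                         linarith
  have hEc : c⁻¹ ≤ E := by linarith
  refine ⟨C * E ^ (2 * k + 2), by positivity, fun q _ χ hχ hχ1 s hs hs2 => ?_⟩
  have hX4 := four_le_anaCond q s
  set X := anaCond q s
  have hX1 : 1 ≤ X ^ (η / (2 * k + 2)) := Real.one_le_rpow (by linarith) hη'.le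
  have := h (LFunction χ) s (E * X ^ (η / (2 * k + 2))) (one_le_mul_of_one_le_of_one_le hE1 hX1)
    ((differentiable_LFunction hχ1).analyticAt s) (fun i hi => ?_) ?_
  · refine this.trans (le_of_eq ?_)
    rw [mul_pow, ← Real.rpow_natCast (X ^ _), ← Real.rpow_mul (by linarith), mul_assoc]
    congr 3
    push_cast; field_simp
  · refine (hD i q χ hχ1 s hs.le hs2).trans ?_
    have : D i ≤ ∑ i ∈ range (k + 2), D i :=
      single_le_sum (fun i _ => (hD0 i).le) (mem_range.mpr (by omega))
    have : D i ≤ E := by have : 0 < c⁻¹ := by positivity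
                         linarith
    gcongr
  · refine le_trans ?_ (hlow q χ hχ hχ1 s hs hs2)
    rw [mul_inv, Real.rpow_neg (by linarith)]
    gcongr
    exact inv_le_of_inv_le₀ hc hEc

end DirichletCharacter

lemma exists_le_norm_riemannZeta {η : ℝ} (hη : 0 < η) : ∃ c : ℝ, 0 < c ∧ ∀ s : ℂ, 1 < s.re →
    s.re ≤ 2 → 1 ≤ |s.im| → c * anaCond 1 s ^ (-η) ≤ ‖riemannZeta s‖ := by
  have hη' : 0 < η / 7 := by positivity
  obtain ⟨C₁, hC₁, h1⟩ := DirichletCharacter.exists_norm_LFunction_one_le hη'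
  obtain ⟨C₂, hC₂, h2⟩ := exists_norm_iteratedDeriv_riemannZeta_le hη' 1
  obtain ⟨C₃, hC₃, h3⟩ := exists_norm_LFunction_le_inv_add hη'
  set D : ℝ := max (max C₁ C₂) (max (C₃ * 2 ^ (η / 7)) 1) with hD
  have hD1 : C₁ ≤ D := (le_max_left _ _).trans (le_max_left _ _)
  have hD2 : C₂ ≤ D := (le_max_right _ _).trans (le_max_left _ _)
  have hD3 : C₃ * 2 ^ (η / 7) ≤ D := (le_max_left _ _).trans (le_max_right _ _)
  have hD5 : 1 ≤ D := (le_max_right _ _).trans (le_max_right _ _)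
  have hD0 : 0 < D := by linarith
  refine ⟨(16 * (2 * D) ^ 7)⁻¹, by positivity, fun s hs hs2 hs1 => ?_⟩
  set X := anaCond 1 s with hX
  have hX4 : 4 ≤ X := four_le_anaCond 1 s
  have hX1 : 1 ≤ X ^ (η / 7) := Real.one_le_rpow (by linarith) hη'.le
  set A := D * X ^ (η / 7) with hA
  have hA1 : 1 ≤ A := by nlinarith
  have hgoal : (16 * (2 * D) ^ 7)⁻¹ * X ^ (-η) = (16 * (2 * A) ^ 7)⁻¹ := by
    rw [Real.rpow_neg (by linarith), ← mul_inv]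
    congr 1
    have hp : X ^ η = (X ^ (η / 7)) ^ 7 := by
      rw [← Real.rpow_natCast (X ^ _), ← Real.rpow_mul (by linarith)]
      congr 1; push_cast; ring
    rw [hp, hA]
    ring
  rw [hgoal]
  have hs_eq : s = 1 + ((s.re - 1 : ℝ) : ℂ) + Complex.I * s.im := by
    apply Complex.ext <;> simp
  have := DirichletCharacter.le_norm_LFunction_of_norm_le (q := 1) (χ := 1) (B := 2 * A) (y := s.im)
    (by linarith) (fun x hx hx1 => ?_) (fun z hz1 hz2 hz3 => ?_)
    (x := s.re - 1) (by linarith) (by linarith) (fun x hx hx1 => ?_)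
  · rwa [← hs_eq, DirichletCharacter.LFunction_modOne_eq] at this
  · refine (h1 1 x hx hx1).trans ?_
    rw [Nat.cast_one, mul_one]
    refine div_le_div_of_nonneg_right ?_ hx.le
    calc C₁ * 4 ^ (η / 7) ≤ D * X ^ (η / 7) := by gcongr
      _ ≤ 2 * A := by linarith
  · rw [DirichletCharacter.LFunction_modOne_eq, ← iteratedDeriv_one]
    have hz : anaCond 1 z = X := by rw [hX, anaCond, anaCond, hz3]
    refine (h2 z hz1.le hz2 (by rwa [hz3])).trans ?_
    rw [hz]
    calc C₂ * X ^ (η / 7) ≤ D * X ^ (η / 7) := by gcongr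
      _ ≤ 2 * A := by linarith
  · have hx0 : 0 < x := by linarith
    have h5 := h3 1 (1 ^ 2) (1 + x + 2 * Complex.I * s.im) (by simpa using hx0) (by simp; linarith)
    rw [show (1 + x + 2 * Complex.I * s.im : ℂ) - 1 = x + 2 * Complex.I * s.im by ring] at h5
    have e1 : anaCond 1 (1 + x + 2 * Complex.I * s.im) ≤ 2 * X :=
      DirichletCharacter.anaCond_two_im_le (by simp [abs_mul])
    have e2 : 0 ≤ anaCond 1 (1 + x + 2 * Complex.I * s.im) := by
      linarith [four_le_anaCond 1 (1 + x + 2 * Complex.I * s.im)]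
    have e3 : C₃ * anaCond 1 (1 + x + 2 * Complex.I * s.im) ^ (η / 7) ≤ A := by
      calc C₃ * anaCond 1 (1 + x + 2 * Complex.I * s.im) ^ (η / 7)
        ≤ C₃ * (2 * X) ^ (η / 7) := by gcongr
      _ = C₃ * 2 ^ (η / 7) * X ^ (η / 7) := by
        rw [Real.mul_rpow (by norm_num) (by linarith)]; ring
      _ ≤ A := by rw [hA]; gcongr
    have e4 : ‖(x : ℂ) + 2 * Complex.I * s.im‖⁻¹ ≤ 1 := by
      refine inv_le_one_of_one_le₀ ?_
      have e2 := Complex.abs_im_le_norm ((x : ℂ) + 2 * Complex.I * s.im)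
      simp [abs_mul] at e2
      linarith
    linarith

lemma exists_norm_iteratedDeriv_logDeriv_riemannZeta_add_le {η : ℝ} (hη : 0 < η) (k : ℕ) :
    ∃ C : ℝ, 0 < C ∧ ∀ s : ℂ, 1 < s.re → s.re ≤ 2 →
      ‖iteratedDeriv k (fun z => logDeriv riemannZeta z + riemannZeta z) s‖ ≤ C * anaCond 1 s ^ η := by
  have hη' : 0 < η / (2 * k + 2) := by positivity
  obtain ⟨C, hC, h⟩ := exists_norm_iteratedDeriv_logDeriv_le_of_bounds k
  obtain ⟨c, hc, hlow⟩ := exists_le_norm_riemannZeta hη'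
  choose D hD0 hD using fun i : ℕ => exists_norm_iteratedDeriv_riemannZeta_le hη' i
  obtain ⟨D', hD'0, hD'⟩ := exists_norm_iteratedDeriv_riemannZeta_le hη k
  set E : ℝ := c⁻¹ + 1 + ∑ i ∈ range (k + 2), D i with hE
  have hDs : 0 ≤ ∑ i ∈ range (k + 2), D i := sum_nonneg fun i _ => (hD0 i).le
  have hc' : 0 < c⁻¹ := by positivity
  have hE1 : 1 ≤ E := by linarith
  have hEc : c⁻¹ ≤ E := by linarith
  set P : ℂ → ℂ := fun z => logDeriv riemannZeta₁ z + riemannZeta₀ z with hP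
  have hG0 : ∀ z : ℂ, 1 ≤ z.re → riemannZeta₁ z ≠ 0 := by
    intro z hz
    rcases eq_or_ne z 1 with rfl | hz1
    · rw [riemannZeta₁]; simp
    · have := riemannZeta_ne_zero_of_one_le_re hz
      rw [riemannZeta_eq_inv_sub_mul hz1] at this
      exact right_ne_zero_of_mul this
  have hPa : ∀ z : ℂ, 1 ≤ z.re → AnalyticAt ℂ P z := fun z hz =>
    (((differentiable_riemannZeta₁.analyticAt z).deriv).div (differentiable_riemannZeta₁.analyticAt z)
      (hG0 z hz)).add (differentiable_riemannZeta₀.analyticAt z)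
  have hPeq : ∀ z : ℂ, 1 < z.re → logDeriv riemannZeta z + riemannZeta z = P z := by
    intro z hz
    have hz1 : z ≠ 1 := by rintro rfl; simp at hz
    have hz1' : z - 1 ≠ 0 := sub_ne_zero.mpr hz1
    have hev : riemannZeta =ᶠ[nhds z] fun w => (w - 1)⁻¹ * riemannZeta₁ w := by
      filter_upwards [isOpen_ne.mem_nhds hz1] with w hw
      exact riemannZeta_eq_inv_sub_mul hw
    have e1 : logDeriv riemannZeta z = -(z - 1)⁻¹ + logDeriv riemannZeta₁ z := by
      rw [logDeriv_apply, hev.deriv_eq, hev.eq_of_nhds, ← logDeriv_apply,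
        logDeriv_mul (f := fun w : ℂ => (w - 1)⁻¹) (g := riemannZeta₁) z (inv_ne_zero hz1') (hG0 z hz.le)
          ((differentiableAt_id.sub_const 1).inv hz1') (differentiable_riemannZeta₁ z)]
      congr 1
      rw [logDeriv_apply]
      have : HasDerivAt (fun w : ℂ => (w - 1)⁻¹) (-1 / (z - 1) ^ 2) z :=
        ((hasDerivAt_id z).sub_const 1).inv hz1'
      rw [this.deriv]
      field_simp
    rw [e1, riemannZeta_eq_inv_sub_add hz1]
    simp only [hP]; ring
  obtain ⟨Z, hZ⟩ := (((isCompact_Icc (a := (1 : ℝ)) (b := 2)).reProdIm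
    (isCompact_Icc (a := (-1 : ℝ)) (b := 1)))).exists_bound_of_continuousOn
    (f := iteratedDeriv k P) (fun z hz => by
      rw [iteratedDeriv_eq_iterate]
      exact ((hPa z hz.1.1).iterated_deriv k).continuousAt.continuousWithinAt)
  refine ⟨C * E ^ (2 * k + 2) + D' + |Z|, by positivity, fun s hs hs2 => ?_⟩
  have hX4 := four_le_anaCond 1 s
  set X := anaCond 1 s
  have hX1 : 1 ≤ X ^ (η / (2 * k + 2)) := Real.one_le_rpow (by linarith) hη'.le
  have hX1' : 1 ≤ X ^ η := Real.one_le_rpow (by linarith) hη.le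
  have hs1 : s ≠ 1 := by rintro rfl; simp at hs
  have hζa : AnalyticAt ℂ riemannZeta s := by
    refine DifferentiableOn.analyticAt (s := {1}ᶜ) (fun w hw => ?_) (isOpen_ne.mem_nhds hs1)
    exact (differentiableAt_riemannZeta hw).differentiableWithinAt
  rcases le_or_gt 1 |s.im| with him | him
  · have h1 := h riemannZeta s (E * X ^ (η / (2 * k + 2))) (one_le_mul_of_one_le_of_one_le hE1 hX1)
      hζa (fun i hi => ?_) ?_
    · have hld : AnalyticAt ℂ (logDeriv riemannZeta) s :=
        hζa.deriv.div hζa (riemannZeta_ne_zero_of_one_le_re hs.le)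
      rw [iteratedDeriv_fun_add hld.contDiffAt hζa.contDiffAt]
      refine (norm_add_le _ _).trans ?_
      have h2 := hD' s hs.le hs2 him
      have h3 : C * (E * X ^ (η / (2 * k + 2))) ^ (2 * k + 2) = C * E ^ (2 * k + 2) * X ^ η := by
        rw [mul_pow, ← Real.rpow_natCast (X ^ _), ← Real.rpow_mul (by linarith), mul_assoc]
        congr 3
        push_cast; field_simp
      rw [h3] at h1
      have : 0 ≤ |Z| * X ^ η := by positivity
      linarith
    · refine (hD i s hs.le hs2 him).trans ?_
      have : D i ≤ ∑ i ∈ range (k + 2), D i :=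
        single_le_sum (fun i _ => (hD0 i).le) (mem_range.mpr (by omega))
      have : D i ≤ E := by linarith
      gcongr
    · refine le_trans ?_ (hlow s hs hs2 him)
      rw [mul_inv, Real.rpow_neg (by linarith)]
      gcongr
      exact inv_le_of_inv_le₀ hc hEc
  · have hev : (fun z => logDeriv riemannZeta z + riemannZeta z) =ᶠ[nhds s] P := by
      filter_upwards [(isOpen_lt continuous_const Complex.continuous_re).mem_nhds hs] with z hz
      exact hPeq z hz
    rw [hev.iteratedDeriv_eq]
    have h1 : ‖iteratedDeriv k P s‖ ≤ Z := by
      refine hZ s ?_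
      rw [Complex.mem_reProdIm]
      exact ⟨⟨hs.le, hs2⟩, abs_le.mp him.le⟩
    have : |Z| ≤ |Z| * X ^ η := le_mul_of_one_le_right (abs_nonneg _) hX1'
    have : 0 ≤ (C * E ^ (2 * k + 2) + D') * X ^ η := by positivity
    have := le_abs_self Z
    linarith

section

open Complex MeasureTheory

private noncomputable def hatKernel (u : ℝ) : ℂ :=
  Set.indicator (Set.Ioc 0 1) (fun _ => 1) u - Set.indicator (Set.Ioc 0 1) (fun t : ℝ => (t : ℂ) ^ (1 : ℂ)) u

private lemma hatKernel_eq {u : ℝ} (hu : 0 < u) : hatKernel u = ((max (1 - u) 0 : ℝ) : ℂ) := by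
  unfold hatKernel
  by_cases h : u ≤ 1
  · have hm : u ∈ Set.Ioc (0 : ℝ) 1 := ⟨hu, h⟩
    rw [Set.indicator_of_mem hm, Set.indicator_of_mem hm, max_eq_left (by linarith)]
    simp
  · rw [Set.indicator_of_notMem (fun h' => h h'.2), Set.indicator_of_notMem (fun h' => h h'.2),
      max_eq_right (by linarith)]
    simp

private lemma norm_hatKernel_mellin_le {c : ℝ} (hc : 1 < c) (y : ℝ) :
    ‖1 / ((c : ℂ) + y * I) - 1 / ((c : ℂ) + y * I + 1)‖ ≤ (1 + y ^ 2)⁻¹ := by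
  have h0 : ∀ d : ℝ, 1 < d → √(1 + y ^ 2) ≤ ‖(d : ℂ) + y * I‖ := fun d hd => by
    rw [norm_add_mul_I]
    exact Real.sqrt_le_sqrt (by nlinarith)
  have h1 := h0 c hc
  have h2 := h0 (c + 1) (by linarith)
  have hp : 0 < √(1 + y ^ 2) := by positivity
  have e : (c : ℂ) + y * I + 1 = ((c + 1 : ℝ) : ℂ) + y * I := by push_cast; ring
  rw [e]
  have n1 : (c : ℂ) + y * I ≠ 0 := norm_pos_iff.mp (hp.trans_le h1)
  have n2 : ((c + 1 : ℝ) : ℂ) + y * I ≠ 0 := norm_pos_iff.mp (hp.trans_le h2)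
  have : 1 / ((c : ℂ) + y * I) - 1 / (((c + 1 : ℝ) : ℂ) + y * I)
      = (((c : ℂ) + y * I) * (((c + 1 : ℝ) : ℂ) + y * I))⁻¹ := by
    field_simp
    push_cast; ring
  rw [this, norm_inv, norm_mul]
  refine inv_anti₀ (by positivity) ?_
  calc 1 + y ^ 2 = √(1 + y ^ 2) * √(1 + y ^ 2) := (Real.mul_self_sqrt (by positivity)).symm
    _ ≤ _ := by gcongr

private lemma integrable_hatKernel_mellin {c : ℝ} (hc : 1 < c) :
    Integrable (fun y : ℝ => 1 / ((c : ℂ) + y * I) - 1 / ((c : ℂ) + y * I + 1)) := by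
  refine integrable_inv_one_add_sq.mono' ?_ (Filter.Eventually.of_forall fun y => norm_hatKernel_mellin_le hc y)
  refine Continuous.aestronglyMeasurable ?_
  have h : ∀ d : ℝ, 0 < d → ∀ y : ℝ, (d : ℂ) + y * I ≠ 0 := fun d hd y h => by
    have := congrArg re h
    simp at this; linarith
  refine Continuous.sub (continuous_const.div (by fun_prop) (h c (by linarith)))
    (continuous_const.div (by fun_prop) fun y h' => h (c + 1) (by linarith) y ?_)
  rw [← h']; push_cast; ring

private lemma hatKernel_inversion {c u : ℝ} (hc : 1 < c) (hu : 0 < u) :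
    ((max (1 - u) 0 : ℝ) : ℂ) = (1 / (2 * Real.pi) : ℝ) • ∫ y : ℝ, (u : ℂ) ^ (-((c : ℂ) + y * I)) *
      (1 / ((c : ℂ) + y * I) - 1 / ((c : ℂ) + y * I + 1)) := by
  have hm : ∀ s : ℂ, 0 < s.re → HasMellin hatKernel s (1 / s - 1 / (s + 1)) := fun s hs =>
by
    have h1 := hasMellin_one_Ioc hs
    have h2 := hasMellin_cpow_Ioc 1 (s := s) (by simp; linarith)
    have h3 := hasMellin_sub h1.1 h2.1
    rw [h1.2, h2.2] at h3
    exact h3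
  have hre : ∀ y : ℝ, 0 < ((c : ℂ) + y * I).re := fun y => by simp; linarith
  have hcont : ContinuousAt hatKernel u := by
    have : hatKernel =ᶠ[nhds u] fun u => ((max (1 - u) 0 : ℝ) : ℂ) := by
      filter_upwards [lt_mem_nhds hu] with v hv using hatKernel_eq hv
    refine ContinuousAt.congr ?_ this.symm
    fun_prop
  have := mellinInv_mellin_eq c hatKernel hu (hm c (by simp; linarith)).1
    ((integrable_hatKernel_mellin hc).congr (Filter.Eventually.of_forall fun y => (hm _ (hre y)).2.symm))
    hcont
  rw [← hatKernel_eq hu, ← this]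
  unfold mellinInv
  congr 1
  refine integral_congr_ae (Filter.Eventually.of_forall fun y => ?_)
  simp only [smul_eq_mul]
  rw [(hm _ (hre y)).2]

private lemma integrable_rpow_div : Integrable (fun y : ℝ => (|y| + 4) ^ ((1 : ℝ) / 2) * (1 + y ^ 2)⁻¹) := by
  have h := (integrable_rpow_neg_one_add_norm_sq (E := ℝ) (μ := volume) (r := 3 / 2)
    (by simp; norm_num)).const_mul 4
  refine h.mono' (Continuous.aestronglyMeasurable ?_) (Filter.Eventually.of_forall fun y => ?_)
  · refine Continuous.mul (Continuous.rpow_const (by fun_prop) fun y => Or.inr (by norm_num)) ?_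
    exact Continuous.inv₀ (by fun_prop) fun y => by positivity
  · have hp : (0 : ℝ) < 1 + y ^ 2 := by positivity
    rw [Real.norm_of_nonneg (by positivity)]
    have h1 : (|y| + 4) ^ ((1 : ℝ) / 2) ≤ 4 * (1 + y ^ 2) ^ ((1 : ℝ) / 4) := by
      have e : (|y| + 4) ^ ((1 : ℝ) / 2) = ((|y| + 4) ^ 2) ^ ((1 : ℝ) / 4) := by
        rw [← Real.rpow_natCast (|y| + 4), ← Real.rpow_mul (by positivity)]; norm_num
      have e4 : (4 : ℝ) = (256 : ℝ) ^ ((1 : ℝ) / 4) := by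
        rw [show (256 : ℝ) = 4 ^ (4 : ℝ) by norm_num, ← Real.rpow_mul (by norm_num)]; norm_num
      have e5 : 4 * (1 + y ^ 2) ^ ((1 : ℝ) / 4) = (256 * (1 + y ^ 2)) ^ ((1 : ℝ) / 4) := by
        rw [Real.mul_rpow (by norm_num) hp.le, ← e4]
      rw [e, e5]
      refine Real.rpow_le_rpow (by positivity) ?_ (by norm_num)
      have := sq_abs y
      nlinarith [sq_nonneg (|y| - 4)]
    have h2 : (1 + y ^ 2)⁻¹ = (1 + y ^ 2) ^ (-1 : ℝ) := (Real.rpow_neg_one _).symm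
    rw [Real.norm_eq_abs, sq_abs]
    calc _ ≤ 4 * (1 + y ^ 2) ^ ((1 : ℝ) / 4) * (1 + y ^ 2)⁻¹ := by gcongr
      _ = 4 * (1 + y ^ 2) ^ (-(3 / 2 : ℝ) / 2) := by
        rw [h2, mul_assoc, ← Real.rpow_add hp]; norm_num

/-- A smoothed sum of coefficients is controlled by the size of the Dirichlet series on a
vertical line. -/
lemma norm_sum_mul_sub_le (a : ℕ → ℂ) {c K : ℝ} (hc : 1 < c) (hK : 0 ≤ K) (hs : LSeriesSummable a c)
    (h : ∀ y : ℝ, ‖LSeries a (c + y * I)‖ ≤ K * (|y| + 4) ^ ((1 : ℝ) / 2)) (x : ℕ) (hx : 0 < x) :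
    ‖∑ n ∈ Ioc 0 x, a n * ((x : ℂ) - n)‖ ≤
      (∫ y : ℝ, (|y| + 4) ^ ((1 : ℝ) / 2) * (1 + y ^ 2)⁻¹) * K * (x : ℝ) ^ (c + 1) := by
  have hxr : (0 : ℝ) < x := by exact_mod_cast hx
  set κ : ℝ → ℂ := fun y => 1 / ((c : ℂ) + y * I) - 1 / ((c : ℂ) + y * I + 1) with hκ
  set G : ℕ → ℝ → ℂ := fun n y => LSeries.term a (c + y * I) n * ((x : ℂ) ^ ((c : ℂ) + y * I) * κ y) with hG
  have hre : ∀ y : ℝ, ((c : ℂ) + y * I).re = c := fun y => by simp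
  have hxn : ∀ y : ℝ, ‖(x : ℂ) ^ ((c : ℂ) + y * I)‖ = (x : ℝ) ^ c := fun y => by
    rw [norm_natCast_cpow_of_pos hx, hre]
  have hxc : Continuous fun y : ℝ => (x : ℂ) ^ ((c : ℂ) + y * I) := by
    refine Continuous.const_cpow (by fun_prop) (Or.inl (by exact_mod_cast hx.ne'))
  have hκi : Integrable κ := integrable_hatKernel_mellin hc
  have hbase : Integrable fun y : ℝ => (x : ℂ) ^ ((c : ℂ) + y * I) * κ y :=
    hκi.bdd_mul hxc.aestronglyMeasurable (c := (x : ℝ) ^ c)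
      (Filter.Eventually.of_forall fun y => (hxn y).le)
  have hterm : ∀ (n : ℕ) (y : ℝ), ‖LSeries.term a (c + y * I) n‖ = ‖LSeries.term a c n‖ := fun n y => by
    rw [LSeries.norm_term_eq, LSeries.norm_term_eq, hre, ofReal_re]
  have htc : ∀ n, Continuous fun y : ℝ => LSeries.term a (c + y * I) n := fun n => by
    rcases Nat.eq_zero_or_pos n with rfl | hn
    · simp only [LSeries.term_zero]; fun_prop
    · simp only [LSeries.term_of_ne_zero hn.ne']
      refine continuous_const.div (Continuous.const_cpow (by fun_prop) (Or.inl (by exact_mod_cast hn.ne')))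
        fun y => ?_
      simp [cpow_eq_zero_iff, hn.ne']
  have hGi : ∀ n, Integrable (G n) := fun n =>
    hbase.bdd_mul (htc n).aestronglyMeasurable (c := ‖LSeries.term a c n‖)
      (Filter.Eventually.of_forall fun y => (hterm n y).le)
  have hsum := hasSum_integral_of_summable_integral_norm (F := G) hGi (by
    have : (fun n => ∫ y, ‖G n y‖) = fun n => ‖LSeries.term a c n‖ *
        ∫ y : ℝ, ‖(x : ℂ) ^ ((c : ℂ) + y * I) * κ y‖ := by
      funext n
      rw [← integral_const_mul]
      refine integral_congr_ae (Filter.Eventually.of_forall fun y => ?_)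
      simp only [hG]
      rw [norm_mul, hterm]
    rw [this]
    exact (Summable.norm hs).mul_right _)
  have hGint : ∀ n, 0 < n → ∫ y, G n y = (2 * Real.pi) * (a n * (max (1 - (n : ℝ) / x) 0 : ℝ)) := fun n hn => by
    have hnr : (0 : ℝ) < n := by exact_mod_cast hn
    rw [hatKernel_inversion hc (div_pos hnr hxr)]
    have e : ∀ y, G n y = a n * ((((n : ℝ) / x : ℝ) : ℂ) ^ (-((c : ℂ) + y * I)) * κ y) := fun y => by
      simp only [hG, LSeries.term_of_ne_zero hn.ne']
      have e1 : (((n : ℝ) / x : ℝ) : ℂ) ^ (-((c : ℂ) + y * I))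
          = (x : ℂ) ^ ((c : ℂ) + y * I) / (n : ℂ) ^ ((c : ℂ) + y * I) := by
        rw [div_eq_mul_inv, ofReal_mul, mul_cpow_ofReal_nonneg hnr.le (by positivity), ofReal_inv,
          inv_cpow _ _ (by simp [Real.pi_pos.ne]), cpow_neg, cpow_neg, inv_inv]
        push_cast
        rw [div_eq_mul_inv, mul_comm]
      rw [e1]; ring
    simp_rw [e]
    rw [integral_const_mul, real_smul]
    have := Real.pi_pos.ne'
    simp only [hκ]
    generalize (∫ y : ℝ, ((((n : ℝ) / x : ℝ) : ℂ) ^ (-((c : ℂ) + y * I)) *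
      (1 / ((c : ℂ) + y * I) - 1 / ((c : ℂ) + y * I + 1)))) = J
    push_cast
    field_simp
  have hval : ∑ n ∈ Ioc 0 x, a n * ((x : ℂ) - n) = x / (2 * Real.pi) * ∫ y, ∑' n, G n y := by
    have h0 : ∀ n ∉ Ioc 0 x, ∫ y, G n y = 0 := fun n hn => by
      rcases Nat.eq_zero_or_pos n with rfl | hn0
      · simp [hG]
      · rw [hGint n hn0, max_eq_right]
        · simp
        · have : (x : ℝ) ≤ n := by
            have : ¬ n ≤ x := fun h => hn (mem_Ioc.mpr ⟨hn0, h⟩)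
            exact_mod_cast (by omega : x ≤ n)
          rw [sub_nonpos, le_div_iff₀ hxr]; linarith
    rw [hsum.unique (hasSum_sum_of_ne_finset_zero h0), mul_sum]
    refine sum_congr rfl fun n hn => ?_
    rw [mem_Ioc] at hn
    rw [hGint n hn.1, max_eq_left]
    · have := Real.pi_pos.ne'
      have : (x : ℂ) ≠ 0 := by exact_mod_cast hxr.ne'
      push_cast
      field_simp
    · have : (n : ℝ) ≤ x := by exact_mod_cast hn.2
      rw [sub_nonneg, div_le_iff₀ hxr]; linarith
  have hGs : ∀ y, ‖∑' n, G n y‖ ≤ (x : ℝ) ^ c * K * ((|y| + 4) ^ ((1 : ℝ) / 2) * (1 + y ^ 2)⁻¹) := fun y => by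
    have : ∑' n, G n y = LSeries a (c + y * I) * ((x : ℂ) ^ ((c : ℂ) + y * I) * κ y) := by
      simp only [hG]
      rw [tsum_mul_right]; rfl
    rw [this, norm_mul, norm_mul, hxn]
    calc _ ≤ (K * (|y| + 4) ^ ((1 : ℝ) / 2)) * ((x : ℝ) ^ c * (1 + y ^ 2)⁻¹) := by
          gcongr
          · exact h y
          · exact norm_hatKernel_mellin_le hc y
      _ = _ := by ring
  have hI : ‖∫ y, ∑' n, G n y‖ ≤ (x : ℝ) ^ c * K * ∫ y : ℝ, (|y| + 4) ^ ((1 : ℝ) / 2) * (1 + y ^ 2)⁻¹ := by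
    rw [← integral_const_mul]
    exact norm_integral_le_of_norm_le (integrable_rpow_div.const_mul _) (Filter.Eventually.of_forall hGs)
  have hI0 : 0 ≤ ∫ y : ℝ, (|y| + 4) ^ ((1 : ℝ) / 2) * (1 + y ^ 2)⁻¹ :=
    integral_nonneg fun y => by positivity
  rw [hval, norm_mul]
  have hn : ‖(x : ℂ) / (2 * Real.pi)‖ ≤ x := by
    rw [norm_div, Complex.norm_natCast, norm_mul, norm_real, Real.norm_of_nonneg Real.pi_pos.le]
    refine div_le_self hxr.le ?_
    have := Real.pi_gt_three
    simp; linarith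
  calc _ ≤ (x : ℝ) * ((x : ℝ) ^ c * K * ∫ y : ℝ, (|y| + 4) ^ ((1 : ℝ) / 2) * (1 + y ^ 2)⁻¹) := by gcongr
    _ = _ := by rw [Real.rpow_add_one hxr.ne']; ring

end

section

private lemma norm_sum_le_of_norm_sum_mul_sub_le (a : ℕ → ℂ) {x h : ℕ} {K M : ℝ} (hh : 0 < h) (hhx : h ≤ x)
    (hK : 0 ≤ K)
    (h1 : ‖∑ n ∈ Ioc 0 x, a n * ((x : ℂ) - n)‖ ≤ K * x ^ 2)
    (h2 : ‖∑ n ∈ Ioc 0 (x + h), a n * (((x + h : ℕ) : ℂ) - n)‖ ≤ K * (x + h : ℕ) ^ 2)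
    (hM : ∀ n ∈ Ioc x (x + h), ‖a n‖ ≤ M) :
    ‖∑ n ∈ Ioc 0 x, a n‖ ≤ 5 * K * x ^ 2 / h + h * M := by
  have hhr : (0 : ℝ) < h := by exact_mod_cast hh
  have hhx' : (h : ℝ) ≤ x := by exact_mod_cast hhx
  have key : (h : ℂ) * ∑ n ∈ Ioc 0 x, a n = ∑ n ∈ Ioc 0 (x + h), a n * (((x + h : ℕ) : ℂ) - n)
      - ∑ n ∈ Ioc 0 x, a n * ((x : ℂ) - n) - ∑ n ∈ Ioc x (x + h), a n * (((x + h : ℕ) : ℂ) - n) := by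
    rw [← sum_Ioc_consecutive _ (Nat.zero_le x) (Nat.le_add_right x h), mul_sum, add_sub_right_comm,
      add_sub_cancel_right, ← sum_sub_distrib]
    refine sum_congr rfl fun n _ => ?_
    push_cast; ring
  have h3 : ‖∑ n ∈ Ioc x (x + h), a n * (((x + h : ℕ) : ℂ) - n)‖ ≤ h * (h * M) := by
    have : ∀ n ∈ Ioc x (x + h), ‖a n * (((x + h : ℕ) : ℂ) - n)‖ ≤ h * M := fun n hn => by
      have hm := hM n hn
      rw [mem_Ioc] at hn
      rw [norm_mul, ← Nat.cast_sub hn.2, Complex.norm_natCast, mul_comm]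
      have : ((x + h - n : ℕ) : ℝ) ≤ h := by exact_mod_cast (by omega)
      gcongr
    refine (norm_sum_le_of_le _ this).trans ?_
    simp
  have h4 : (h : ℝ) * ‖∑ n ∈ Ioc 0 x, a n‖ ≤ 5 * K * x ^ 2 + h * (h * M) := by
    rw [← Complex.norm_natCast, ← norm_mul, key]
    refine (norm_sub_le _ _).trans (add_le_add ((norm_sub_le _ _).trans ((add_le_add h2 h1).trans ?_)) (by simpa using h3))
    push_cast
    have : ((x : ℝ) + h) ^ 2 ≤ 4 * x ^ 2 := by nlinarith
    nlinarith
  have h5 : 5 * K * x ^ 2 / h + h * M = (5 * K * x ^ 2 + h * (h * M)) / h := by field_simp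
  rw [h5, le_div_iff₀ hhr]
  linarith

lemma norm_sum_Ioc_mul_le_of_antitoneOn (a : ℕ → ℂ) (g : ℕ → ℝ) {N x : ℕ} {G : ℝ}
    (hNx : N ≤ x) (hG : 0 ≤ G) (hA : ∀ t, N ≤ t → t ≤ x → ‖∑ n ∈ Ioc 0 t, a n‖ ≤ G)
    (hg : ∀ n, N < n → n < x → g (n + 1) ≤ g n) (hg0 : ∀ n, N < n → 0 ≤ g n) :
    ‖∑ n ∈ Ioc N x, a n * g n‖ ≤ 2 * G * g (N + 1) := by
  rcases hNx.eq_or_lt with rfl | hlt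
  · have := hg0 (N + 1) (by omega)
    simp only [Ioc_self, sum_empty, norm_zero]; positivity
  have key : ∀ t, N < t → t ≤ x →
      ‖∑ n ∈ Ioc N t, a n * g n - g t * ∑ n ∈ Ioc 0 t, a n‖ ≤ (2 * g (N + 1) - g t) * G := by
    intro t ht
    induction t, ht using Nat.le_induction with
    | base =>
      intro hx
      have e : ∑ n ∈ Ioc N (N + 1), a n * g n - g (N + 1) * ∑ n ∈ Ioc 0 (N + 1), a n
          = - (g (N + 1) * ∑ n ∈ Ioc 0 N, a n) := by
        rw [sum_Ioc_succ_top (Nat.zero_le N)]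
        simp
        ring
      have h0 := hg0 (N + 1) (by omega)
      rw [Nat.succ_eq_add_one, e, norm_neg, norm_mul, Complex.norm_real, Real.norm_of_nonneg h0]
      have := hA N le_rfl (by omega)
      nlinarith
    | succ t ht ih =>
      intro hx
      have e : ∑ n ∈ Ioc N (t + 1), a n * g n - g (t + 1) * ∑ n ∈ Ioc 0 (t + 1), a n
          = (∑ n ∈ Ioc N t, a n * g n - g t * ∑ n ∈ Ioc 0 t, a n)
            + ((g t - g (t + 1) : ℝ) : ℂ) * ∑ n ∈ Ioc 0 t, a n := by
        rw [sum_Ioc_succ_top (Nat.zero_le t), sum_Ioc_succ_top (by omega)]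
        push_cast
        ring
      have h0 : 0 ≤ g t - g (t + 1) := sub_nonneg.mpr (hg t (by omega) (by omega))
      rw [e]
      refine (norm_add_le _ _).trans ?_
      rw [norm_mul, Complex.norm_real, Real.norm_of_nonneg h0]
      have := hA t (by omega) (by omega)
      have := ih (by omega)
      nlinarith
  have h1 := key x hlt le_rfl
  have h2 := hA x hNx le_rfl
  have h0 := hg0 x hlt
  have h3 : ‖(g x : ℂ) * ∑ n ∈ Ioc 0 x, a n‖ ≤ g x * G := by
    rw [norm_mul, Complex.norm_real, Real.norm_of_nonneg h0]
    gcongr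
  have h4 := norm_add_le (∑ n ∈ Ioc N x, a n * g n - g x * ∑ n ∈ Ioc 0 x, a n) (g x * ∑ n ∈ Ioc 0 x, a n)
  rw [sub_add_cancel] at h4
  linarith

private lemma one_le_log_of_three_le {x : ℝ} (hx : 3 ≤ x) : 1 ≤ Real.log x := by
  rw [Real.le_log_iff_exp_le (by linarith)]
  linarith [Real.exp_one_lt_d9]

private lemma norm_sum_mul_log_pow_le (A : ℕ) {C : ℝ} (hC : 0 ≤ C) :
    ∃ C1 : ℝ, 0 < C1 ∧ ∀ (f : ℕ → ℂ) (K : ℝ), 0 ≤ K →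
      (∀ n, 1 ≤ n → ‖f n‖ ≤ C * (1 + Real.log n)) →
      (∀ c : ℝ, 1 < c → LSeriesSummable (fun n => f n * (Real.log n) ^ (2 * A + 1)) c) →
      (∀ c : ℝ, 1 < c → c ≤ 2 → ∀ y : ℝ,
        ‖LSeries (fun n => f n * (Real.log n) ^ (2 * A + 1)) (c + y * Complex.I)‖
          ≤ K * (|y| + 4) ^ ((1 : ℝ) / 2)) →
      ∀ x : ℕ, 3 ≤ x → ‖∑ n ∈ Ioc 0 x, f n * (Real.log n) ^ (2 * A + 1)‖
        ≤ C1 * (1 + K) * x * Real.log x ^ (A + 1) := by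
  set I0 : ℝ := ∫ y : ℝ, (|y| + 4) ^ ((1 : ℝ) / 2) * (1 + y ^ 2)⁻¹ with hI0
  have hI0n : 0 ≤ I0 := MeasureTheory.integral_nonneg fun y => by positivity
  refine ⟨5 * I0 * Real.exp 1 + 3 * C * 2 ^ (2 * A + 1) * (1 + (A + 1).factorial) + 1, by positivity, ?_⟩
  intro f K hK hf hs hL x hx
  set a : ℕ → ℂ := fun n => f n * (Real.log n) ^ (2 * A + 1) with ha
  have hT : ∀ t : ℕ, 3 ≤ t → ‖∑ n ∈ Ioc 0 t, a n * ((t : ℂ) - n)‖ ≤ I0 * K * Real.exp 1 * t ^ 2 := by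
    intro t ht
    have htr : (3 : ℝ) ≤ t := by exact_mod_cast ht
    have hl := one_le_log_of_three_le htr
    have hc : 1 < 1 + 1 / Real.log t := by
      have : 0 < 1 / Real.log t := by positivity
      linarith
    have hc2 : 1 + 1 / Real.log t ≤ 2 := by
      have : 1 / Real.log t ≤ 1 := (div_le_one (by linarith)).mpr hl
      linarith
    have := norm_sum_mul_sub_le a hc hK (hs _ hc) (hL _ hc hc2) t (by omega)
    refine this.trans (le_of_eq ?_)
    have e : (t : ℝ) ^ (1 + 1 / Real.log t + 1) = Real.exp 1 * t ^ 2 := by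
      have : 1 + 1 / Real.log t + 1 = 1 / Real.log t + (2 : ℕ) := by push_cast; ring
      rw [this, Real.rpow_add_natCast (by linarith), Real.rpow_def_of_pos (by linarith), mul_one_div,
        div_self (by linarith)]
    rw [e]; ring
  have hxr : (3 : ℝ) ≤ x := by exact_mod_cast hx
  have hl := one_le_log_of_three_le hxr
  set l := Real.log x with hl_def
  have hlj : 1 ≤ l ^ (A + 1) := one_le_pow₀ hl
  have hlj0 : 0 < l ^ (A + 1) := by linarith
  set h := ⌈(x : ℝ) / l ^ (A + 1)⌉₊ with hh
  have hh1 : (x : ℝ) / l ^ (A + 1) ≤ h := Nat.le_ceil _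
  have hh2 : (h : ℝ) ≤ x / l ^ (A + 1) + 1 := (Nat.ceil_lt_add_one (by positivity)).le
  have hq : 0 < (x : ℝ) / l ^ (A + 1) := by positivity
  have hh0 : 0 < h := by exact_mod_cast hq.trans_le hh1
  have hhx : h ≤ x := Nat.ceil_le.mpr (div_le_self (by positivity) hlj)
  have hfac : l ^ (A + 1) ≤ (A + 1).factorial * x := by
    have := Real.pow_div_factorial_le_exp (x := l) (by linarith) (A + 1)
    rw [div_le_iff₀ (by positivity), hl_def, Real.exp_log (by linarith)] at this
    linarith
  have hM : ∀ n ∈ Ioc x (x + h), ‖a n‖ ≤ 3 * C * 2 ^ (2 * A + 1) * (l ^ (A + 1) * l ^ (A + 1)) := by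
    intro n hn
    rw [mem_Ioc] at hn
    have hn0 : (0 : ℝ) < n := by exact_mod_cast (by omega)
    have hn1 : (1 : ℝ) ≤ n := by exact_mod_cast (by omega)
    have hn2 : (n : ℝ) ≤ x ^ 2 := by
      have : (n : ℝ) ≤ 2 * x := by exact_mod_cast (by omega)
      nlinarith
    have hln : Real.log n ≤ 2 * l := by
      have := Real.log_le_log hn0 hn2
      rw [Real.log_pow] at this
      exact_mod_cast this
    have hln0 : 0 ≤ Real.log n := Real.log_nonneg hn1
    have hp : ‖((Real.log n : ℂ)) ^ (2 * A + 1)‖ = Real.log n ^ (2 * A + 1) := by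
      rw [norm_pow, Complex.norm_real, Real.norm_of_nonneg hln0]
    simp only [ha]
    rw [norm_mul, hp]
    calc _ ≤ (C * (1 + Real.log n)) * (2 * l) ^ (2 * A + 1) := by
          gcongr
          exact hf n (by omega)
      _ ≤ (C * (3 * l)) * (2 * l) ^ (2 * A + 1) := by
          gcongr; linarith
      _ = _ := by ring
  have := norm_sum_le_of_norm_sum_mul_sub_le a hh0 hhx (K := I0 * K * Real.exp 1) (by positivity)
    (hT x hx) (hT (x + h) (by omega)) hM
  refine this.trans ?_
  have t1 : 5 * (I0 * K * Real.exp 1) * (x : ℝ) ^ 2 / h ≤ 5 * I0 * Real.exp 1 * K * x * l ^ (A + 1) := by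
    have hhr : (0 : ℝ) < h := by exact_mod_cast hh0
    rw [div_le_iff₀ hhr]
    rw [div_le_iff₀ hlj0] at hh1
    calc 5 * (I0 * K * Real.exp 1) * (x : ℝ) ^ 2 = 5 * I0 * Real.exp 1 * K * x * x := by ring
      _ ≤ 5 * I0 * Real.exp 1 * K * x * (h * l ^ (A + 1)) := by gcongr
      _ = _ := by ring
  have t2 : (h : ℝ) * (3 * C * 2 ^ (2 * A + 1) * (l ^ (A + 1) * l ^ (A + 1)))
      ≤ 3 * C * 2 ^ (2 * A + 1) * (1 + (A + 1).factorial) * x * l ^ (A + 1) := by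
    have : (h : ℝ) * l ^ (A + 1) ≤ (1 + (A + 1).factorial) * x := by
      calc (h : ℝ) * l ^ (A + 1) ≤ (x / l ^ (A + 1) + 1) * l ^ (A + 1) := by gcongr
        _ = x + l ^ (A + 1) := by field_simp
        _ ≤ _ := by linarith
    calc _ = (3 * C * 2 ^ (2 * A + 1)) * ((h : ℝ) * l ^ (A + 1)) * l ^ (A + 1) := by ring
      _ ≤ (3 * C * 2 ^ (2 * A + 1)) * ((1 + (A + 1).factorial) * x) * l ^ (A + 1) := by gcongr
      _ = _ := by ring
  set P := 5 * I0 * Real.exp 1 with hP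
  set Q := 3 * C * 2 ^ (2 * A + 1) * (1 + ((A + 1).factorial : ℝ)) with hQ
  have hP0 : 0 ≤ P := by positivity
  have hQ0 : 0 ≤ Q := by positivity
  have hx0 : 0 < x * l ^ (A + 1) := by positivity
  calc _ ≤ (P * K + Q) * (x * l ^ (A + 1)) := by linarith
    _ ≤ ((P + Q + 1) * (1 + K)) * (x * l ^ (A + 1)) := by
      gcongr
      nlinarith [mul_nonneg hQ0 hK]
    _ = _ := by ring

/-- A quantitative Tauberian theorem: uniform bounds for a high derivative of a Dirichlet series up
to the line of absolute convergence give savings of powers of the logarithm. -/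
theorem exists_norm_sum_le_of_LSeries_le (A : ℕ) {C : ℝ} (hC : 0 ≤ C) :
    ∃ C1 : ℝ, 0 < C1 ∧ ∀ (f : ℕ → ℂ) (K : ℝ), 0 ≤ K →
      (∀ n, 1 ≤ n → ‖f n‖ ≤ C * (1 + Real.log n)) →
      (∀ c : ℝ, 1 < c → LSeriesSummable (fun n => f n * (Real.log n) ^ (2 * A + 1)) c) →
      (∀ c : ℝ, 1 < c → c ≤ 2 → ∀ y : ℝ,
        ‖LSeries (fun n => f n * (Real.log n) ^ (2 * A + 1)) (c + y * Complex.I)‖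
          ≤ K * (|y| + 4) ^ ((1 : ℝ) / 2)) →
      ∀ x : ℕ, 3 ≤ x → ‖∑ n ∈ Ioc 0 x, f n‖ ≤ C1 * (1 + K) * x / Real.log x ^ A := by
  obtain ⟨C2, hC2, h⟩ := norm_sum_mul_log_pow_le A hC
  refine ⟨2 * C * (2 ^ (A + 1) * (A + 1).factorial) + 2 * (C2 + 4 * C) * 2 ^ (2 * A + 1), by positivity, ?_⟩
  intro f K hK hf hs hL x hx
  have hB := h f K hK hf hs hL
  have hxr : (3 : ℝ) ≤ x := by exact_mod_cast hx
  have hl := one_le_log_of_three_le hxr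
  set l := Real.log x with hl_def
  have hl0 : 0 < l := by linarith
  set a : ℕ → ℂ := fun n => f n * (Real.log n) ^ (2 * A + 1) with ha
  set G := (C2 + 4 * C) * (1 + K) * (x * l ^ (A + 1)) with hG
  have hlj : 1 ≤ l ^ (A + 1) := one_le_pow₀ hl
  have hA : ∀ t, t ≤ x → ‖∑ n ∈ Ioc 0 t, a n‖ ≤ G := by
    intro t ht
    rcases Nat.lt_or_ge t 3 with h3 | h3
    · have h2 : ∀ n ∈ Ioc 0 t, ‖a n‖ ≤ 2 * C := fun n hn => by
        rw [mem_Ioc] at hn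
        have hn1 : (1 : ℝ) ≤ n := by exact_mod_cast hn.1
        have hn2 : (n : ℝ) ≤ 2 := by exact_mod_cast (by omega)
        have h0 : 0 ≤ Real.log n := Real.log_nonneg hn1
        have h1 : Real.log n ≤ 1 := by
          have := Real.log_le_sub_one_of_pos (by linarith : (0 : ℝ) < n)
          linarith
        simp only [ha]
        rw [norm_mul, norm_pow, Complex.norm_real, Real.norm_of_nonneg h0]
        calc _ ≤ (C * (1 + 1)) * 1 := by
              gcongr
              · exact (hf n hn.1).trans (by gcongr)
              · exact pow_le_one₀ h0 h1
          _ = _ := by ring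
      refine (norm_sum_le_of_le _ h2).trans ?_
      have ht2 : (t : ℝ) ≤ 2 := by exact_mod_cast (by omega)
      have : (1 : ℝ) ≤ (1 + K) * (x * l ^ (A + 1)) :=
        one_le_mul_of_one_le_of_one_le (by linarith) (one_le_mul_of_one_le_of_one_le (by linarith) hlj)
      simp only [sum_const, Nat.card_Ioc, nsmul_eq_mul, Nat.sub_zero]
      rw [hG, mul_assoc]
      calc (t : ℝ) * (2 * C) ≤ 2 * (2 * C) := by gcongr
        _ = 4 * C * 1 := by ring
        _ ≤ (C2 + 4 * C) * ((1 + K) * (x * l ^ (A + 1))) := by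
          gcongr; linarith
    · have htr : (3 : ℝ) ≤ t := by exact_mod_cast h3
      have htx : (t : ℝ) ≤ x := by exact_mod_cast ht
      have h1 := one_le_log_of_three_le htr
      have h2 : Real.log t ≤ l := Real.log_le_log (by linarith) htx
      refine (hB t h3).trans ?_
      calc C2 * (1 + K) * t * Real.log t ^ (A + 1) ≤ C2 * (1 + K) * x * l ^ (A + 1) := by gcongr
        _ = C2 * (1 + K) * (x * l ^ (A + 1)) := by ring
        _ ≤ _ := by
          rw [hG]
          gcongr
          linarith
  set N := Nat.sqrt x with hN
  have hN1 : 1 ≤ N := Nat.sqrt_pos.mpr (by omega)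
  have hNx : N ≤ x := Nat.sqrt_le_self x
  have hNe : (N : ℝ) ≤ Real.exp (l / 2) := by
    refine le_of_sq_le_sq ?_ (by positivity)
    rw [← Real.exp_nat_mul]
    push_cast
    rw [mul_div_cancel₀ _ two_ne_zero, hl_def, Real.exp_log (by linarith)]
    exact_mod_cast Nat.sqrt_le' x
  have hlogN : ∀ n, N < n → l / 2 ≤ Real.log n := fun n hn => by
    have h1 : x ≤ n ^ 2 := by
      have : n * n = n ^ 2 := by ring
      rw [← this]
      exact (Nat.sqrt_lt.mp hn).le
    have h2 : (x : ℝ) ≤ (n : ℝ) ^ 2 := by exact_mod_cast h1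
    have := Real.log_le_log (by linarith) h2
    rw [Real.log_pow] at this
    push_cast at this
    linarith
  rw [← sum_Ioc_consecutive _ (Nat.zero_le N) hNx]
  have hexp : 2 * l ^ (A + 1) * Real.exp (l / 2) ≤ 2 * (2 ^ (A + 1) * (A + 1).factorial) * x := by
    have := Real.pow_div_factorial_le_exp (x := l / 2) (by linarith) (A + 1)
    rw [div_le_iff₀ (by positivity), div_pow, div_le_iff₀ (by positivity)] at this
    calc _ ≤ 2 * (Real.exp (l / 2) * (A + 1).factorial * 2 ^ (A + 1)) * Real.exp (l / 2) := by gcongr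
      _ = 2 * (2 ^ (A + 1) * (A + 1).factorial) * (Real.exp (l / 2) * Real.exp (l / 2)) := by ring
      _ = _ := by
        rw [← Real.exp_add, add_halves, hl_def, Real.exp_log (by linarith)]
  have p1 : ‖∑ n ∈ Ioc 0 N, f n‖ ≤ 2 * C * (2 ^ (A + 1) * (A + 1).factorial) * x / l ^ A := by
    have : ∀ n ∈ Ioc 0 N, ‖f n‖ ≤ C * (2 * l) := fun n hn => by
      rw [mem_Ioc] at hn
      refine (hf n hn.1).trans ?_
      have hn1 : (1 : ℝ) ≤ n := by exact_mod_cast hn.1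
      have hn2 : (n : ℝ) ≤ x := by exact_mod_cast hn.2.trans hNx
      have : Real.log n ≤ l := Real.log_le_log (by linarith) hn2
      gcongr
      linarith
    refine (norm_sum_le_of_le _ this).trans ?_
    simp only [sum_const, Nat.card_Ioc, nsmul_eq_mul, Nat.sub_zero]
    rw [le_div_iff₀ (by positivity)]
    calc (N : ℝ) * (C * (2 * l)) * l ^ A ≤ Real.exp (l / 2) * (C * (2 * l)) * l ^ A := by gcongr
      _ = C * (2 * l ^ (A + 1) * Real.exp (l / 2)) := by ring
      _ ≤ C * (2 * (2 ^ (A + 1) * (A + 1).factorial) * x) := by gcongr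
      _ = _ := by ring
  have p2 : ‖∑ n ∈ Ioc N x, f n‖ ≤ 2 * (C2 + 4 * C) * 2 ^ (2 * A + 1) * (1 + K) * x / l ^ A := by
    set g : ℕ → ℝ := fun n => (Real.log n ^ (2 * A + 1))⁻¹ with hg
    have e : ∑ n ∈ Ioc N x, f n = ∑ n ∈ Ioc N x, a n * g n := by
      refine sum_congr rfl fun n hn => ?_
      rw [mem_Ioc] at hn
      have : (Real.log n : ℂ) ≠ 0 := by
        have := hlogN n hn.1
        exact_mod_cast (by linarith : 0 < Real.log n).ne'
      simp only [ha, hg]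
      rw [Complex.ofReal_inv, Complex.ofReal_pow, mul_assoc, mul_inv_cancel₀ (pow_ne_zero _ this), mul_one]
    have hlp : ∀ n, N < n → 0 < Real.log n := fun n hn => by
      have := hlogN n hn
      linarith
    rw [e]
    refine (norm_sum_Ioc_mul_le_of_antitoneOn a g hNx (by positivity) (fun t _ ht => hA t ht)
      (fun n hn _ => ?_) (fun n hn => ?_)).trans ?_
    · have h1 := hlp n hn
      simp only [hg]
      have hn0 : (0 : ℝ) < n := by exact_mod_cast (by omega)
      have : Real.log n ≤ Real.log (n + 1 : ℕ) := Real.log_le_log hn0 (by push_cast; linarith)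
      gcongr
    · have := hlp n hn
      simp only [hg]; positivity
    · have h1 : g (N + 1) ≤ 2 ^ (2 * A + 1) / l ^ (2 * A + 1) := by
        simp only [hg]
        rw [← div_pow, ← inv_div, inv_pow]
        have := hlogN (N + 1) (by omega)
        gcongr
      calc 2 * G * g (N + 1) ≤ 2 * G * (2 ^ (2 * A + 1) / l ^ (2 * A + 1)) := by gcongr
        _ = _ := by
          rw [hG]
          field_simp
          ring
  refine (norm_add_le _ _).trans ((add_le_add p1 p2).trans ?_)
  rw [← add_div]
  refine div_le_div_of_nonneg_right ?_ (by positivity)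
  have : 0 ≤ 2 * C * (2 ^ (A + 1) * (A + 1).factorial) * x * K := by positivity
  linarith
end

section

private lemma iterate_logMul (f : ℕ → ℂ) (k n : ℕ) :
    (LSeries.logMul^[k] f) n = f n * (Real.log n : ℂ) ^ k := by
  induction k generalizing f with
  | zero => simp
  | succ k ih =>
    rw [Function.iterate_succ_apply, ih]
    simp only [LSeries.logMul]
    rw [← Complex.natCast_log]
    ring

theorem exists_norm_sum_le_of_iteratedDeriv_le (A : ℕ) {C : ℝ} (hC : 0 ≤ C) :
    ∃ C1 : ℝ, 0 < C1 ∧ ∀ (f : ℕ → ℂ) (H : ℂ → ℂ) (K : ℝ), 0 ≤ K →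
      (∀ n, 1 ≤ n → ‖f n‖ ≤ C * (1 + Real.log n)) →
      (∀ s : ℂ, 1 < s.re → LSeriesSummable f s) →
      (∀ s : ℂ, 1 < s.re → LSeries f s = H s) →
      (∀ s : ℂ, 1 < s.re → s.re ≤ 2 →
        ‖iteratedDeriv (2 * A + 1) H s‖ ≤ K * (|s.im| + 4) ^ ((1 : ℝ) / 2)) →
      ∀ x : ℕ, 3 ≤ x → ‖∑ n ∈ Ioc 0 x, f n‖ ≤ C1 * (1 + K) * x / Real.log x ^ A := by
  obtain ⟨C1, hC1, h⟩ := exists_norm_sum_le_of_LSeries_le A hC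
  refine ⟨C1, hC1, fun f H K hK hf hs hfH hH => ?_⟩
  have habs : LSeries.abscissaOfAbsConv f ≤ 1 :=
    LSeries.abscissaOfAbsConv_le_of_forall_lt_LSeriesSummable' (x := 1) fun y hy =>
      hs y (by simpa using (by exact_mod_cast hy))
  have hlt : ∀ s : ℂ, 1 < s.re → LSeries.abscissaOfAbsConv f < s.re := fun s hs =>
    habs.trans_lt (by exact_mod_cast hs)
  have hfun : (fun n : ℕ => f n * (Real.log n : ℂ) ^ (2 * A + 1)) = LSeries.logMul^[2 * A + 1] f := by
    funext n
    exact (iterate_logMul f _ n).symm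
  refine h f K hK hf (fun c hc => ?_) (fun c hc hc2 y => ?_)
  · rw [hfun]
    refine LSeriesSummable_of_abscissaOfAbsConv_lt_re ?_
    rw [LSeries.absicssaOfAbsConv_logPowMul]
    exact hlt c (by simpa using hc)
  · rw [hfun]
    set s : ℂ := c + y * Complex.I
    have hre : s.re = c := by simp [s]
    have him : s.im = y := by simp [s]
    have h1 := LSeries_iteratedDeriv (2 * A + 1) (hlt s (by rwa [hre]))
    have h2 : iteratedDeriv (2 * A + 1) (LSeries f) s = iteratedDeriv (2 * A + 1) H s := by
      refine Filter.EventuallyEq.iteratedDeriv_eq _ ?_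
      filter_upwards [(isOpen_lt continuous_const Complex.continuous_re).mem_nhds
        (show (1 : ℝ) < s.re by rwa [hre])] with z hz using hfH z hz
    have h3 : ‖LSeries (LSeries.logMul^[2 * A + 1] f) s‖ = ‖iteratedDeriv (2 * A + 1) H s‖ := by
      rw [← h2, h1]; simp
    rw [h3, ← him]
    exact hH s (by rwa [hre]) (by rwa [hre])

private lemma anaCond_rpow_le (q : ℕ) (s : ℂ) {η : ℝ} (hη : η ≤ 1 / 2) :
    anaCond q s ^ η ≤ (q : ℝ) ^ η * (|s.im| + 4) ^ ((1 : ℝ) / 2) := by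
  rw [anaCond, Real.mul_rpow (by positivity) (by positivity)]
  have : (|s.im| + 4) ^ η ≤ (|s.im| + 4) ^ ((1 : ℝ) / 2) :=
    Real.rpow_le_rpow_of_exponent_le (by linarith [abs_nonneg s.im]) hη
  gcongr

end

namespace ArithmeticFunction

/-- The Siegel-Walfisz theorem for sums of the von Mangoldt function against primitive characters. -/
theorem exists_norm_sum_twist_vonMangoldt_le (A B : ℕ) (hB : 2 ≤ B) :
    ∃ C : ℝ, 0 < C ∧ ∀ x : ℕ, 3 ≤ x → ∀ (q : ℕ) [NeZero q] (χ : DirichletCharacter ℂ q),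
      χ.IsPrimitive → χ ≠ 1 → (q : ℝ) ≤ Real.log x ^ B →
      ‖∑ n ∈ Ioc 0 x, twist χ vonMangoldt n‖ ≤ C * x / Real.log x ^ A := by
  obtain ⟨C1, hC1, h⟩ := exists_norm_sum_le_of_iteratedDeriv_le (A + 1) (zero_le_one (α := ℝ))
  have hBr : (2 : ℝ) ≤ B := by exact_mod_cast hB
  have hη : (0 : ℝ) < 1 / B := by positivity
  have hη2 : (1 : ℝ) / B ≤ 1 / 2 := one_div_le_one_div_of_le (by norm_num) hBr
  obtain ⟨D, hD, hd⟩ := DirichletCharacter.exists_norm_iteratedDeriv_logDeriv_le hη (2 * (A + 1) + 1)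
  refine ⟨C1 * (1 + D), by positivity, fun x hx q _ χ hp hχ hq => ?_⟩
  have hxr : (3 : ℝ) ≤ x := by exact_mod_cast hx
  have hl : 1 ≤ Real.log x := by
    rw [Real.le_log_iff_exp_le (by linarith)]
    linarith [Real.exp_one_lt_d9]
  have hqp : (0 : ℝ) < q := by exact_mod_cast NeZero.pos q
  have hK : (q : ℝ) ^ ((1 : ℝ) / B) ≤ Real.log x := by
    calc (q : ℝ) ^ ((1 : ℝ) / B) ≤ (Real.log x ^ B) ^ ((1 : ℝ) / B) := by gcongr
      _ = Real.log x := by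
        rw [one_div, Real.pow_rpow_inv_natCast (by linarith) (by omega)]
  have := h (fun n => twist χ vonMangoldt n) (fun s => - logDeriv (DirichletCharacter.LFunction χ) s)
    (D * (q : ℝ) ^ ((1 : ℝ) / B)) (by positivity) (fun n hn => ?_) (fun s hs => ?_) (fun s hs => ?_)
    (fun s hs hs2 => ?_) x hx
  · refine this.trans ?_
    have hp : Real.log x ^ A ≠ 0 := by positivity
    calc _ ≤ C1 * (Real.log x + D * Real.log x) * x / Real.log x ^ (A + 1) := by gcongr
      _ = _ := by
        rw [pow_succ]
        field_simp
  · refine (norm_twist_le χ vonMangoldt n).trans ?_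
    rw [abs_of_nonneg vonMangoldt_nonneg, one_mul]
    exact vonMangoldt_le_log.trans (by linarith)
  · refine (LSeriesSummable_congr s fun {n} _ => ?_).mp (DirichletCharacter.LSeriesSummable_twist_vonMangoldt χ hs)
    simp [twist_apply, mul_comm]
  · have h1 := DirichletCharacter.LSeries_twist_vonMangoldt_eq χ hs
    have h2 : LSeries (fun n => twist χ vonMangoldt n) s
        = LSeries ((fun n : ℕ => χ n) * fun n : ℕ => ((vonMangoldt n : ℝ) : ℂ)) s :=
      LSeries_congr (fun {n} _ => by simp [twist_apply, mul_comm]) s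
    rw [h2, h1, logDeriv_apply, DirichletCharacter.deriv_LFunction_eq_deriv_LSeries χ hs,
      DirichletCharacter.LFunction_eq_LSeries χ hs, neg_div]
  · rw [iteratedDeriv_fun_neg, norm_neg, mul_assoc]
    refine (hd q χ hp hχ s hs hs2).trans ?_
    gcongr
    exact anaCond_rpow_le q s hη2

/-- The prime number theorem with an arbitrary power of the logarithm saved. -/
theorem exists_abs_sum_vonMangoldt_sub_le (A : ℕ) :
    ∃ C : ℝ, 0 < C ∧ ∀ x : ℕ, 3 ≤ x →
      |∑ n ∈ Ioc 0 x, vonMangoldt n - x| ≤ C * x / Real.log x ^ A := by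
  obtain ⟨C1, hC1, h⟩ := exists_norm_sum_le_of_iteratedDeriv_le A (zero_le_one (α := ℝ))
  obtain ⟨D, hD, hd⟩ := exists_norm_iteratedDeriv_logDeriv_riemannZeta_add_le (η := 1 / 2) (by norm_num) (2 * A + 1)
  refine ⟨C1 * (1 + D), by positivity, fun x hx => ?_⟩
  have hsum1 : ∀ s : ℂ, 1 < s.re → LSeriesSummable (fun n => ((vonMangoldt n : ℝ) : ℂ)) s :=
    fun s hs => LSeriesSummable_vonMangoldt hs
  have hsum2 : ∀ s : ℂ, 1 < s.re → LSeriesSummable (1 : ℕ → ℂ) s :=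
    fun s hs => LSeriesSummable_one_iff.mpr hs
  have := h (fun n => ((vonMangoldt n : ℝ) : ℂ) - 1)
    (fun s => - (logDeriv riemannZeta s + riemannZeta s)) D hD.le (fun n hn => ?_) (fun s hs => ?_)
    (fun s hs => ?_) (fun s hs hs2 => ?_) x hx
  · have e : ∑ n ∈ Ioc 0 x, (((vonMangoldt n : ℝ) : ℂ) - 1) = ((∑ n ∈ Ioc 0 x, vonMangoldt n - x : ℝ) : ℂ) := by
      rw [sum_sub_distrib]; push_cast; simp
    rwa [e, Complex.norm_real, Real.norm_eq_abs] at this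
  · have h0 : 0 ≤ Real.log n := Real.log_natCast_nonneg n
    have e : ((vonMangoldt n : ℝ) : ℂ) - 1 = ((vonMangoldt n - 1 : ℝ) : ℂ) := by push_cast; rfl
    rw [e, Complex.norm_real, Real.norm_eq_abs, abs_le]
    have h1 : vonMangoldt n ≤ Real.log n := vonMangoldt_le_log
    have h2 : 0 ≤ vonMangoldt n := vonMangoldt_nonneg
    constructor <;> linarith
  · exact (hsum1 s hs).sub (hsum2 s hs)
  · have h1 := LSeries_sub (hsum1 s hs) (hsum2 s hs)
    have h2 := LSeries_vonMangoldt_eq_deriv_riemannZeta_div hs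
    have h3 := LSeries_one_eq_riemannZeta hs
    have e : (fun n : ℕ => ((vonMangoldt n : ℝ) : ℂ) - 1)
      = (fun n : ℕ => ((vonMangoldt n : ℝ) : ℂ)) - (1 : ℕ → ℂ) := rfl
    rw [e, h1, h2, h3, logDeriv_apply]
    ring
  · rw [iteratedDeriv_fun_neg, norm_neg]
    refine (hd s hs hs2).trans ?_
    have := anaCond_rpow_le 1 s (le_refl ((1 : ℝ) / 2))
    simp only [Nat.cast_one, Real.one_rpow, one_mul] at this
    gcongr

end ArithmeticFunction

section

lemma one_div_card_add_one_le_prod (s : Finset ℕ) (hs : ∀ p ∈ s, 2 ≤ p) :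
    (1 : ℝ) / (s.card + 1) ≤ ∏ p ∈ s, (1 - (p : ℝ)⁻¹) := by
  induction s using Finset.induction_on_max with
  | empty => simp
  | insert a s ha ih =>
    have hnot : a ∉ s := fun h => (ha a h).false
    have hcard : s.card + 2 ≤ a := by
      have h2 : 2 ≤ a := hs a (mem_insert_self a s)
      have : s ⊆ Ico 2 a := fun p hp => mem_Ico.mpr ⟨hs p (mem_insert_of_mem hp), ha p hp⟩
      have := card_le_card this
      rw [Nat.card_Ico] at this
      omega
    have hcr : (s.card : ℝ) + 2 ≤ a := by exact_mod_cast hcard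
    rw [prod_insert hnot, card_insert_of_notMem hnot]
    have ih' := ih fun p hp => hs p (mem_insert_of_mem hp)
    have h1 : (a : ℝ)⁻¹ ≤ ((s.card : ℝ) + 2)⁻¹ := inv_anti₀ (by positivity) hcr
    have h2 : ((s.card : ℝ) + 2)⁻¹ ≤ 1 := inv_le_one_of_one_le₀ (by linarith [Nat.cast_nonneg (α := ℝ) s.card])
    calc (1 : ℝ) / ((s.card + 1 : ℕ) + 1) = (1 - ((s.card : ℝ) + 2)⁻¹) * (1 / (s.card + 1)) := by
          push_cast
          field_simp
          ring
      _ ≤ _ := mul_le_mul (by linarith) ih' (by positivity) (by linarith)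

lemma one_div_totient_le (m : ℕ) (hm : 0 < m) :
    (1 : ℝ) / m.totient ≤ (1 + 2 * Real.log m) / m := by
  have hmr : (0 : ℝ) < m := by exact_mod_cast hm
  have hφ : (0 : ℝ) < m.totient := by exact_mod_cast Nat.totient_pos.mpr hm
  have h1 : (m.totient : ℝ) = m * ∏ p ∈ m.primeFactors, (1 - (p : ℝ)⁻¹) := by
    have := congrArg (fun t : ℚ => (t : ℝ)) (Nat.totient_eq_mul_prod_factors m)
    push_cast at this
    exact this
  have h2 := one_div_card_add_one_le_prod m.primeFactors fun p hp => (Nat.prime_of_mem_primeFactors hp).two_le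
  have h3 : (m.primeFactors.card : ℝ) ≤ 2 * Real.log m := by
    have h4 : 2 ^ m.primeFactors.card ≤ m :=
      (pow_card_le_prod _ _ _ fun p hp => (Nat.prime_of_mem_primeFactors hp).two_le).trans
        (Nat.le_of_dvd hm (Nat.prod_primeFactors_dvd m))
    have h5 : (2 : ℝ) ^ m.primeFactors.card ≤ m := by exact_mod_cast h4
    have h6 := Real.log_le_log (by positivity) h5
    rw [Real.log_pow] at h6
    have := Real.log_two_gt_d9
    nlinarith [Nat.cast_nonneg (α := ℝ) m.primeFactors.card]
  have hc : (0 : ℝ) < m.primeFactors.card + 1 := by positivity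
  rw [div_le_div_iff₀ hφ hmr, h1]
  have h7 : 1 ≤ (1 + 2 * Real.log m) * ∏ p ∈ m.primeFactors, (1 - (p : ℝ)⁻¹) := by
    rw [div_le_iff₀ hc] at h2
    have h0 : 0 ≤ ∏ p ∈ m.primeFactors, (1 - (p : ℝ)⁻¹) := by
      by_contra h
      push Not at h
      nlinarith
    nlinarith
  nlinarith

end

namespace ArithmeticFunction

private noncomputable def nonCoprimeSum (z m : ℕ) : ℝ :=
  ∑ n ∈ (Ioc 0 z).filter (fun n => ¬ n.Coprime m), vonMangoldt n

lemma nonCoprimeSum_le (z m : ℕ) (hm : 0 < m) :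
    nonCoprimeSum z m ≤ m * (2 * Real.log z + 1) * Real.log z := by
  classical
  rcases Nat.eq_zero_or_pos z with rfl | hz
  · simp [nonCoprimeSum]
  have hzr : (1 : ℝ) ≤ z := by exact_mod_cast hz
  have hl : 0 ≤ Real.log z := Real.log_nonneg hzr
  set S := (Icc 1 m ×ˢ range (Nat.log 2 z + 1)).image fun pk : ℕ × ℕ => pk.1 ^ pk.2 with hS
  have hsub : ((Ioc 0 z).filter (fun n => ¬ n.Coprime m)).filter (fun n => vonMangoldt n ≠ 0) ⊆ S := by
    intro n hn
    rw [mem_filter, mem_filter, mem_Ioc, vonMangoldt_ne_zero_iff, isPrimePow_nat_iff] at hn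
    obtain ⟨⟨⟨hn0, hnz⟩, hco⟩, p, k, hp, hk, rfl⟩ := hn
    refine mem_image.mpr ⟨(p, k), mem_product.mpr ⟨mem_Icc.mpr ⟨hp.one_le, ?_⟩, mem_range.mpr ?_⟩, rfl⟩
    · refine Nat.le_of_dvd hm ?_
      by_contra h
      exact hco (Nat.Coprime.pow_left k ((Nat.Prime.coprime_iff_not_dvd hp).mpr h))
    · have : 2 ^ k ≤ z := (Nat.pow_le_pow_left hp.two_le k).trans hnz
      have := Nat.le_log_of_pow_le (by norm_num) this
      omega
  have hb : ∀ n ∈ ((Ioc 0 z).filter (fun n => ¬ n.Coprime m)).filter (fun n => vonMangoldt n ≠ 0),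
      vonMangoldt n ≤ Real.log z := fun n hn => by
    rw [mem_filter, mem_filter, mem_Ioc] at hn
    refine vonMangoldt_le_log.trans (Real.log_le_log (by exact_mod_cast hn.1.1.1) (by exact_mod_cast hn.1.1.2))
  have hlog : (Nat.log 2 z : ℝ) ≤ 2 * Real.log z := by
    have h1 : (2 : ℝ) ^ Nat.log 2 z ≤ z := by exact_mod_cast Nat.pow_log_le_self 2 hz.ne'
    have h6 := Real.log_le_log (by positivity) h1
    rw [Real.log_pow] at h6
    have := Real.log_two_gt_d9
    nlinarith [Nat.cast_nonneg (α := ℝ) (Nat.log 2 z)]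
  unfold nonCoprimeSum
  rw [← sum_filter_ne_zero]
  refine (sum_le_card_nsmul _ _ _ hb).trans ?_
  rw [nsmul_eq_mul]
  gcongr
  have hc : (((Ioc 0 z).filter (fun n => ¬ n.Coprime m)).filter (fun n => vonMangoldt n ≠ 0)).card
      ≤ m * (Nat.log 2 z + 1) := by
    refine (card_le_card hsub).trans (card_image_le.trans ?_)
    rw [card_product, Nat.card_Icc, card_range]
    simp
  calc _ ≤ ((m * (Nat.log 2 z + 1) : ℕ) : ℝ) := by exact_mod_cast hc
    _ ≤ _ := by push_cast; gcongr

/-- The sum of the absolute values of the twisted Chebyshev functions over primitive characters. -/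
noncomputable def primCharSum (z q : ℕ) : ℝ :=
  ∑ χ ∈ primChars q, ‖∑ n ∈ Ioc 0 z, twist χ vonMangoldt n‖

lemma primCharSum_nonneg (z q : ℕ) : 0 ≤ primCharSum z q := sum_nonneg fun _ _ => norm_nonneg _

private lemma norm_sum_sub_primitiveCharacter_le (z m : ℕ) (χ : DirichletCharacter ℂ m) :
    ‖∑ n ∈ Ioc 0 z, χ n * (vonMangoldt n : ℂ) - ∑ n ∈ Ioc 0 z, twist χ.primitiveCharacter vonMangoldt n‖
      ≤ nonCoprimeSum z m := by
  rw [← sum_sub_distrib, nonCoprimeSum, sum_filter]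
  refine norm_sum_le_of_le _ fun n _ => ?_
  by_cases h : n.Coprime m
  · have h1 : χ.primitiveCharacter (n : ZMod χ.conductor) = χ (n : ZMod m) := by
      have := DirichletCharacter.primitiveCharacter_apply_of_isCoprime χ (a := n)
        (Nat.isCoprime_iff_coprime.mpr h)
      simpa using this
    rw [if_neg (not_not.mpr h), twist_apply, h1, mul_comm, sub_self, norm_zero]
  · have h1 : χ (n : ZMod m) = 0 := χ.map_nonunit (by rwa [ZMod.isUnit_iff_coprime])
    rw [if_pos h, h1, zero_mul, zero_sub, norm_neg]
    refine (norm_twist_le _ _ _).trans ?_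
    rw [abs_of_nonneg vonMangoldt_nonneg]

private lemma sum_norm_primitiveCharacter_le (z m : ℕ) [DecidableEq (DirichletCharacter ℂ m)] (hm : 0 < m) :
    ∑ χ ∈ univ.erase (1 : DirichletCharacter ℂ m),
      ‖∑ n ∈ Ioc 0 z, twist χ.primitiveCharacter vonMangoldt n‖
      ≤ ∑ q ∈ m.divisors.filter (2 ≤ ·), primCharSum z q := by
  classical
  have : NeZero m := ⟨hm.ne'⟩
  unfold primCharSum
  rw [sum_sigma' (m.divisors.filter (2 ≤ ·)) (fun q => primChars q)
    (fun q χ => ‖∑ n ∈ Ioc 0 z, twist χ vonMangoldt n‖)]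
  set F : DirichletCharacter ℂ m → (Σ q : ℕ, DirichletCharacter ℂ q) :=
    fun χ => ⟨χ.conductor, χ.primitiveCharacter⟩ with hF
  set R : (Σ q : ℕ, DirichletCharacter ℂ q) → DirichletCharacter ℂ m :=
    fun x => if h : x.1 ∣ m then DirichletCharacter.changeLevel h x.2 else 1 with hR
  have hRF : Function.LeftInverse R F := fun χ => by
    simp only [hR, hF]
    rw [dif_pos χ.conductor_dvd_level]
    exact χ.changeLevel_primitiveCharacter
  rw [← sum_image (f := fun x : (Σ q : ℕ, DirichletCharacter ℂ q) => ‖∑ n ∈ Ioc 0 z, twist x.2 vonMangoldt n‖)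
    (g := F) (hRF.injective.injOn)]
  refine sum_le_sum_of_subset_of_nonneg (fun x hx => ?_) fun _ _ _ => norm_nonneg _
  obtain ⟨χ, hχ, rfl⟩ := mem_image.mp hx
  have hχ1 := (mem_erase.mp hχ).1
  rw [mem_sigma, mem_filter, Nat.mem_divisors]
  refine ⟨⟨⟨χ.conductor_dvd_level, hm.ne'⟩, ?_⟩, mem_primChars.mpr χ.primitiveCharacter_isPrimitive⟩
  have h0 : χ.conductor ≠ 0 := χ.conductor_ne_zero
  have h1 : χ.conductor ≠ 1 := fun h => hχ1 (DirichletCharacter.eq_one_iff_conductor_eq_one.mpr h)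
  simp only [hF]
  omega

lemma abs_psi_sub_le (z m a : ℕ) (hm : 0 < m) (ha : Nat.gcd a m = 1) :
    |psi z m a - z / (m.totient : ℝ)| ≤ 1 / (m.totient : ℝ) * (|∑ n ∈ Ioc 0 z, vonMangoldt n - z|
      + ∑ q ∈ m.divisors.filter (2 ≤ ·), primCharSum z q) + m * (2 * Real.log z + 1) * Real.log z := by
  classical
  have : NeZero m := ⟨hm.ne'⟩
  have hφ : (0 : ℝ) < m.totient := by exact_mod_cast Nat.totient_pos.mpr hm
  have hau : IsUnit (a : ZMod m) := (ZMod.isUnit_iff_coprime a m).mpr ha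
  set D := nonCoprimeSum z m with hD
  set S : DirichletCharacter ℂ m → ℂ := fun χ => ∑ n ∈ Ioc 0 z, χ n * (vonMangoldt n : ℂ) with hS
  have hexp : ((m.totient : ℝ) * psi z m a : ℂ) = ∑ χ : DirichletCharacter ℂ m, χ (a : ZMod m)⁻¹ * S χ := by
    have e1 : (Icc 1 ⌊(z : ℝ)⌋₊) = Ioc 0 z := by
      rw [Nat.floor_natCast]; rfl
    unfold psi
    rw [e1]
    simp only [hS, mul_sum]
    rw [sum_comm]
    push_cast
    rw [mul_sum]
    refine sum_congr rfl fun n _ => ?_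
    have h1 := DirichletCharacter.sum_char_inv_mul_char_eq ℂ hau (n : ZMod m)
    simp_rw [← mul_assoc]
    rw [← sum_mul, h1]
    by_cases h : n % m = a % m
    · rw [if_pos h, if_pos ((ZMod.natCast_eq_natCast_iff' a n m).mpr h.symm)]
    · rw [if_neg h, if_neg fun h' => h ((ZMod.natCast_eq_natCast_iff' a n m).mp h').symm]
      simp
  have hS1 : ‖S 1 - ((∑ n ∈ Ioc 0 z, vonMangoldt n : ℝ) : ℂ)‖ ≤ D := by
    simp only [hS]
    rw [Complex.ofReal_sum, ← sum_sub_distrib, hD, nonCoprimeSum, sum_filter]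
    refine norm_sum_le_of_le _ fun n _ => ?_
    by_cases h : n.Coprime m
    · rw [if_neg (not_not.mpr h), MulChar.one_apply ((ZMod.isUnit_iff_coprime n m).mpr h)]
      simp
    · rw [if_pos h, MulChar.map_nonunit _ (by rwa [ZMod.isUnit_iff_coprime]), zero_mul, zero_sub, norm_neg,
        Complex.norm_real, Real.norm_of_nonneg vonMangoldt_nonneg]
  have hrest : ‖∑ χ ∈ univ.erase (1 : DirichletCharacter ℂ m), χ (a : ZMod m)⁻¹ * S χ‖
      ≤ ∑ q ∈ m.divisors.filter (2 ≤ ·), primCharSum z q + (m.totient - 1) * D := by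
    have hle : ∀ χ ∈ univ.erase (1 : DirichletCharacter ℂ m), ‖χ (a : ZMod m)⁻¹ * S χ‖ ≤
        ‖∑ n ∈ Ioc 0 z, twist χ.primitiveCharacter vonMangoldt n‖ + D := fun χ _ => by
      rw [norm_mul]
      have h1 := DirichletCharacter.norm_le_one χ (a : ZMod m)⁻¹
      have h2 := norm_sum_sub_primitiveCharacter_le z m χ
      have h3 := norm_sub_norm_le (S χ) (∑ n ∈ Ioc 0 z, twist χ.primitiveCharacter vonMangoldt n)
      have h4 : ‖χ (a : ZMod m)⁻¹‖ * ‖S χ‖ ≤ 1 * ‖S χ‖ := by gcongr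
      linarith
    refine (norm_sum_le_of_le _ hle).trans ?_
    rw [sum_add_distrib]
    have hcard : ((univ.erase (1 : DirichletCharacter ℂ m)).card : ℝ) = m.totient - 1 := by
      rw [card_erase_of_mem (mem_univ _), card_univ, ← Nat.card_eq_fintype_card,
        DirichletCharacter.card_eq_totient_of_hasEnoughRootsOfUnity ℂ m,
        Nat.cast_sub (Nat.totient_pos.mpr hm)]
      simp
    rw [sum_const, nsmul_eq_mul, hcard]
    gcongr
    exact sum_norm_primitiveCharacter_le z m hm
  have hmain : |(m.totient : ℝ) * psi z m a - z| ≤ |∑ n ∈ Ioc 0 z, vonMangoldt n - z|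
      + ∑ q ∈ m.divisors.filter (2 ≤ ·), primCharSum z q + m.totient * D := by
    have e : (((m.totient : ℝ) * psi z m a - z : ℝ) : ℂ)
        = ((∑ n ∈ Ioc 0 z, vonMangoldt n - z : ℝ) : ℂ) + (S 1 - ((∑ n ∈ Ioc 0 z, vonMangoldt n : ℝ) : ℂ))
          + ∑ χ ∈ univ.erase (1 : DirichletCharacter ℂ m), χ (a : ZMod m)⁻¹ * S χ := by
      have h1 : (1 : DirichletCharacter ℂ m) (a : ZMod m)⁻¹ = 1 := by
        refine MulChar.one_apply ?_
        obtain ⟨u, hu⟩ := hau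
        rw [← hu, ZMod.inv_coe_unit]
        exact u⁻¹.isUnit
      rw [Complex.ofReal_sub, Complex.ofReal_mul, hexp, ← add_sum_erase _ _ (mem_univ (1 : DirichletCharacter ℂ m)), h1]
      push_cast
      ring
    rw [← Real.norm_eq_abs, ← Complex.norm_real, e]
    refine (norm_add_le _ _).trans ((add_le_add ((norm_add_le _ _).trans (add_le_add le_rfl hS1)) hrest).trans ?_)
    rw [Complex.norm_real, Real.norm_eq_abs]
    linarith
  have hDle := nonCoprimeSum_le z m hm
  have e2 : psi z m a - z / (m.totient : ℝ) = 1 / (m.totient : ℝ) * (m.totient * psi z m a - z) := by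
    field_simp
  rw [e2, abs_mul, abs_of_pos (by positivity)]
  calc _ ≤ 1 / (m.totient : ℝ) * (|∑ n ∈ Ioc 0 z, vonMangoldt n - z|
      + ∑ q ∈ m.divisors.filter (2 ≤ ·), primCharSum z q + m.totient * D) := by gcongr
    _ = 1 / (m.totient : ℝ) * (|∑ n ∈ Ioc 0 z, vonMangoldt n - z|
      + ∑ q ∈ m.divisors.filter (2 ≤ ·), primCharSum z q) + D := by field_simp
    _ ≤ _ := by gcongr

end ArithmeticFunction

section

lemma sum_Ioc_div_eq_abel (w : ℕ → ℝ) (Q R : ℕ) (hQR : Q ≤ R) :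
    ∑ q ∈ Ioc Q R, w q / q = (∑ q ∈ Ioc Q R, w q) / (R + 1)
      + ∑ r ∈ Ioc Q R, (∑ q ∈ Ioc Q r, w q) / ((r : ℝ) * (r + 1)) := by
  induction R, hQR using Nat.le_induction with
  | base => simp
  | succ R hR ih =>
    rw [sum_Ioc_succ_top (by omega), ih, sum_Ioc_succ_top (by omega) (fun r => _ / ((r : ℝ) * (r + 1))),
      sum_Ioc_succ_top (by omega) w]
    push_cast
    have h1 : (R : ℝ) + 1 ≠ 0 := by positivity
    have h2 : (R : ℝ) + 1 + 1 ≠ 0 := by positivity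
    field_simp
    ring

lemma sum_Ioc_one_div_mul_succ (Q R : ℕ) (hQR : Q ≤ R) :
    ∑ r ∈ Ioc Q R, 1 / ((r : ℝ) * (r + 1)) = 1 / (Q + 1) - 1 / (R + 1) := by
  induction R, hQR using Nat.le_induction with
  | base => simp
  | succ R hR ih =>
    rw [sum_Ioc_succ_top (by omega), ih]
    push_cast
    have h1 : (R : ℝ) + 1 ≠ 0 := by positivity
    have h2 : (R : ℝ) + 1 + 1 ≠ 0 := by positivity
    field_simp
    ring

lemma sum_Ioc_div_le_of_sum_le (w : ℕ → ℝ) (Q R : ℕ) {a b c d : ℝ} (ha : 0 ≤ a) (hb : 0 ≤ b)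
    (hc : 0 ≤ c) (hd : 0 ≤ d)
    (hS : ∀ r ≤ R, ∑ q ∈ Ioc Q r, w q ≤ a + b * r + c * r ^ 2 + d * r ^ 3) :
    ∑ q ∈ Ioc Q R, w q / q ≤ a / (Q + 1) + b * (2 + Real.log R) + 2 * c * R + 2 * d * R ^ 2 := by
  have hlR : 0 ≤ Real.log R := Real.log_natCast_nonneg R
  rcases lt_or_ge R Q with h | hQR
  · rw [Ioc_eq_empty (by omega), sum_empty]
    positivity
  rw [sum_Ioc_div_eq_abel w Q R hQR]
  have hR0 : (0 : ℝ) ≤ R := Nat.cast_nonneg R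
  have h1 : (∑ q ∈ Ioc Q R, w q) / (R + 1) ≤ a * (1 / (R + 1)) + b + c * R + d * R ^ 2 := by
    have := hS R le_rfl
    rw [div_le_iff₀ (by positivity)]
    have e : (a * (1 / ((R : ℝ) + 1)) + b + c * R + d * R ^ 2) * (R + 1)
        = a + b * (R + 1) + c * (R ^ 2 + R) + d * (R ^ 3 + R ^ 2) := by
      field_simp
    rw [e]
    nlinarith [mul_nonneg hc hR0, mul_nonneg hd (sq_nonneg (R : ℝ))]
  have h2 : ∑ r ∈ Ioc Q R, (∑ q ∈ Ioc Q r, w q) / ((r : ℝ) * (r + 1))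
      ≤ ∑ r ∈ Ioc Q R, (a * (1 / ((r : ℝ) * (r + 1))) + b * (1 / r) + c + d * R) := by
    refine sum_le_sum fun r hr => ?_
    rw [mem_Ioc] at hr
    have hr0 : (0 : ℝ) < r := by exact_mod_cast (by omega : 0 < r)
    have hrR : (r : ℝ) ≤ R := by exact_mod_cast hr.2
    have := hS r hr.2
    rw [div_le_iff₀ (by positivity)]
    have e : (a * (1 / ((r : ℝ) * (r + 1))) + b * (1 / r) + c + d * R) * ((r : ℝ) * (r + 1))
        = a + b * (r + 1) + c * (r ^ 2 + r) + d * R * (r ^ 2 + r) := by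
      field_simp
    rw [e]
    have : d * r * r ^ 2 ≤ d * R * r ^ 2 := by gcongr
    have : 0 ≤ d * R * r := by positivity
    nlinarith [mul_nonneg hc hr0.le]
  have h3 : ∑ r ∈ Ioc Q R, 1 / (r : ℝ) ≤ 1 + Real.log R := by
    refine le_trans (sum_le_sum_of_subset_of_nonneg (Ioc_subset_Ioc_left (Nat.zero_le Q))
      fun _ _ _ => by positivity) (sum_Ioc_inv_le R)
  have hcard : (((Ioc Q R).card : ℕ) : ℝ) ≤ R := by
    rw [Nat.card_Ioc]
    exact_mod_cast Nat.sub_le R Q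
  have h4 : ∑ r ∈ Ioc Q R, (a * (1 / ((r : ℝ) * (r + 1))) + b * (1 / r) + c + d * R)
      ≤ a * (1 / (Q + 1) - 1 / (R + 1)) + b * (1 + Real.log R) + R * (c + d * R) := by
    simp_rw [add_assoc]
    rw [sum_add_distrib, sum_add_distrib, ← mul_sum, ← mul_sum, sum_Ioc_one_div_mul_succ Q R hQR, sum_const,
      nsmul_eq_mul]
    gcongr
  rw [div_eq_mul_one_div a]
  nlinarith

lemma sum_sum_divisors_le (W : ℕ → ℝ) (hW : ∀ q, 0 ≤ W q) (R : ℕ) (T : Finset ℕ) (hT : T ⊆ Ioc 0 R) :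
    ∑ m ∈ T, ∑ q ∈ m.divisors.filter (2 ≤ ·), W q ≤ R * ∑ q ∈ Ioc 1 R, W q / q := by
  have h1 : ∀ m ∈ Ioc 0 R, ∑ q ∈ m.divisors.filter (2 ≤ ·), W q
      = ∑ q ∈ Ioc 1 R, if q ∣ m then W q else 0 := fun m hm => by
    rw [← sum_filter]
    refine sum_congr ?_ fun _ _ => rfl
    ext q
    rw [mem_Ioc] at hm
    rw [mem_filter, mem_filter, Nat.mem_divisors, mem_Ioc]
    constructor
    · rintro ⟨⟨h, -⟩, h2⟩
      exact ⟨⟨by omega, (Nat.le_of_dvd hm.1 h).trans hm.2⟩, h⟩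
    · rintro ⟨⟨h1, -⟩, h⟩
      exact ⟨⟨h, by omega⟩, by omega⟩
  calc _ ≤ ∑ m ∈ Ioc 0 R, ∑ q ∈ m.divisors.filter (2 ≤ ·), W q :=
        sum_le_sum_of_subset_of_nonneg hT fun _ _ _ => sum_nonneg fun _ _ => hW _
    _ = ∑ q ∈ Ioc 1 R, ∑ m ∈ Ioc 0 R, if q ∣ m then W q else 0 := by
        rw [sum_congr rfl h1, sum_comm]
    _ ≤ ∑ q ∈ Ioc 1 R, R * (W q / q) := by
        refine sum_le_sum fun q _ => ?_
        rw [← sum_filter, sum_const, Nat.Ioc_filter_dvd_card_eq_div, nsmul_eq_mul]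
        calc ((R / q : ℕ) : ℝ) * W q ≤ (R / q) * W q := by
              gcongr
              · exact hW q
              · exact Nat.cast_div_le
          _ = _ := by ring
    _ = _ := by rw [mul_sum]

end

namespace ArithmeticFunction

lemma sum_Ioc_primCharSum_div_le (z U Q R : ℕ) (hQ : 1 ≤ Q) (hU : 1 ≤ U) (hUz : U ≤ z) (hR : R ≤ z) :
    ∑ q ∈ Ioc Q R, primCharSum z q / q ≤
      60 * (1 + Real.log z) ^ 6 * (z / (Q + 1) + 2 * z / √U * (2 + Real.log R) + 2 * √z * R)
        + 8 * U ^ 2 * Real.log z * R ^ 2 := by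
  have hl : 0 ≤ Real.log z := Real.log_natCast_nonneg z
  refine (sum_Ioc_div_le_of_sum_le (primCharSum z) Q R (a := 60 * (1 + Real.log z) ^ 6 * z)
    (b := 60 * (1 + Real.log z) ^ 6 * (2 * z / √U)) (c := 60 * (1 + Real.log z) ^ 6 * √z)
    (d := 4 * U ^ 2 * Real.log z) (by positivity) (by positivity) (by positivity) (by positivity)
    fun r hr => ?_).trans (le_of_eq (by ring))
  have h := sum_norm_vonMangoldt_primChars_le U z r hU hUz (hr.trans hR)
  have h2 : ∑ q ∈ Ioc Q r, primCharSum z q ≤ ∑ q ∈ Icc 2 r, primCharSum z q := by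
    refine sum_le_sum_of_subset_of_nonneg (fun q hq => ?_) fun _ _ _ => primCharSum_nonneg _ _
    rw [mem_Ioc] at hq
    exact mem_Icc.mpr ⟨by omega, hq.2⟩
  refine (h2.trans h).trans (le_of_eq (by ring))

lemma exists_primCharSum_le (A B : ℕ) (hB : 2 ≤ B) : ∃ C > 0, ∀ z : ℕ, 3 ≤ z → ∀ q : ℕ, 2 ≤ q →
    (q : ℝ) ≤ Real.log z ^ B → primCharSum z q / q ≤ C * z / Real.log z ^ A := by
  obtain ⟨C, hC, h⟩ := exists_norm_sum_twist_vonMangoldt_le A B hB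
  refine ⟨C, hC, fun z hz q hq hqz => ?_⟩
  have : NeZero q := ⟨by omega⟩
  have hq0 : (0 : ℝ) < q := by exact_mod_cast (by omega : 0 < q)
  have hl : 0 ≤ Real.log z := Real.log_natCast_nonneg z
  rw [div_le_iff₀ hq0]
  calc primCharSum z q ≤ ∑ χ ∈ primChars q, C * z / Real.log z ^ A :=
        sum_le_sum fun χ hχ => h z hz q χ (mem_primChars.mp hχ) (ne_one_of_mem_primChars hq hχ) hqz
    _ = (primChars q).card * (C * z / Real.log z ^ A) := by rw [sum_const, nsmul_eq_mul]
    _ ≤ q * (C * z / Real.log z ^ A) := by gcongr ?_ * _; exact card_primChars_le q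
    _ = _ := by ring

end ArithmeticFunction
namespace ArithmeticFunction

lemma exists_sum_primCharSum_div_le : ∃ C > 0, ∀ (z R : ℕ) (s t L : ℝ), 2 ≤ L → 4 ≤ t → L ^ 12 ≤ t →
    t ^ 4 ≤ s → s ≤ z → z ≤ s ^ 2 → L / 2 ≤ Real.log z → Real.log z ≤ L → R * t ^ 4 ≤ 4 * s →
    ∑ q ∈ Ioc 1 R, primCharSum z q / q ≤ C * s ^ 2 / L ^ 5 := by
  obtain ⟨C, hC, hSW⟩ := exists_primCharSum_le 16 11 (by norm_num)
  refine ⟨2 ^ 5 * C + 3840 * (2048 + 12 + 8) + 128, by positivity, ?_⟩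
  intro z R s t L hL ht hLt hts hsz hzs hzL1 hzL2 hR
  have hL1 : 1 ≤ L := by linarith
  have ht1 : 1 ≤ t := by linarith
  have ht4 : t ≤ t ^ 4 := le_self_pow₀ ht1 (by norm_num)
  have ht2 : t ^ 2 ≤ t ^ 4 := pow_le_pow_right₀ ht1 (by norm_num)
  have hs0 : 0 < s := by linarith
  have hLp : ∀ k ≤ 12, L ^ k ≤ t := fun k hk => (pow_le_pow_right₀ hL1 hk).trans hLt
  have hl0 : 0 < Real.log z := by linarith
  have hRs' : (R : ℝ) ≤ s := by
    have : (R : ℝ) * 4 ≤ R * t ^ 4 := by gcongr; linarith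
    linarith
  have hRz : R ≤ z := by exact_mod_cast hRs'.trans hsz
  have hlR : Real.log R ≤ L := by
    rcases Nat.eq_zero_or_pos R with rfl | h
    · simp; linarith
    · exact (Real.log_le_log (by exact_mod_cast h) (by exact_mod_cast hRz)).trans hzL2
  have hz3 : 3 ≤ z := by
    have : (3 : ℝ) ≤ z := by linarith
    exact_mod_cast this
  set Q := ⌊Real.log z ^ 11⌋₊ with hQ
  have hQ1 : 1 ≤ Q := Nat.le_floor (by
    rw [Nat.cast_one]
    exact one_le_pow₀ (by linarith))
  have hQle : (Q : ℝ) ≤ Real.log z ^ 11 := Nat.floor_le (by positivity)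
  have hQgt : Real.log z ^ 11 < Q + 1 := Nat.lt_floor_add_one _
  set U := ⌊t ^ 2⌋₊ with hU
  have hUle : (U : ℝ) ≤ t ^ 2 := Nat.floor_le (by positivity)
  have hUgt : t ^ 2 < U + 1 := Nat.lt_floor_add_one _
  have hU1 : 1 ≤ U := Nat.le_floor (by
    rw [Nat.cast_one]
    exact one_le_pow₀ ht1)
  have hUz : U ≤ z := by
    have : (U : ℝ) ≤ z := by linarith
    exact_mod_cast this
  have hsU : t / 2 ≤ √U := by
    refine Real.le_sqrt_of_sq_le ?_
    nlinarith
  have hsz2 : √z ≤ s := Real.sqrt_le_left hs0.le |>.mpr hzs |> fun h => h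
  have hsmall : ∑ q ∈ (Ioc 1 R).filter (· ≤ Q), primCharSum z q / q ≤ 2 ^ 5 * C * s ^ 2 / L ^ 5 := by
    have h1 : ∀ q ∈ (Ioc 1 R).filter (· ≤ Q), primCharSum z q / q ≤ C * z / Real.log z ^ 16 := fun q hq => by
      rw [mem_filter, mem_Ioc] at hq
      refine hSW z hz3 q (by omega) (le_trans (by exact_mod_cast hq.2) hQle)
    refine (sum_le_card_nsmul _ _ _ h1).trans ?_
    have hc : ((((Ioc 1 R).filter (· ≤ Q)).card : ℕ) : ℝ) ≤ Real.log z ^ 11 := by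
      refine le_trans ?_ hQle
      have : (Ioc 1 R).filter (· ≤ Q) ⊆ Ioc 0 Q := fun q hq => by
        rw [mem_filter, mem_Ioc] at hq
        exact mem_Ioc.mpr ⟨by omega, hq.2⟩
      have := card_le_card this
      rw [Nat.card_Ioc] at this
      exact_mod_cast this
    rw [nsmul_eq_mul]
    calc _ ≤ Real.log z ^ 11 * (C * s ^ 2 / Real.log z ^ 16) := by gcongr
      _ = C * s ^ 2 / Real.log z ^ 5 := by
          field_simp
      _ ≤ C * s ^ 2 / (L / 2) ^ 5 := by gcongr
      _ = _ := by
          field_simp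
  have hlarge := sum_Ioc_primCharSum_div_le z U Q R hQ1 hU1 hUz hRz
  have hsplit : ∑ q ∈ Ioc 1 R, primCharSum z q / q ≤
      ∑ q ∈ (Ioc 1 R).filter (· ≤ Q), primCharSum z q / q + ∑ q ∈ Ioc Q R, primCharSum z q / q := by
    rw [← sum_filter_add_sum_filter_not (Ioc 1 R) (· ≤ Q)]
    refine add_le_add le_rfl ?_
    refine sum_le_sum_of_subset_of_nonneg (fun q hq => ?_) fun q _ _ =>
      div_nonneg (primCharSum_nonneg _ _) (Nat.cast_nonneg q)
    rw [mem_filter, mem_Ioc] at hq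
    exact mem_Ioc.mpr ⟨lt_of_not_ge hq.2, hq.1.2⟩
  have hA : 60 * (1 + Real.log z) ^ 6 ≤ 3840 * L ^ 6 := by
    calc 60 * (1 + Real.log z) ^ 6 ≤ 60 * (2 * L) ^ 6 := by gcongr; linarith
      _ = _ := by ring
  have ht0 : 0 < t := by linarith
  have hR4 : (R : ℝ) ≤ 4 * s / t ^ 4 := by rwa [le_div_iff₀ (by positivity)]
  have hB1 : (z : ℝ) / (Q + 1) ≤ 2048 * s ^ 2 / L ^ 11 := by
    calc (z : ℝ) / (Q + 1) ≤ s ^ 2 / (L / 2) ^ 11 := by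
          gcongr
          refine le_trans ?_ hQgt.le
          gcongr
      _ = _ := by field_simp; norm_num
  have hB2 : 2 * (z : ℝ) / √U * (2 + Real.log R) ≤ 12 * s ^ 2 / L ^ 11 := by
    calc 2 * (z : ℝ) / √U * (2 + Real.log R) ≤ 2 * s ^ 2 / (t / 2) * (3 * L) := by
          gcongr
          linarith
      _ = 12 * s ^ 2 * L / t := by field_simp; norm_num
      _ ≤ 12 * s ^ 2 * L / L ^ 12 := by gcongr
      _ = _ := by field_simp
  have hB3 : 2 * √z * R ≤ 8 * s ^ 2 / L ^ 11 := by
    calc 2 * √z * R ≤ 2 * s * (4 * s / t ^ 4) := by gcongr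
      _ = 8 * s ^ 2 / t ^ 4 := by ring
      _ ≤ _ := by gcongr; exact (hLp 11 (by norm_num)).trans ht4
  have hB4 : 8 * (U : ℝ) ^ 2 * Real.log z * R ^ 2 ≤ 128 * s ^ 2 / L ^ 5 := by
    calc 8 * (U : ℝ) ^ 2 * Real.log z * R ^ 2 ≤ 8 * (t ^ 2) ^ 2 * L * (4 * s / t ^ 4) ^ 2 := by gcongr
      _ = 128 * s ^ 2 * L / t ^ 4 := by field_simp; norm_num
      _ ≤ 128 * s ^ 2 * L / L ^ 6 := by gcongr; exact (hLp 6 (by norm_num)).trans ht4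
      _ = _ := by field_simp
  have hfin : 60 * (1 + Real.log z) ^ 6 * (z / (Q + 1) + 2 * z / √U * (2 + Real.log R) + 2 * √z * R)
      ≤ 3840 * (2048 + 12 + 8) * s ^ 2 / L ^ 5 := by
    calc _ ≤ 3840 * L ^ 6 * (2048 * s ^ 2 / L ^ 11 + 12 * s ^ 2 / L ^ 11 + 8 * s ^ 2 / L ^ 11) := by
          gcongr
      _ = _ := by field_simp
  calc _ ≤ _ := hsplit
    _ ≤ 2 ^ 5 * C * s ^ 2 / L ^ 5 + (3840 * (2048 + 12 + 8) * s ^ 2 / L ^ 5 + 128 * s ^ 2 / L ^ 5) := by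
        linarith
    _ = _ := by ring

/-- An upper bound, uniform in the residue class, for the error term of `ψ(z; m, a)`. -/
noncomputable def progressionError (z m : ℕ) : ℝ :=
  1 / (m.totient : ℝ) * (|∑ n ∈ Ioc 0 z, vonMangoldt n - z|
    + ∑ q ∈ m.divisors.filter (2 ≤ ·), primCharSum z q) + m * (2 * Real.log z + 1) * Real.log z

lemma progressionError_nonneg (z m : ℕ) : 0 ≤ progressionError z m := by
  have := Real.log_natCast_nonneg z
  have : 0 ≤ ∑ q ∈ m.divisors.filter (2 ≤ ·), primCharSum z q := sum_nonneg fun _ _ => primCharSum_nonneg _ _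
  unfold progressionError
  positivity

lemma sum_progressionError_le (z R : ℕ) (T : Finset ℕ) {M L : ℝ} (hM : 0 < M) (hT : T ⊆ Ioc 0 R)
    (hR : R ≤ 4 * M) (hTM : ∀ m ∈ T, M ≤ m) (hL : 1 ≤ L) (hRL : Real.log R ≤ L) (hzL : Real.log z ≤ L) :
    ∑ m ∈ T, progressionError z m ≤ 12 * L * (|∑ n ∈ Ioc 0 z, vonMangoldt n - z|
      + ∑ q ∈ Ioc 1 R, primCharSum z q / q) + 48 * M ^ 2 * L ^ 2 := by
  set P := |∑ n ∈ Ioc 0 z, vonMangoldt n - (z : ℝ)| with hP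
  have hP0 : 0 ≤ P := abs_nonneg _
  have hlz := Real.log_natCast_nonneg z
  have hD0 : ∀ m : ℕ, 0 ≤ ∑ q ∈ m.divisors.filter (2 ≤ ·), primCharSum z q :=
    fun m => sum_nonneg fun _ _ => primCharSum_nonneg _ _
  have h1 : ∀ m ∈ T, progressionError z m ≤ 3 * L / M * (P
      + ∑ q ∈ m.divisors.filter (2 ≤ ·), primCharSum z q) + 12 * M * L ^ 2 := fun m hm => by
    have hm2 := mem_Ioc.mp (hT hm)
    have hmM := hTM m hm
    have hm0 : (0 : ℝ) < m := by exact_mod_cast hm2.1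
    have hmR : (m : ℝ) ≤ R := by exact_mod_cast hm2.2
    have hlm : Real.log m ≤ L := (Real.log_le_log hm0 hmR).trans hRL
    have h2 : (1 : ℝ) / m.totient ≤ 3 * L / M :=
      (one_div_totient_le m hm2.1).trans (by gcongr; linarith)
    have h3 : m * (2 * Real.log z + 1) * Real.log z ≤ 12 * M * L ^ 2 := by
      calc m * (2 * Real.log z + 1) * Real.log z ≤ (4 * M) * (3 * L) * L := by
            gcongr
            · linarith
            · linarith
        _ = _ := by ring
    unfold progressionError
    have := hD0 m
    gcongr
  have hcard : (T.card : ℝ) ≤ 4 * M := by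
    refine le_trans ?_ hR
    have := card_le_card hT
    rw [Nat.card_Ioc] at this
    exact_mod_cast this
  have h4 := sum_sum_divisors_le (primCharSum z) (primCharSum_nonneg z) R T hT
  have h5 : 0 ≤ ∑ q ∈ Ioc 1 R, primCharSum z q / q := sum_nonneg fun q _ =>
      div_nonneg (primCharSum_nonneg _ _) (Nat.cast_nonneg q)
  calc _ ≤ _ := sum_le_sum h1
    _ = 3 * L / M * (T.card * P + ∑ m ∈ T, ∑ q ∈ m.divisors.filter (2 ≤ ·), primCharSum z q)
        + T.card * (12 * M * L ^ 2) := by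
        rw [sum_add_distrib, ← mul_sum, sum_add_distrib, sum_const, sum_const, nsmul_eq_mul, nsmul_eq_mul]
    _ ≤ 3 * L / M * (4 * M * P + 4 * M * ∑ q ∈ Ioc 1 R, primCharSum z q / q)
        + 4 * M * (12 * M * L ^ 2) := by
        gcongr
        exact h4.trans (by gcongr)
    _ = _ := by field_simp; ring

lemma exists_sum_progressionError_le : ∃ C > 0, ∀ (z R : ℕ) (T : Finset ℕ) (s t L : ℝ), 2 ≤ L → 4 ≤ t →
    L ^ 12 ≤ t → t ^ 4 ≤ s → s ≤ z → z ≤ s ^ 2 → L / 2 ≤ Real.log z → Real.log z ≤ L →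
    R ≤ 4 * (s / t ^ 4) → T ⊆ Ioc 0 R → (∀ m ∈ T, s / t ^ 4 ≤ m) →
    ∑ m ∈ T, progressionError z m ≤ C * s ^ 2 / L ^ 4 := by
  obtain ⟨C₁, hC₁, h₁⟩ := exists_sum_primCharSum_div_le
  obtain ⟨C₂, hC₂, h₂⟩ := exists_abs_sum_vonMangoldt_sub_le 5
  refine ⟨12 * (32 * C₂ + C₁) + 48, by positivity, ?_⟩
  intro z R T s t L hL ht hLt hts hsz hzs hzL1 hzL2 hR hT hTM
  have hL1 : 1 ≤ L := by linarith
  have ht1 : 1 ≤ t := by linarith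
  have ht4 : t ≤ t ^ 4 := le_self_pow₀ ht1 (by norm_num)
  have ht0 : 0 < t := by linarith
  have hs0 : 0 < s := by linarith
  have hz3 : 3 ≤ z := by
    have : (3 : ℝ) ≤ z := by linarith
    exact_mod_cast this
  have hR' : (R : ℝ) * t ^ 4 ≤ 4 * s := by
    rwa [← le_div_iff₀ (by positivity), mul_div_assoc]
  have hRz : (R : ℝ) ≤ z := by
    have : (R : ℝ) * 4 ≤ R * t ^ 4 := by gcongr; linarith
    linarith
  have hlR : Real.log R ≤ L := by
    rcases Nat.eq_zero_or_pos R with rfl | h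
    · simp; linarith
    · exact (Real.log_le_log (by exact_mod_cast h) hRz).trans hzL2
  refine (sum_progressionError_le z R T (by positivity) hT hR hTM hL1 hlR hzL2).trans ?_
  have h3 := h₁ z R s t L hL ht hLt hts hsz hzs hzL1 hzL2 hR'
  have h4 : |∑ n ∈ Ioc 0 z, vonMangoldt n - (z : ℝ)| ≤ 32 * C₂ * s ^ 2 / L ^ 5 := by
    refine (h₂ z hz3).trans ?_
    calc C₂ * z / Real.log z ^ 5 ≤ C₂ * s ^ 2 / (L / 2) ^ 5 := by gcongr
      _ = _ := by field_simp; norm_num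
  have h5 : 48 * (s / t ^ 4) ^ 2 * L ^ 2 ≤ 48 * s ^ 2 / L ^ 4 := by
    have : L ^ 6 ≤ (t ^ 4) ^ 2 := by
      refine (pow_le_pow_right₀ hL1 (by norm_num : 6 ≤ 12)).trans (hLt.trans ?_)
      rw [← pow_mul]
      exact le_self_pow₀ ht1 (by norm_num)
    calc 48 * (s / t ^ 4) ^ 2 * L ^ 2 = 48 * s ^ 2 * L ^ 2 / (t ^ 4) ^ 2 := by field_simp
      _ ≤ 48 * s ^ 2 * L ^ 2 / L ^ 6 := by gcongr
      _ = _ := by field_simp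
  calc _ ≤ 12 * L * (32 * C₂ * s ^ 2 / L ^ 5 + C₁ * s ^ 2 / L ^ 5) + 48 * s ^ 2 / L ^ 4 := by gcongr
    _ = _ := by field_simp

end ArithmeticFunction

section

lemma psi_mono {y y' : ℝ} (h : y ≤ y') (m a : ℕ) : psi y m a ≤ psi y' m a := by
  unfold psi
  refine sum_le_sum_of_subset_of_nonneg (Icc_subset_Icc_right (Nat.floor_le_floor h)) fun n _ _ => ?_
  split_ifs
  · exact ArithmeticFunction.vonMangoldt_nonneg
  · exact le_rfl

lemma psi_zero (m a : ℕ) : psi 0 m a = 0 := by simp [psi]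

lemma exists_mul_abs_psi_sub_ge {y δ : ℝ} {m a h : ℕ} (hh : 0 < h) (hy : 0 ≤ y) (hδ : 0 < δ)
    (hhδ : h / (m.totient : ℝ) ≤ δ) (hdev : 2 * δ ≤ |psi y m a - y / (m.totient : ℝ)|) :
    ∃ j : ℕ, 1 ≤ j ∧ ((j * h : ℕ) : ℝ) ≤ y + h ∧
      δ ≤ |psi (j * h : ℕ) m a - (j * h : ℕ) / (m.totient : ℝ)| := by
  have hhr : (0 : ℝ) < h := by exact_mod_cast hh
  have hφ : (0 : ℝ) ≤ m.totient := Nat.cast_nonneg _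
  set i := ⌊y / h⌋₊ with hi
  have h1 : ((i * h : ℕ) : ℝ) ≤ y := by
    push_cast
    rw [← le_div_iff₀ hhr]
    exact Nat.floor_le (by positivity)
  have h2 : y ≤ (((i + 1) * h : ℕ) : ℝ) := by
    push_cast
    rw [← div_le_iff₀ hhr]
    exact (Nat.lt_floor_add_one _).le
  have h3 : (((i + 1) * h : ℕ) : ℝ) = ((i * h : ℕ) : ℝ) + h := by push_cast; ring
  rcases le_abs.mp hdev with hd | hd
  · refine ⟨i + 1, by omega, by rw [h3]; linarith, le_abs.mpr (Or.inl ?_)⟩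
    have h4 := psi_mono h2 m a
    have h5 : (((i + 1) * h : ℕ) : ℝ) / (m.totient : ℝ) ≤ y / m.totient + h / m.totient := by
      rw [← add_div]
      gcongr
      rw [h3]
      linarith
    linarith
  · have h4 := psi_mono h1 m a
    have h5 : y / m.totient ≤ (((i * h : ℕ) : ℝ)) / (m.totient : ℝ) + h / m.totient := by
      rw [← add_div]
      gcongr
      linarith
    have h6 : δ ≤ -(psi (i * h : ℕ) m a - (i * h : ℕ) / (m.totient : ℝ)) := by linarith
    refine ⟨i, Nat.one_le_iff_ne_zero.mpr fun h0 => ?_, by linarith, le_abs.mpr (Or.inr h6)⟩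
    rw [h0, zero_mul, Nat.cast_zero, psi_zero] at h6
    simp at h6
    linarith

lemma card_filter_le_of_sum_le {T : Finset ℕ} (f : ℕ → ℝ) (hf : ∀ m ∈ T, 0 ≤ f m) {K S : ℝ} (hK : 0 < K)
    (hS : ∑ m ∈ T, f m ≤ S) : ((T.filter (K ≤ f ·)).card : ℝ) ≤ S / K := by
  rw [le_div_iff₀ hK, ← nsmul_eq_mul]
  refine (card_nsmul_le_sum _ f K fun m hm => (mem_filter.mp hm).2).trans (le_trans ?_ hS)
  exact sum_le_sum_of_subset_of_nonneg (filter_subset _ _) fun m hm _ => hf m hm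

open Filter in
lemma eventually_log_pow_le_rpow (k : ℕ) {δ : ℝ} (hδ : 0 < δ) :
    ∀ᶠ n : ℕ in atTop, Real.log n ^ k ≤ (n : ℝ) ^ δ := by
  have h := (isLittleO_log_rpow_rpow_atTop (k : ℝ) hδ).bound one_pos
  filter_upwards [tendsto_natCast_atTop_atTop.eventually h, eventually_ge_atTop 1] with n hn hn1
  have hl : 0 ≤ Real.log n := Real.log_natCast_nonneg n
  rw [Real.rpow_natCast, one_mul, Real.norm_of_nonneg (by positivity), Real.norm_of_nonneg (by positivity)] at hn
  exact hn

end

namespace ArithmeticFunction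

lemma exists_ncard_le : ∃ C > 0, ∀ (n : ℕ) (s t L : ℝ), L = Real.log n → s ^ 2 = n → 2 ≤ L → 4 ≤ t →
    L ^ 12 ≤ t → t ^ 4 ≤ s → 120 * L ≤ s →
    (Set.ncard {m : ℕ | s / t ^ 4 ≤ m ∧ m ≤ 4 * (s / t ^ 4) ∧
      ∃ y : ℝ, 0 < y ∧ y ≤ (n : ℝ) / 2 ∧ ∃ a : ℕ, Nat.gcd a m = 1 ∧
        (n : ℝ) / (10 * (m : ℝ)) ≤ |psi y m a - y / (Nat.totient m : ℝ)|} : ℝ) ≤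
      C * (s / t ^ 4) / L ^ 3 := by
  obtain ⟨C, hC, hsum⟩ := exists_sum_progressionError_le
  refine ⟨9600 * C, by positivity, ?_⟩
  intro n s t L hLn hsn hL ht hLt hts hsL
  have hL1 : 1 ≤ L := by linarith
  have hL0 : 0 < L := by linarith
  have hs0 : 0 < s := by linarith
  have ht0 : 0 < t := by linarith
  have ht4 : 4 ≤ t ^ 4 := ht.trans (le_self_pow₀ (by linarith) (by norm_num))
  have hn0 : (0 : ℝ) < n := by rw [← hsn]; positivity
  set M := s / t ^ 4 with hM
  have hM0 : 0 < M := by positivity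
  have hMs : 4 * M ≤ s := by
    rw [hM, ← mul_div_assoc, div_le_iff₀ (by positivity)]
    nlinarith
  have hsn' : s ≤ n := by rw [← hsn]; nlinarith
  set T := (Ioc 0 ⌊4 * M⌋₊).filter (fun m : ℕ => M ≤ m) with hT
  have hR : ((⌊4 * M⌋₊ : ℕ) : ℝ) ≤ 4 * M := Nat.floor_le (by positivity)
  set h := ⌊n / (60 * L)⌋₊ with hh
  have hx : s * 2 ≤ n / (60 * L) := by
    rw [le_div_iff₀ (by positivity), ← hsn]
    nlinarith
  have hhle : (h : ℝ) ≤ n / (60 * L) := Nat.floor_le (by positivity)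
  have hhge : n / (120 * L) ≤ (h : ℝ) := by
    have h1 := Nat.lt_floor_add_one (n / (60 * L))
    have h2 : n / (60 * L) = 2 * (n / (120 * L)) := by field_simp; norm_num
    have h3 : 1 ≤ n / (120 * L) := by linarith
    linarith
  have hhs : s ≤ h := by
    have h2 : n / (60 * L) = 2 * (n / (120 * L)) := by field_simp; norm_num
    linarith
  have hh0 : 0 < h := by
    have : (0 : ℝ) < h := by linarith
    exact_mod_cast this
  set J := (Icc 1 ⌊120 * L⌋₊).filter (fun j => ((j * h : ℕ) : ℝ) ≤ n) with hJ
  set K := n / (80 * M) with hK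
  have hK0 : 0 < K := by positivity
  have hcard : ∀ j ∈ J, ((T.filter (fun m => K ≤ progressionError (j * h) m)).card : ℝ)
      ≤ C * n / L ^ 4 / K := fun j hj => by
    rw [hJ, mem_filter, mem_Icc] at hj
    refine card_filter_le_of_sum_le _ (fun m _ => progressionError_nonneg _ m) hK0 ?_
    have hz0 : s ≤ ((j * h : ℕ) : ℝ) := hhs.trans (by
      exact_mod_cast Nat.le_mul_of_pos_left h hj.1.1)
    rw [← hsn]
    refine hsum (j * h) ⌊4 * M⌋₊ T s t L hL ht hLt hts hz0 (hsn ▸ hj.2) ?_ ?_ hR (filter_subset _ _)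
      fun m hm => (mem_filter.mp hm).2
    · have : L = 2 * Real.log s := by rw [hLn, ← hsn, Real.log_pow]; norm_num
      have := Real.log_le_log hs0 hz0
      linarith
    · rw [hLn]
      exact Real.log_le_log (by linarith) hj.2
  have hsub : {m : ℕ | M ≤ m ∧ m ≤ 4 * M ∧ ∃ y : ℝ, 0 < y ∧ y ≤ (n : ℝ) / 2 ∧ ∃ a : ℕ, Nat.gcd a m = 1 ∧
        (n : ℝ) / (10 * (m : ℝ)) ≤ |psi y m a - y / (Nat.totient m : ℝ)|} ⊆
      (J.biUnion fun j => T.filter (fun m => K ≤ progressionError (j * h) m) : Finset ℕ) := by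
    rintro m ⟨hm1, hm2, y, hy0, hy, a, ha, hdev⟩
    have hm0r : (0 : ℝ) < m := by linarith
    have hm0 : 0 < m := by exact_mod_cast hm0r
    have hlm : Real.log m ≤ L := by
      rw [hLn]
      exact Real.log_le_log hm0r (by linarith)
    have hφ : (1 : ℝ) / m.totient ≤ 3 * L / m :=
      (one_div_totient_le m hm0).trans (by gcongr; linarith)
    have hδ : h / (m.totient : ℝ) ≤ n / (20 * m) := by
      calc h / (m.totient : ℝ) = h * (1 / m.totient) := by ring
        _ ≤ n / (60 * L) * (3 * L / m) := by
            gcongr ?_ * ?_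
        _ = _ := by field_simp; norm_num
    obtain ⟨j, hj1, hjy, hj⟩ := exists_mul_abs_psi_sub_ge (δ := n / (20 * m)) hh0 hy0.le (by positivity) hδ
      (le_trans (le_of_eq (by field_simp; norm_num)) hdev)
    have hjn : ((j * h : ℕ) : ℝ) ≤ n := by
      have : n / (60 * L) ≤ n / 2 := by gcongr; linarith
      linarith
    rw [mem_coe, mem_biUnion]
    refine ⟨j, mem_filter.mpr ⟨mem_Icc.mpr ⟨hj1, Nat.le_floor ?_⟩, hjn⟩, mem_filter.mpr ⟨mem_filter.mpr
      ⟨mem_Ioc.mpr ⟨hm0, Nat.le_floor hm2⟩, hm1⟩, ?_⟩⟩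
    · push_cast at hjn
      have h1 : (j : ℝ) * (n / (120 * L)) ≤ n := le_trans (by gcongr) hjn
      rw [← mul_div_assoc, div_le_iff₀ (by positivity), mul_comm] at h1
      exact le_of_mul_le_mul_left h1 hn0
    · refine le_trans ?_ (hj.trans (abs_psi_sub_le (j * h) m a hm0 ha))
      exact div_le_div_of_nonneg_left hn0.le (by positivity) (by linarith)
  calc _ ≤ ((J.biUnion fun j => T.filter (fun m => K ≤ progressionError (j * h) m)).card : ℝ) := by
        have := Set.ncard_le_ncard hsub (finite_toSet _)
        rw [Set.ncard_coe_finset] at this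
        exact_mod_cast this
    _ ≤ ∑ j ∈ J, ((T.filter (fun m => K ≤ progressionError (j * h) m)).card : ℝ) := by
        exact_mod_cast card_biUnion_le
    _ ≤ ∑ j ∈ J, C * n / L ^ 4 / K := sum_le_sum hcard
    _ = J.card * (C * n / L ^ 4 / K) := by rw [sum_const, nsmul_eq_mul]
    _ ≤ (120 * L) * (C * n / L ^ 4 / K) := by
        gcongr
        refine le_trans ?_ (Nat.floor_le (by positivity : 0 ≤ 120 * L))
        have := card_le_card (filter_subset (fun j => ((j * h : ℕ) : ℝ) ≤ n) (Icc 1 ⌊120 * L⌋₊))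
        rw [Nat.card_Icc, Nat.add_sub_cancel] at this
        exact Nat.cast_le.mpr this
    _ = _ := by rw [hK]; field_simp; norm_num

end ArithmeticFunction

end

/-- For every real `0 < ε < 1/4` there exists `C > 0` such that for all
sufficiently large `n`, the number of integers `m ∈ [n^(1/2−2ε), 4·n^(1/2−2ε)]` with
`max_{y ≤ n/2} max_{gcd(a,m)=1} |ψ(y; m, a) − y/φ(m)| ≥ n/(10m)` is at most
`C·n^(1/2−2ε)/(log n)³`. -/
theorem bad_moduli_count (ε : ℝ) (hε0 : 0 < ε) (hε1 : ε < 1 / 4) :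
    ∃ C : ℝ, 0 < C ∧ ∃ N : ℕ, ∀ n : ℕ, N ≤ n →
      (Set.ncard {m : ℕ |
          (n : ℝ) ^ ((1 : ℝ) / 2 - 2 * ε) ≤ (m : ℝ) ∧
          (m : ℝ) ≤ 4 * (n : ℝ) ^ ((1 : ℝ) / 2 - 2 * ε) ∧
          ∃ y : ℝ, 0 < y ∧ y ≤ (n : ℝ) / 2 ∧ ∃ a : ℕ, Nat.gcd a m = 1 ∧
            (n : ℝ) / (10 * (m : ℝ)) ≤ |psi y m a - y / (Nat.totient m : ℝ)|} : ℝ) ≤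
        C * (n : ℝ) ^ ((1 : ℝ) / 2 - 2 * ε) / Real.log n ^ 3 := by
  obtain ⟨C, hC, h⟩ := ArithmeticFunction.exists_ncard_le
  refine ⟨C, hC, Filter.eventually_atTop.mp ?_⟩
  have hlog := Real.tendsto_log_atTop.comp (tendsto_natCast_atTop_atTop (R := ℝ))
  filter_upwards [eventually_log_pow_le_rpow 12 (half_pos hε0),
    eventually_log_pow_le_rpow 2 (by norm_num : (0 : ℝ) < 1 / 2), Filter.eventually_ge_atTop 1,
    hlog.eventually (Filter.eventually_ge_atTop 120)] with n h1 h2 hn hL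
  have hL' : 120 ≤ Real.log n := hL
  have hn0 : (0 : ℝ) < n := by exact_mod_cast hn
  have hn1 : (1 : ℝ) ≤ n := by exact_mod_cast hn
  have e : (n : ℝ) ^ ((1 : ℝ) / 2 - 2 * ε) = (n : ℝ) ^ ((1 : ℝ) / 2) / ((n : ℝ) ^ (ε / 2)) ^ 4 := by
    rw [← Real.rpow_natCast, ← Real.rpow_mul hn0.le, ← Real.rpow_sub hn0]
    congr 1
    push_cast
    ring
  rw [e]
  refine h n _ _ _ rfl ?_ (by linarith) ?_ h1 ?_ ?_
  · rw [← Real.rpow_natCast, ← Real.rpow_mul hn0.le]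
    norm_num
  · refine le_trans ?_ h1
    exact (by linarith : (4 : ℝ) ≤ Real.log n).trans (le_self_pow₀ (by linarith) (by norm_num))
  · rw [← Real.rpow_natCast, ← Real.rpow_mul hn0.le]
    refine Real.rpow_le_rpow_of_exponent_le hn1 ?_
    push_cast
    linarith
  · nlinarith
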